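/- Let n ≥ 2 and q = 2(n+2)/n. For every ε > 0 there is a constant C_ε depending only on n and ε such that the following holds: let ω₁, ω₂ ⊆ [-1,1]^{n-1} be two cubes of side length comparable to D, with 0 < D ≤ 1 and dist(ω₁, ω₂) ≥ D, let R ≥ 1 with R^{-1} ≤ D, let B_R ⊂ ℝⁿ be a ball of radius R, let Ξᵢ ⊆ ωᵢ (i = 1,2) be finite sets of pairwise R^{-1}-separated points, and let (a_ξ) be complex coefficients. Then ‖ |∏_{i=1}^{2} Σ_{ξ ∈ Ξᵢ} a_ξ e(x·ξ + t|ξ|²)|^{1/2} ‖_{L^q_{x,t}(B_R)} ≤ C_ε R^{(n-1)/2 + ε} D^{(n-1)/2 - (n+1)/q + ε} (∏_{i=1}^{2} (Σ_{ξ ∈ Ξᵢ} |a_ξ|²)^{1/2})^{1/2}. -/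

import Mathlib

open MeasureTheory Real Complex
open scoped ENNReal

noncomputable section

/-- Axis-parallel closed cube with center `c` and half-side `r`. -/
def cube {d : ℕ} (c : Fin d → ℝ) (r : ℝ) : Set (Fin d → ℝ) :=
  Set.Icc (fun i => c i - r) (fun i => c i + r)

/-- The cube `[-1,1]^d`. -/
def bigCube (d : ℕ) : Set (Fin d → ℝ) :=
  Set.Icc (fun _ => (-1 : ℝ)) (fun _ => 1)

/-- The Euclidean ball of radius `R` centered at `z` in `ℝ^d × ℝ = ℝ^{d+1}`. -/
def ballR {d : ℕ} (z : (Fin d → ℝ) × ℝ) (R : ℝ) : Set ((Fin d → ℝ) × ℝ) :=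
  {w | (∑ i, (w.1 i - z.1 i) ^ 2) + (w.2 - z.2) ^ 2 < R ^ 2}

/-- Distance between two sets. -/
noncomputable def setDist {α : Type*} [PseudoMetricSpace α] (A B : Set α) : ℝ :=
  sInf (Set.image2 dist A B)

/-- The extension operator for the paraboloid, `E_S f(x,t) = ∫_S f(ξ) e(x·ξ + t|ξ|²) dξ`. -/
noncomputable def Eop {d : ℕ} (S : Set (Fin d → ℝ)) (f : (Fin d → ℝ) → ℂ)
    (x : Fin d → ℝ) (t : ℝ) : ℂ :=
  ∫ ξ in S, f ξ * Complex.exp (Complex.I * ((∑ i, x i * ξ i) + t * ∑ i, ξ i ^ 2))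

/-- `L²` norm of `f` on a set `S ⊆ ℝ^d`. -/
noncomputable def L2on {d : ℕ} (S : Set (Fin d → ℝ)) (f : (Fin d → ℝ) → ℂ) : ℝ :=
  (∫ ξ in S, ‖f ξ‖ ^ (2 : ℝ)) ^ ((2 : ℝ)⁻¹)

/-- The bilinear restriction inequality at exponent `q`, spatial scale `R`, frequency
separation `D`, with constant `C`: for all pairs of cubes `ω₁, ω₂ ⊆ [-1,1]^d` with
`dist(ω₁,ω₂) ≥ D`, all `f` and all balls of radius `R`,
`‖ |E_{ω₁}f E_{ω₂}f|^{1/2} ‖_{L^q(B_R)} ≤ C (‖f‖_{L²(ω₁)} ‖f‖_{L²(ω₂)})^{1/2}`. -/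
def BilinEst (d : ℕ) (q : ℝ≥0∞) (R D C : ℝ) : Prop :=
  ∀ (c₁ c₂ : Fin d → ℝ) (r₁ r₂ : ℝ),
    cube c₁ r₁ ⊆ bigCube d → cube c₂ r₂ ⊆ bigCube d →
    D ≤ setDist (cube c₁ r₁) (cube c₂ r₂) →
    ∀ (f : (Fin d → ℝ) → ℂ) (z : (Fin d → ℝ) × ℝ),
      eLpNorm (fun w : (Fin d → ℝ) × ℝ =>
          (‖Eop (cube c₁ r₁) f w.1 w.2‖ * ‖Eop (cube c₂ r₂) f w.1 w.2‖) ^ ((2 : ℝ)⁻¹)) q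
          (volume.restrict (ballR z R))
        ≤ ENNReal.ofReal (C * (L2on (cube c₁ r₁) f * L2on (cube c₂ r₂) f) ^ ((2 : ℝ)⁻¹))

/-- `C_R(q, D)`: the smallest constant `C > 0` in the bilinear restriction inequality. -/
noncomputable def CRconst (d : ℕ) (q : ℝ≥0∞) (R D : ℝ) : ℝ :=
  sInf {C : ℝ | 0 < C ∧ BilinEst d q R D C}

/-- The (spacetime) Fourier transform on `ℝ^d × ℝ`. -/
noncomputable def FT {d : ℕ} (F : (Fin d → ℝ) × ℝ → ℂ) (ζ : (Fin d → ℝ) × ℝ) : ℂ :=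
  ∫ w : (Fin d → ℝ) × ℝ, F w * Complex.exp (-(Complex.I * ((∑ i, w.1 i * ζ.1 i) + w.2 * ζ.2)))

/-- `N_S(ρ₀)`: the `ρ₀`-neighborhood of the paraboloid over `S`. -/
def Nbhd {d : ℕ} (S : Set (Fin d → ℝ)) (ρ₀ : ℝ) : Set ((Fin d → ℝ) × ℝ) :=
  {ζ | ζ.1 ∈ S ∧ |ζ.2 - ∑ i, ζ.1 i ^ 2| < ρ₀}

namespace BR

def ee (x : ℝ) : ℂ := Complex.exp ((2 * Real.pi * x : ℝ) * Complex.I)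

lemma ee_add (x y : ℝ) : ee (x + y) = ee x * ee y := by
  unfold ee; rw [← Complex.exp_add]; congr 1; push_cast; ring

lemma ee_zero : ee 0 = 1 := by simp [ee]

lemma norm_ee (x : ℝ) : ‖ee x‖ = 1 := by
  unfold ee; exact Complex.norm_exp_ofReal_mul_I _

lemma conj_ee (x : ℝ) : (starRingEnd ℂ) (ee x) = ee (-x) := by
  unfold ee
  rw [← Complex.exp_conj]; congr 1
  rw [map_mul, Complex.conj_ofReal, Complex.conj_I]; push_cast; ring

lemma ee_int (n : ℤ) : ee (n : ℝ) = 1 := by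
  unfold ee
  rw [Complex.exp_eq_one_iff]; exact ⟨n, by push_cast; ring⟩

lemma ee_sum {ι : Type*} (s : Finset ι) (f : ι → ℝ) : ee (∑ i ∈ s, f i) = ∏ i ∈ s, ee (f i) := by
  classical
  induction s using Finset.induction_on with
  | empty => simp [ee_zero]
  | insert a s ha ih => rw [Finset.sum_insert ha, Finset.prod_insert ha, ee_add, ih]

lemma ee_eq_one {x : ℝ} (h : ee x = 1) : ∃ n : ℤ, x = n := by
  unfold ee at h
  rw [Complex.exp_eq_one_iff] at h
  obtain ⟨n, hn⟩ := h
  refine ⟨n, ?_⟩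
  have h1 : ((2 * Real.pi * x : ℝ) : ℂ) * Complex.I = ((2 * Real.pi * n : ℝ) : ℂ) * Complex.I := by
    rw [hn]; push_cast; ring
  have h2 := mul_right_cancel₀ Complex.I_ne_zero h1
  have h3 : 2 * Real.pi * x = 2 * Real.pi * n := by exact_mod_cast h2
  exact mul_left_cancel₀ (by positivity) h3

lemma sum_Ico_ee (N : ℕ) (hN : 0 < N) (j : ℤ) :
    ∑ x ∈ Finset.Ico (0 : ℤ) N, ee (x * j / N) = if (N : ℤ) ∣ j then (N : ℂ) else 0 := by
  have hN' : (N : ℝ) ≠ 0 := by positivity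
  split_ifs with h
  · obtain ⟨m, rfl⟩ := h
    rw [Finset.sum_congr rfl (g := fun _ => (1 : ℂ))]
    · simp
    · intro x _
      have : ((x : ℝ) * ((N * m : ℤ) : ℝ) / N) = ((x * m : ℤ) : ℝ) := by
        push_cast; field_simp
      rw [this, ee_int]
  · set z := ee (j / N) with hz
    have hz1 : z ≠ 1 := by
      intro h1
      obtain ⟨n, hn⟩ := ee_eq_one h1
      apply h
      refine ⟨n, ?_⟩
      have : (j : ℝ) = N * n := by rw [← hn]; field_simp
      exact_mod_cast this
    have hpow : ∀ n : ℕ, ee ((n : ℝ) * j / N) = z ^ n := by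
      intro n
      induction n with
      | zero => simp [ee_zero]
      | succ n ih =>
        rw [pow_succ, ← ih, hz, ← ee_add]; congr 1; push_cast; ring
    have e1 : ∑ x ∈ Finset.Ico (0 : ℤ) N, ee (x * j / N) = ∑ n ∈ Finset.range N, z ^ n := by
      refine Finset.sum_nbij' (fun x => x.toNat) (fun n => (n : ℤ)) ?_ ?_ ?_ ?_ ?_
      · intro x hx; simp at hx ⊢; omega
      · intro x hx; simp at hx ⊢; omega
      · intro x hx; simp at hx ⊢; omega
      · intro x hx; simp
      · intro x hx
        rw [← hpow]
        have hx0 : 0 ≤ x := (Finset.mem_Ico.1 hx).1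
        lift x to ℕ using hx0
        simp
    rw [e1, geom_sum_eq hz1]
    have : z ^ N = 1 := by
      rw [← hpow]
      have : (N : ℝ) * j / N = (j : ℝ) := by field_simp
      rw [this, ee_int]
    rw [this]; simp

def box (d : ℕ) (n : ℕ) : Finset (Fin d → ℤ) := Fintype.piFinset fun _ => Finset.Ico (0 : ℤ) n

lemma mem_box {d n : ℕ} {x : Fin d → ℤ} : x ∈ box d n ↔ ∀ i, 0 ≤ x i ∧ x i < n := by
  simp [box]

lemma card_box (d n : ℕ) : ((box d n).card : ℝ) = (n : ℝ) ^ d := by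
  simp [box]

lemma sum_box_prod {R : Type*} [CommSemiring R] (d n : ℕ) (g : Fin d → ℤ → R) :
    ∑ x ∈ box d n, ∏ i, g i (x i) = ∏ i, ∑ j ∈ Finset.Ico (0 : ℤ) n, g i j := by
  rw [box, Finset.prod_univ_sum]

/-- linear phase -/
def lin {d : ℕ} (N : ℕ) (x u : Fin d → ℤ) : ℝ := ∑ i, (x i : ℝ) * u i / N

lemma lin_comm {d : ℕ} (N : ℕ) (x u : Fin d → ℤ) : lin N x u = lin N u x := by
  unfold lin; refine Finset.sum_congr rfl fun i _ => by ring

lemma lin_sub {d : ℕ} (N : ℕ) (x u v : Fin d → ℤ) : lin N x (u - v) = lin N x u - lin N x v := by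
  unfold lin; rw [← Finset.sum_sub_distrib]
  refine Finset.sum_congr rfl fun i _ => by simp; ring

lemma sum_box_ee {d : ℕ} (N : ℕ) (hN : 0 < N) (j : Fin d → ℤ) :
    ∑ x ∈ box d N, ee (lin N x j) = if (∀ i, (N : ℤ) ∣ j i) then (N : ℂ) ^ d else 0 := by
  have : ∀ x : Fin d → ℤ, ee (lin N x j) = ∏ i, ee ((x i : ℝ) * j i / N) := fun x => ee_sum _ _
  simp only [this]
  rw [sum_box_prod d N (fun i y => ee ((y : ℝ) * j i / N))]
  simp only [sum_Ico_ee N hN]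
  split_ifs with h
  · rw [Finset.prod_congr rfl (g := fun _ => (N : ℂ)) (fun i _ => if_pos (h i))]; simp
  · push Not at h
    obtain ⟨i, hi⟩ := h
    exact Finset.prod_eq_zero (Finset.mem_univ i) (if_neg hi)

lemma parseval {α β : Type*} [DecidableEq β] (X : Finset α) (S : Finset β) (χ : β → α → ℂ) (c : ℝ)
    (h : ∀ u ∈ S, ∀ v ∈ S, ∑ x ∈ X, χ u x * (starRingEnd ℂ) (χ v x) = if u = v then (c : ℂ) else 0)
    (a : β → ℂ) :
    ∑ x ∈ X, ‖∑ u ∈ S, a u * χ u x‖ ^ 2 = c * ∑ u ∈ S, ‖a u‖ ^ 2 := by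
  have key : ((∑ x ∈ X, ‖∑ u ∈ S, a u * χ u x‖ ^ 2 : ℝ) : ℂ) = ((c * ∑ u ∈ S, ‖a u‖ ^ 2 : ℝ) : ℂ) := by
    push_cast
    calc ∑ x ∈ X, ((‖∑ u ∈ S, a u * χ u x‖ : ℂ)) ^ 2
        = ∑ x ∈ X, ∑ u ∈ S, ∑ v ∈ S, (a u * (starRingEnd ℂ) (a v)) * (χ u x * (starRingEnd ℂ) (χ v x)) := by
          refine Finset.sum_congr rfl fun x _ => ?_
          rw [← Complex.mul_conj', map_sum, Finset.sum_mul_sum]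
          refine Finset.sum_congr rfl fun u _ => Finset.sum_congr rfl fun v _ => ?_
          rw [map_mul]; ring
      _ = ∑ u ∈ S, ∑ v ∈ S, (a u * (starRingEnd ℂ) (a v)) * ∑ x ∈ X, (χ u x * (starRingEnd ℂ) (χ v x)) := by
          rw [Finset.sum_comm]
          refine Finset.sum_congr rfl fun u _ => ?_
          rw [Finset.sum_comm]
          refine Finset.sum_congr rfl fun v _ => ?_
          rw [Finset.mul_sum]
      _ = ∑ u ∈ S, c * (‖a u‖ : ℂ) ^ 2 := by
          refine Finset.sum_congr rfl fun u hu => ?_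
          rw [Finset.sum_eq_single u]
          · rw [h u hu u hu, if_pos rfl, Complex.mul_conj']; ring
          · intro v hv hvu
            rw [h u hu v hv, if_neg (Ne.symm hvu), mul_zero]
          · intro h'; exact absurd hu h'
      _ = _ := by rw [Finset.mul_sum]
  exact_mod_cast key

lemma parseval_box {d : ℕ} (N : ℕ) (hN : 0 < N) (S : Finset (Fin d → ℤ))
    (hS : ∀ u ∈ S, ∀ v ∈ S, (∀ i, (N : ℤ) ∣ u i - v i) → u = v) (a : (Fin d → ℤ) → ℂ) :
    ∑ x ∈ box d N, ‖∑ u ∈ S, a u * ee (lin N x u)‖ ^ 2 = (N : ℝ) ^ d * ∑ u ∈ S, ‖a u‖ ^ 2 := by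
  apply parseval (box d N) S (fun u x => ee (lin N x u))
  intro u hu v hv
  have : ∀ x, ee (lin N x u) * (starRingEnd ℂ) (ee (lin N x v)) = ee (lin N x (u - v)) := by
    intro x; rw [conj_ee, ← ee_add, lin_sub]; congr 1
  simp only [this]
  rw [sum_box_ee N hN]
  by_cases huv : u = v
  · subst huv; simp
  · rw [if_neg huv, if_neg]
    intro h; exact huv (hS u hu v hv h)

lemma box_inj {d N : ℕ} : ∀ u ∈ box d N, ∀ v ∈ box d N, (∀ i, (N : ℤ) ∣ u i - v i) → u = v := by
  intro u hu v hv h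
  rw [mem_box] at hu hv
  funext i
  have h1 := hu i; have h2 := hv i
  have := Int.eq_zero_of_abs_lt_dvd (h i) (by rw [abs_lt]; constructor <;> omega)
  omega

def quad {d : ℕ} (N : ℕ) (u : Fin d → ℤ) : ℝ := ∑ i, (u i : ℝ) ^ 2 / (N : ℝ) ^ 2

/-- discrete free solution -/
def Phi {d : ℕ} (N : ℕ) (f : (Fin d → ℤ) → ℂ) (x : Fin d → ℤ) (t : ℤ) : ℂ :=
  ∑ u ∈ box d N, f u * ee (lin N x u + t * quad N u)

def En {d : ℕ} (N : ℕ) (f : (Fin d → ℤ) → ℂ) : ℝ := (N : ℝ) ^ d * ∑ u ∈ box d N, ‖f u‖ ^ 2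

lemma En_nonneg {d : ℕ} (N : ℕ) (f : (Fin d → ℤ) → ℂ) : 0 ≤ En N f := by
  unfold En; positivity

lemma energy {d : ℕ} (N : ℕ) (hN : 0 < N) (f : (Fin d → ℤ) → ℂ) (t : ℤ) :
    ∑ x ∈ box d N, ‖Phi N f x t‖ ^ 2 = En N f := by
  have := parseval_box (d := d) N hN (box d N) box_inj (fun u => f u * ee (t * quad N u))
  unfold En
  rw [← (show ∑ u ∈ box d N, ‖f u * ee (t * quad N u)‖ ^ 2 = ∑ u ∈ box d N, ‖f u‖ ^ 2 by
    refine Finset.sum_congr rfl fun u _ => by rw [norm_mul, norm_ee, mul_one]), ← this]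
  refine Finset.sum_congr rfl fun x _ => ?_
  congr 2; unfold Phi
  refine Finset.sum_congr rfl fun u _ => ?_
  rw [ee_add]; ring

/-- discrete Fourier transform -/
def hat {d : ℕ} (N : ℕ) (h : (Fin d → ℤ) → ℂ) (u : Fin d → ℤ) : ℂ :=
  ((N : ℂ) ^ d)⁻¹ * ∑ x ∈ box d N, h x * ee (-lin N x u)

lemma hat_energy {d : ℕ} (N : ℕ) (hN : 0 < N) (h : (Fin d → ℤ) → ℂ) :
    (N : ℝ) ^ d * ∑ u ∈ box d N, ‖hat N h u‖ ^ 2 = ∑ x ∈ box d N, ‖h x‖ ^ 2 := by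
  have := parseval (box d N) (box d N) (fun x u => ee (-lin N x u)) ((N : ℝ) ^ d) (by
    intro u hu v hv
    have : ∀ x, ee (-lin N u x) * (starRingEnd ℂ) (ee (-lin N v x)) = ee (lin N x (v - u)) := by
      intro x; rw [conj_ee, ← ee_add, lin_sub, lin_comm N u, lin_comm N v]; congr 1; ring
    simp only [this]
    rw [sum_box_ee N hN]
    by_cases huv : u = v
    · subst huv; simp
    · rw [if_neg huv, if_neg]
      intro h; exact huv (box_inj v hv u hu h).symm) h
  have hN' : (0 : ℝ) < (N : ℝ) ^ d := by positivity
  have e1 : ∀ u, ‖hat N h u‖ ^ 2 = (((N : ℝ) ^ d)⁻¹) ^ 2 * ‖∑ x ∈ box d N, h x * ee (-lin N x u)‖ ^ 2 := by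
    intro u; unfold hat; rw [norm_mul, mul_pow]; simp
  simp only [e1]
  rw [← Finset.mul_sum, this]
  field_simp

lemma hat_Phi {d : ℕ} (N : ℕ) (hN : 0 < N) (f : (Fin d → ℤ) → ℂ) (u : Fin d → ℤ) (hu : u ∈ box d N) :
    hat N (fun x => Phi N f x 0) u = f u := by
  unfold hat Phi
  have e1 : ∑ x ∈ box d N, (∑ v ∈ box d N, f v * ee (lin N x v + (0 : ℤ) * quad N v)) * ee (-lin N x u)
      = ∑ v ∈ box d N, f v * ∑ x ∈ box d N, ee (lin N x (v - u)) := by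
    simp only [Finset.sum_mul, Finset.mul_sum]
    rw [Finset.sum_comm]
    refine Finset.sum_congr rfl fun v _ => Finset.sum_congr rfl fun x _ => ?_
    rw [mul_assoc, ← ee_add, lin_sub]; congr 2; push_cast; ring
  rw [e1, Finset.sum_eq_single u]
  · rw [sum_box_ee N hN, if_pos (by simp)]
    have : (N : ℂ) ^ d ≠ 0 := by
      apply pow_ne_zero; exact_mod_cast hN.ne'
    field_simp
  · intro v hv hvu
    rw [sum_box_ee N hN, if_neg, mul_zero]
    intro h; exact hvu (box_inj v hv u hu h)
  · intro h; exact absurd hu h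

lemma hat_congr {d : ℕ} (N : ℕ) {h h' : (Fin d → ℤ) → ℂ} (hh : ∀ x ∈ box d N, h x = h' x) (u : Fin d → ℤ) :
    hat N h u = hat N h' u := by
  unfold hat; congr 1; exact Finset.sum_congr rfl fun x hx => by rw [hh x hx]

end BR

namespace BR

/-- one-dimensional weight -/
def om (M N : ℕ) (y : ℤ) : ℝ := 1 + (M : ℝ) ^ 2 * ‖ee (y / N) - 1‖ ^ 2

lemma one_le_om (M N : ℕ) (y : ℤ) : 1 ≤ om M N y := by
  unfold om; nlinarith [mul_nonneg (sq_nonneg (M : ℝ)) (sq_nonneg ‖ee (y / N) - 1‖)]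

lemma om_neg (M N : ℕ) (y : ℤ) : om M N (-y) = om M N y := by
  unfold om
  have : ‖ee (((-y : ℤ) : ℝ) / N) - 1‖ = ‖ee ((y : ℝ) / N) - 1‖ := by
    rw [← Complex.norm_conj (ee ((y : ℝ) / N) - 1), map_sub, conj_ee]
    simp [neg_div]
  rw [this]

lemma om_add (M N : ℕ) (a b : ℤ) : om M N (a + b) ≤ 2 * om M N a * om M N b := by
  unfold om
  have h : ‖ee (((a + b : ℤ) : ℝ) / N) - 1‖ ≤ ‖ee ((a : ℝ) / N) - 1‖ + ‖ee ((b : ℝ) / N) - 1‖ := by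
    have : ee (((a + b : ℤ) : ℝ) / N) - 1 = ee ((a : ℝ) / N) * (ee ((b : ℝ) / N) - 1) + (ee ((a : ℝ) / N) - 1) := by
      push_cast; rw [add_div, ee_add]; ring
    rw [this]
    refine (norm_add_le _ _).trans ?_
    rw [norm_mul, norm_ee, one_mul, add_comm]
  set A := ‖ee ((a : ℝ) / N) - 1‖
  set B := ‖ee ((b : ℝ) / N) - 1‖
  have hA : 0 ≤ A := norm_nonneg _
  have hB : 0 ≤ B := norm_nonneg _
  have h2 : ‖ee (((a + b : ℤ) : ℝ) / N) - 1‖ ^ 2 ≤ 2 * A ^ 2 + 2 * B ^ 2 := by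
    have := pow_le_pow_left₀ (norm_nonneg _) h 2
    nlinarith [sq_nonneg (A - B)]
  have h3 : (M : ℝ) ^ 2 * ‖ee (((a + b : ℤ) : ℝ) / N) - 1‖ ^ 2 ≤ (M : ℝ) ^ 2 * (2 * A ^ 2 + 2 * B ^ 2) := by
    gcongr
  have h4 : 0 ≤ ((M : ℝ) ^ 2 * A ^ 2) * ((M : ℝ) ^ 2 * B ^ 2) := by positivity
  nlinarith

/-- product weight -/
def Om {d : ℕ} (M N : ℕ) (y : Fin d → ℤ) : ℝ := ∏ i, om M N (y i)

lemma one_le_Om {d : ℕ} (M N : ℕ) (y : Fin d → ℤ) : 1 ≤ Om M N y := by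
  unfold Om
  exact Finset.one_le_prod fun i _ => one_le_om M N (y i)

lemma Om_pos {d : ℕ} (M N : ℕ) (y : Fin d → ℤ) : 0 < Om M N y := lt_of_lt_of_le one_pos (one_le_Om M N y)

lemma Om_neg {d : ℕ} (M N : ℕ) (y : Fin d → ℤ) : Om M N (-y) = Om M N y := by
  unfold Om; refine Finset.prod_congr rfl fun i _ => by rw [Pi.neg_apply, om_neg]

lemma Om_add {d : ℕ} (M N : ℕ) (a b : Fin d → ℤ) : Om M N (a + b) ≤ 2 ^ d * Om M N a * Om M N b := by
  unfold Om
  calc ∏ i, om M N ((a + b) i) ≤ ∏ i : Fin d, (2 * om M N (a i) * om M N (b i)) := by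
        refine Finset.prod_le_prod (fun i _ => by have := one_le_om M N ((a + b) i); linarith) fun i _ => om_add M N _ _
    _ = _ := by rw [Finset.prod_mul_distrib, Finset.prod_mul_distrib]; simp

lemma norm_ee_sub_one (θ : ℝ) (h : |θ| ≤ 1 / 2) : 4 * |θ| ≤ ‖ee θ - 1‖ := by
  have h1 : ‖ee θ - 1‖ = 2 * |Real.sin (π * θ)| := by
    have : ee θ - 1 = ee (θ / 2) * (2 * Complex.I * (Real.sin (π * θ) : ℂ)) := by
      have e1 : ee θ = ee (θ / 2) * ee (θ / 2) := by rw [← ee_add]; congr 1; ring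
      have e2 : ee (θ / 2) * ee (-(θ / 2)) = 1 := by rw [← ee_add]; simp [ee_zero]
      have e3 : ee (θ / 2) - ee (-(θ / 2)) = 2 * Complex.I * (Real.sin (π * θ) : ℂ) := by
        unfold ee
        rw [Complex.exp_mul_I, Complex.exp_mul_I]
        have a1 : (2 * π * (θ / 2) : ℝ) = π * θ := by ring
        have a2 : (2 * π * (-(θ / 2)) : ℝ) = -(π * θ) := by ring
        rw [a1, a2]; push_cast; rw [Complex.cos_neg, Complex.sin_neg]; ring
      rw [← e3, mul_sub, e2, ← e1]
    rw [this, norm_mul, norm_ee, one_mul, norm_mul, norm_mul, Complex.norm_real, Complex.norm_I]; simp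
  rw [h1]
  have hpi := Real.pi_pos
  have h2 : 2 / π * |π * θ| ≤ |Real.sin (π * θ)| := Real.mul_abs_le_abs_sin (by
    rw [abs_mul, abs_of_pos hpi]; nlinarith)
  rw [abs_mul, abs_of_pos hpi] at h2
  have : 2 / π * (π * |θ|) = 2 * |θ| := by field_simp
  linarith

/-- the summable profile -/
def wm (m : ℤ) : ℝ := 3 / (1 + (m : ℝ) ^ 2)

lemma wm_nonneg (m : ℤ) : 0 ≤ wm m := by unfold wm; positivity

lemma summable_wm : Summable wm := by
  have h := (Real.summable_one_div_int_pow (p := 2)).2 (by norm_num)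
  have h2 := h.mul_left 3
  have h3 : Summable fun m : ℤ => if m = 0 then (3 : ℝ) else 0 :=
    summable_of_ne_finset_zero (s := {0}) (by intro b hb; simp at hb; simp [hb])
  refine Summable.of_nonneg_of_le wm_nonneg ?_ (h2.add h3)
  intro m
  by_cases hm : m = 0
  · simp [hm, wm]
  · have : (0 : ℝ) < (m : ℝ) ^ 2 := by positivity
    simp only [hm, if_false, add_zero, wm]
    rw [mul_one_div]
    gcongr; linarith

def Cw : ℝ := 1 + ∑' m, wm m

lemma one_le_Cw : 1 ≤ Cw := by
  unfold Cw; linarith [(tsum_nonneg wm_nonneg : 0 ≤ ∑' m, wm m)]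

lemma sum_wm_le (s : Finset ℤ) : ∑ m ∈ s, wm m ≤ Cw := by
  unfold Cw
  linarith [summable_wm.sum_le_tsum s (fun m _ => wm_nonneg m)]

lemma om_bmod (M N : ℕ) (y : ℤ) (hN : 0 < N) : om M N y = om M N (Int.bmod y N) := by
  unfold om
  have h : y = N * (Int.bdiv y N) + Int.bmod y N := (Int.bdiv_add_bmod y N).symm
  have hN' : (N : ℝ) ≠ 0 := by positivity
  have h2 : (y : ℝ) / N = (Int.bdiv y N : ℤ) + (Int.bmod y N : ℝ) / N := by
    have : (y : ℝ) = N * (Int.bdiv y N : ℤ) + (Int.bmod y N : ℤ) := by exact_mod_cast h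
    rw [this]; field_simp
  rw [h2, ee_add, ee_int, one_mul]

lemma inv_om_le (M N ρ : ℕ) (hN : 0 < N) (hM : N = M * ρ) (y : ℤ) :
    (om M N y)⁻¹ ≤ wm (Int.bmod y N / ρ) := by
  rw [om_bmod M N y hN]
  set r := Int.bmod y N with hr
  have hρ : 0 < ρ := by rcases Nat.eq_zero_or_pos ρ with h | h; (subst h; simp at hM; omega); exact h
  have hMp : 0 < M := by rcases Nat.eq_zero_or_pos M with h | h; (subst h; simp at hM; omega); exact h
  have hρ' : (0 : ℝ) < ρ := by exact_mod_cast hρ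
  have hN' : (0 : ℝ) < N := by exact_mod_cast hN
  have hM' : (0 : ℝ) < M := by exact_mod_cast hMp
  have hMN : (N : ℝ) = M * ρ := by exact_mod_cast hM
  have hb : |(r : ℝ) / N| ≤ 1 / 2 := by
    have h1 := Int.le_bmod (x := y) hN
    have h2 := Int.bmod_lt (x := y) hN
    have h3 : -(N : ℤ) ≤ 2 * r := by omega
    have h4 : 2 * r ≤ (N : ℤ) := by omega
    have h3' : -(N : ℝ) ≤ 2 * r := by exact_mod_cast h3
    have h4' : 2 * (r : ℝ) ≤ (N : ℝ) := by exact_mod_cast h4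
    rw [abs_le]; constructor
    · rw [le_div_iff₀ hN']; linarith
    · rw [div_le_iff₀ hN']; linarith
  have h1 := norm_ee_sub_one _ hb
  have h2 : 1 + 16 * ((r : ℝ) / ρ) ^ 2 ≤ om M N r := by
    unfold om
    have : (4 * |(r : ℝ) / N|) ^ 2 ≤ ‖ee ((r : ℝ) / N) - 1‖ ^ 2 := by gcongr
    rw [mul_pow, sq_abs] at this
    have h3 := mul_le_mul_of_nonneg_left this (sq_nonneg (M : ℝ))
    have h4 : (M : ℝ) ^ 2 * (4 ^ 2 * ((r : ℝ) / N) ^ 2) = 16 * ((r : ℝ) / ρ) ^ 2 := by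
      rw [hMN]; field_simp; ring
    linarith
  set m := r / (ρ : ℤ) with hm
  have hm1 : (m : ℝ) ≤ (r : ℝ) / ρ := by
    rw [le_div_iff₀ hρ']
    have : m * ρ ≤ r := Int.ediv_mul_le _ (by omega)
    exact_mod_cast this
  have hm2 : (r : ℝ) / ρ < m + 1 := by
    rw [div_lt_iff₀ hρ']
    have : r < (m + 1) * ρ := Int.lt_ediv_add_one_mul_self _ (by omega)
    exact_mod_cast this
  unfold wm
  rw [inv_eq_one_div, div_le_div_iff₀ (by linarith [one_le_om M N r]) (by positivity)]
  have h5 : 1 + (m : ℝ) ^ 2 ≤ 3 * (1 + 16 * ((r : ℝ) / ρ) ^ 2) := by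
    rcases le_or_gt 0 m with h | h
    · have : (0 : ℝ) ≤ m := by exact_mod_cast h
      nlinarith
    · have : (m : ℝ) ≤ -1 := by exact_mod_cast (by omega : m ≤ -1)
      have hx : ((m : ℝ) + 1) ^ 2 ≤ ((r : ℝ) / ρ) ^ 2 := by nlinarith
      nlinarith [sq_nonneg ((m : ℝ) + 1), sq_nonneg ((m : ℝ) + 2)]
  nlinarith

lemma cell_sum {α : Type*} {d : ℕ} (M N ρ : ℕ) (hN : 0 < N) (hM : N = M * ρ) (A : Finset α)
    (y : α → Fin d → ℤ) (μ : ℝ) (hμ0 : 0 ≤ μ)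
    (h : ∀ a ∈ A, ∀ B ⊆ A, (∀ b ∈ B, ∀ i, ∃ z : ℤ, |y b i - y a i - N * z| < ρ) → (B.card : ℝ) ≤ μ) :
    ∑ a ∈ A, (Om M N (y a))⁻¹ ≤ μ * Cw ^ d := by
  classical
  have hρ : 0 < ρ := by rcases Nat.eq_zero_or_pos ρ with h | h; (subst h; simp at hM; omega); exact h
  set c : α → Fin d → ℤ := fun a i => Int.bmod (y a i) N / ρ with hc
  have h1 : ∑ a ∈ A, (Om M N (y a))⁻¹ ≤ ∑ a ∈ A, ∏ i, wm (c a i) := by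
    refine Finset.sum_le_sum fun a _ => ?_
    unfold Om; rw [← Finset.prod_inv_distrib]
    exact Finset.prod_le_prod (fun i _ => by have := one_le_om M N (y a i); positivity)
      fun i _ => inv_om_le M N ρ hN hM _
  set T : Finset (Fin d → ℤ) := Fintype.piFinset fun i => A.image fun a => c a i with hT
  have hmaps : ∀ a ∈ A, c a ∈ T := by
    intro a ha; rw [hT, Fintype.mem_piFinset]; intro i
    exact Finset.mem_image_of_mem (fun a => c a i) ha
  have h2 : ∑ a ∈ A, ∏ i, wm (c a i) = ∑ m ∈ T, ∑ a ∈ A with c a = m, ∏ i, wm (c a i) :=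
    (Finset.sum_fiberwise_of_maps_to hmaps _).symm
  have h3 : ∀ m ∈ T, ∑ a ∈ A with c a = m, ∏ i, wm (c a i) ≤ μ * ∏ i, wm (m i) := by
    intro m _
    have e : ∑ a ∈ A with c a = m, ∏ i, wm (c a i) = ((A.filter fun a => c a = m).card : ℝ) * ∏ i, wm (m i) := by
      rw [← nsmul_eq_mul, ← Finset.sum_const]
      refine Finset.sum_congr rfl fun a ha => by rw [(Finset.mem_filter.1 ha).2]
    rw [e]
    refine mul_le_mul_of_nonneg_right ?_ (Finset.prod_nonneg fun i _ => wm_nonneg _)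
    rcases (A.filter fun a => c a = m).eq_empty_or_nonempty with he | ⟨a, ha⟩
    · rw [he]; simpa using hμ0
    · rw [Finset.mem_filter] at ha
      refine h a ha.1 _ (Finset.filter_subset _ _) fun b hb i => ?_
      rw [Finset.mem_filter] at hb
      have hcc : c b i = c a i := by rw [hb.2, ha.2]
      simp only [hc] at hcc
      refine ⟨Int.bdiv (y b i) N - Int.bdiv (y a i) N, ?_⟩
      have e1 := Int.bdiv_add_bmod (y b i) N
      have e2 := Int.bdiv_add_bmod (y a i) N
      have f1 := Int.ediv_mul_le (Int.bmod (y b i) N) (b := (ρ : ℤ)) (by omega)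
      have f2 := Int.ediv_mul_le (Int.bmod (y a i) N) (b := (ρ : ℤ)) (by omega)
      have g1 := Int.lt_ediv_add_one_mul_self (Int.bmod (y b i) N) (b := (ρ : ℤ)) (by omega)
      have g2 := Int.lt_ediv_add_one_mul_self (Int.bmod (y a i) N) (b := (ρ : ℤ)) (by omega)
      rw [hcc] at f1 g1
      rw [mul_sub, abs_lt]; constructor <;> linarith
  calc _ ≤ _ := h1
    _ = _ := h2
    _ ≤ ∑ m ∈ T, μ * ∏ i, wm (m i) := Finset.sum_le_sum h3
    _ = μ * ∏ i, ∑ m ∈ A.image fun a => c a i, wm m := by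
      rw [← Finset.mul_sum, hT, Finset.prod_univ_sum]
    _ ≤ μ * ∏ i : Fin d, Cw := by
      refine mul_le_mul_of_nonneg_left ?_ hμ0
      exact Finset.prod_le_prod (fun i _ => Finset.sum_nonneg fun m _ => wm_nonneg m) fun i _ => sum_wm_le _
    _ = _ := by simp

end BR

namespace BR

/-- `C^{1,1}`-type norm bound on `[-2,3]` -/
def Nice (A : ℝ) (g : ℝ → ℂ) : Prop := ∃ a0 a1 a2 : ℝ, 0 ≤ a0 ∧ 0 ≤ a1 ∧ 0 ≤ a2 ∧ a0 + a1 + a2 / 2 ≤ A ∧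
  (∀ x, -2 ≤ x → x ≤ 3 → ‖g x‖ ≤ a0) ∧
  (∀ x h, 0 ≤ h → -2 ≤ x → x + h ≤ 3 → ‖g (x + h) - g x‖ ≤ a1 * h) ∧
  (∀ x h, 0 ≤ h → -2 ≤ x - h → x + h ≤ 3 → ‖g (x + h) - 2 * g x + g (x - h)‖ ≤ a2 * h ^ 2)

lemma Nice.mono {A B : ℝ} {g : ℝ → ℂ} (h : Nice A g) (hAB : A ≤ B) : Nice B g := by
  obtain ⟨a0, a1, a2, h0, h1, h2, hA, h3⟩ := h
  exact ⟨a0, a1, a2, h0, h1, h2, hA.trans hAB, h3⟩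

lemma Nice.mul {A B : ℝ} {f g : ℝ → ℂ} (hf : Nice A f) (hg : Nice B g) : Nice (A * B) (fun x => f x * g x) := by
  obtain ⟨a0, a1, a2, ha0, ha1, ha2, hA, f0, f1, f2⟩ := hf
  obtain ⟨b0, b1, b2, hb0, hb1, hb2, hB, g0, g1, g2⟩ := hg
  refine ⟨a0 * b0, a0 * b1 + b0 * a1, a0 * b2 + b0 * a2 + 2 * a1 * b1, by positivity, by positivity, by positivity, ?_, ?_, ?_, ?_⟩
  · calc _ ≤ (a0 + a1 + a2 / 2) * (b0 + b1 + b2 / 2) := by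
          have : 0 ≤ a1 * b2 + a2 * b1 + a2 * b2 / 2 := by positivity
          nlinarith
      _ ≤ A * B := mul_le_mul hA hB (by positivity) (by linarith)
  · intro x h1 h2
    rw [norm_mul]; exact mul_le_mul (f0 x h1 h2) (g0 x h1 h2) (norm_nonneg _) ha0
  · intro x h hh h1 h2
    have e : f (x + h) * g (x + h) - f x * g x = f (x + h) * (g (x + h) - g x) + g x * (f (x + h) - f x) := by ring
    rw [e]
    refine (norm_add_le _ _).trans ?_
    rw [norm_mul, norm_mul]
    have i1 := mul_le_mul (f0 (x + h) (by linarith) h2) (g1 x h hh h1 h2) (norm_nonneg _) ha0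
    have i2 := mul_le_mul (g0 x h1 (by linarith)) (f1 x h hh h1 h2) (norm_nonneg _) hb0
    linarith
  · intro x h hh h1 h2
    have e : f (x + h) * g (x + h) - 2 * (f x * g x) + f (x - h) * g (x - h)
      = f x * (g (x + h) - 2 * g x + g (x - h)) + g x * (f (x + h) - 2 * f x + f (x - h))
        + (f (x + h) - f x) * (g (x + h) - g x) + (f (x - h + h) - f (x - h)) * (g (x - h + h) - g (x - h)) := by
      rw [sub_add_cancel]; ring
    rw [e]
    refine (norm_add_le _ _).trans (add_le_add ((norm_add_le _ _).trans (add_le_add (norm_add_le _ _) le_rfl)) le_rfl) |>.trans ?_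
    rw [norm_mul, norm_mul, norm_mul, norm_mul]
    have i1 := mul_le_mul (f0 x (by linarith) (by linarith)) (g2 x h hh h1 h2) (norm_nonneg _) ha0
    have i2 := mul_le_mul (g0 x (by linarith) (by linarith)) (f2 x h hh h1 h2) (norm_nonneg _) hb0
    have i3 := mul_le_mul (f1 x h hh (by linarith) h2) (g1 x h hh (by linarith) h2) (norm_nonneg _) (by positivity)
    have i4 := mul_le_mul (f1 (x - h) h hh h1 (by linarith)) (g1 (x - h) h hh h1 (by linarith)) (norm_nonneg _) (by positivity)
    nlinarith

lemma Nice.add {A B : ℝ} {f g : ℝ → ℂ} (hf : Nice A f) (hg : Nice B g) : Nice (A + B) (fun x => f x + g x) := by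
  obtain ⟨a0, a1, a2, ha0, ha1, ha2, hA, f0, f1, f2⟩ := hf
  obtain ⟨b0, b1, b2, hb0, hb1, hb2, hB, g0, g1, g2⟩ := hg
  refine ⟨a0 + b0, a1 + b1, a2 + b2, by positivity, by positivity, by positivity, by linarith, ?_, ?_, ?_⟩
  · intro x h1 h2
    exact (norm_add_le _ _).trans (add_le_add (f0 x h1 h2) (g0 x h1 h2))
  · intro x h hh h1 h2
    have e : f (x + h) + g (x + h) - (f x + g x) = (f (x + h) - f x) + (g (x + h) - g x) := by ring
    rw [e, add_mul]
    exact (norm_add_le _ _).trans (add_le_add (f1 x h hh h1 h2) (g1 x h hh h1 h2))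
  · intro x h hh h1 h2
    have e : f (x + h) + g (x + h) - 2 * (f x + g x) + (f (x - h) + g (x - h))
      = (f (x + h) - 2 * f x + f (x - h)) + (g (x + h) - 2 * g x + g (x - h)) := by ring
    rw [e, add_mul]
    exact (norm_add_le _ _).trans (add_le_add (f2 x h hh h1 h2) (g2 x h hh h1 h2))

lemma Nice.const (c : ℂ) : Nice ‖c‖ (fun _ => c) := by
  refine ⟨‖c‖, 0, 0, norm_nonneg _, le_rfl, le_rfl, by simp, fun _ _ _ => le_rfl, ?_, ?_⟩
  · intros; simp
  · intros; ring_nf; simp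

lemma Nice.smul {A : ℝ} {f : ℝ → ℂ} (c : ℂ) (hf : Nice A f) : Nice (‖c‖ * A) (fun x => c * f x) :=
  (Nice.const c).mul hf

lemma Nice.id : Nice 4 (fun x => (x : ℂ)) := by
  refine ⟨3, 1, 0, by norm_num, by norm_num, le_rfl, by norm_num, ?_, ?_, ?_⟩
  · intro x h1 h2; rw [Complex.norm_real, Real.norm_eq_abs, abs_le]; constructor <;> linarith
  · intro x h hh h1 h2
    rw [← Complex.ofReal_sub, Complex.norm_real, Real.norm_eq_abs, abs_le]; constructor <;> linarith
  · intro x h hh h1 h2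
    push_cast; ring_nf; simp

lemma ee_lip (a b : ℝ) : ‖ee a - ee b‖ ≤ 2 * π * |a - b| := by
  have : ee a - ee b = ee b * (ee (a - b) - 1) := by
    rw [mul_sub, ← ee_add]; simp
  rw [this, norm_mul, norm_ee, one_mul]
  unfold ee
  rw [mul_comm]
  refine (Real.norm_exp_I_mul_ofReal_sub_one_le).trans ?_
  rw [Real.norm_eq_abs, abs_mul, abs_of_pos (by positivity)]

def Cee : ℝ := 1 + 2 * π * 6 + (4 * π + 2 * (12 * π) ^ 2) / 2

lemma Nice.ee_sq (s : ℝ) (h0 : 0 ≤ s) (h1 : s ≤ 1) : Nice Cee (fun v => ee (s * v ^ 2)) := by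
  have hpi := Real.pi_pos
  refine ⟨1, 2 * π * 6, 4 * π + 2 * (12 * π) ^ 2, by norm_num, by positivity, by positivity, le_rfl, ?_, ?_, ?_⟩
  · intro x _ _; rw [norm_ee]
  · intro x h hh hx hxh
    refine (ee_lip _ _).trans ?_
    have : s * (x + h) ^ 2 - s * x ^ 2 = s * (h * (2 * x + h)) := by ring
    rw [this, abs_mul, abs_mul, abs_of_nonneg h0, abs_of_nonneg hh]
    have h6 : |2 * x + h| ≤ 6 := by rw [abs_le]; constructor <;> linarith
    have : s * (h * |2 * x + h|) ≤ 1 * (h * 6) := by gcongr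
    nlinarith
  · intro x h hh hx hxh
    set c : ℂ := ((Real.cos (2 * π * (2 * s * x * h)) : ℝ) : ℂ) with hc
    have e0 : ee (2 * s * x * h) + ee (-(2 * s * x * h)) = 2 * c := by
      unfold ee
      rw [Complex.exp_mul_I, Complex.exp_mul_I, hc, mul_neg]
      push_cast; rw [Complex.cos_neg, Complex.sin_neg]; ring
    have e : ee (s * (x + h) ^ 2) - 2 * ee (s * x ^ 2) + ee (s * (x - h) ^ 2)
        = ee (s * x ^ 2) * ((ee (s * h ^ 2) - 1) * (2 * c) + 2 * (c - 1)) := by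
      have a1 : ee (s * (x + h) ^ 2) = ee (s * x ^ 2) * ee (s * h ^ 2) * ee (2 * s * x * h) := by
        rw [← ee_add, ← ee_add]; congr 1; ring
      have a2 : ee (s * (x - h) ^ 2) = ee (s * x ^ 2) * ee (s * h ^ 2) * ee (-(2 * s * x * h)) := by
        rw [← ee_add, ← ee_add]; congr 1; ring
      rw [a1, a2, ← e0]
      linear_combination (ee (s * x ^ 2)) * e0
    rw [e, norm_mul, norm_ee, one_mul]
    refine (norm_add_le _ _).trans ?_
    rw [norm_mul, norm_mul, norm_mul]
    have n1 : ‖ee (s * h ^ 2) - 1‖ ≤ 2 * π * h ^ 2 := by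
      have := ee_lip (s * h ^ 2) 0
      rw [ee_zero, sub_zero, abs_of_nonneg (by positivity)] at this
      refine this.trans ?_
      have : s * h ^ 2 ≤ 1 * h ^ 2 := by gcongr
      nlinarith
    have n2 : ‖c‖ ≤ 1 := by
      rw [hc, Complex.norm_real]; exact Real.abs_cos_le_one _
    have n3 : ‖c - 1‖ ≤ (12 * π) ^ 2 * h ^ 2 := by
      have : c - 1 = ((Real.cos (2 * π * (2 * s * x * h)) - 1 : ℝ) : ℂ) := by rw [hc]; push_cast; rfl
      rw [this, Complex.norm_real, Real.norm_eq_abs, abs_sub_comm, abs_of_nonneg (by linarith [Real.cos_le_one (2 * π * (2 * s * x * h))])]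
      have := Real.one_sub_sq_div_two_le_cos (x := 2 * π * (2 * s * x * h))
      have hx2 : x ^ 2 ≤ 9 := by nlinarith
      have hs2 : s ^ 2 ≤ 1 := by nlinarith
      have : (2 * π * (2 * s * x * h)) ^ 2 = 16 * π ^ 2 * (s ^ 2 * x ^ 2) * h ^ 2 := by ring
      have h9 : s ^ 2 * x ^ 2 ≤ 1 * 9 := by gcongr
      have : 16 * π ^ 2 * (s ^ 2 * x ^ 2) * h ^ 2 ≤ 16 * π ^ 2 * (1 * 9) * h ^ 2 := by gcongr
      nlinarith
    have n4 : ‖(2 : ℂ)‖ = 2 := by simp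
    rw [n4]
    have n5 : ‖ee (s * h ^ 2) - 1‖ * (2 * ‖c‖) ≤ (2 * π * h ^ 2) * (2 * 1) := by gcongr
    nlinarith

def pp (x : ℝ) : ℝ := (max x 0) ^ 2

lemma Nice.pp (c : ℝ) (h1 : -1 ≤ c) (h2 : c ≤ 2) : Nice 25 (fun x => ((pp (x - c) : ℝ) : ℂ)) := by
  unfold BR.pp
  refine ⟨16, 8, 2, by norm_num, by norm_num, by norm_num, by norm_num, ?_, ?_, ?_⟩
  · intro x hx hx'
    have : max (x - c) 0 ≤ 4 := max_le (by linarith) (by norm_num)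
    have h0 : 0 ≤ max (x - c) 0 := le_max_right _ _
    rw [Complex.norm_real, Real.norm_eq_abs, abs_of_nonneg (by positivity)]
    nlinarith
  · intro x h hh hx hx'
    rw [← Complex.ofReal_sub, Complex.norm_real, Real.norm_eq_abs, abs_le]
    rcases max_cases (x + h - c) 0 with ⟨e1, _⟩ | ⟨e1, _⟩ <;> rcases max_cases (x - c) 0 with ⟨e2, _⟩ | ⟨e2, _⟩ <;>
      rw [e1, e2] <;> constructor <;> nlinarith
  · intro x h hh hx hx'
    have e : ((((max (x + h - c) 0) ^ 2 : ℝ) : ℂ) - 2 * (((max (x - c) 0) ^ 2 : ℝ) : ℂ) + (((max (x - h - c) 0) ^ 2 : ℝ) : ℂ))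
      = (((max (x + h - c) 0) ^ 2 - 2 * (max (x - c) 0) ^ 2 + (max (x - h - c) 0) ^ 2 : ℝ) : ℂ) := by push_cast; ring
    rw [e, Complex.norm_real, Real.norm_eq_abs, abs_le]
    rcases max_cases (x + h - c) 0 with ⟨e1, _⟩ | ⟨e1, _⟩ <;> rcases max_cases (x - c) 0 with ⟨e2, _⟩ | ⟨e2, _⟩ <;>
     rcases max_cases (x - h - c) 0 with ⟨e3, _⟩ | ⟨e3, _⟩ <;>
      rw [e1, e2, e3] <;> constructor <;> nlinarith

def eta (x : ℝ) : ℝ := 2 * (pp (x - (-1)) + (-2) * pp (x - (-1/2)) + pp (x - 0)) + (-2) * (pp (x - 1) + (-2) * pp (x - 3/2) + pp (x - 2))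

lemma Nice.eta : Nice 400 (fun x => ((eta x : ℝ) : ℂ)) := by
  have a := ((Nice.pp (-1) (by norm_num) (by norm_num)).add ((Nice.pp (-1/2) (by norm_num) (by norm_num)).smul (-2))).add (Nice.pp 0 (by norm_num) (by norm_num))
  have b := ((Nice.pp (1) (by norm_num) (by norm_num)).add ((Nice.pp (3/2) (by norm_num) (by norm_num)).smul (-2))).add (Nice.pp 2 (by norm_num) (by norm_num))
  have c := (a.smul 2).add (b.smul (-2))
  refine Nice.mono (A := ‖(2 : ℂ)‖ * (25 + ‖(-2 : ℂ)‖ * 25 + 25) + ‖(-2 : ℂ)‖ * (25 + ‖(-2 : ℂ)‖ * 25 + 25)) ?_ (by simp; norm_num)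
  convert c using 2
  unfold BR.eta; push_cast; rfl

lemma eta_eq_zero (x : ℝ) (h : x ≤ -1 ∨ 2 ≤ x) : eta x = 0 := by
  unfold eta pp
  rcases h with h | h
  · rw [max_eq_right (by linarith), max_eq_right (by linarith), max_eq_right (by linarith), max_eq_right (by linarith), max_eq_right (by linarith), max_eq_right (by linarith)]; ring
  · rw [max_eq_left (by linarith), max_eq_left (by linarith), max_eq_left (by linarith), max_eq_left (by linarith), max_eq_left (by linarith), max_eq_left (by linarith)]; ring

lemma eta_eq_one (x : ℝ) (h0 : 0 ≤ x) (h1 : x ≤ 1) : eta x = 1 := by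
  unfold eta pp
  rw [max_eq_left (by linarith), max_eq_left (by linarith), max_eq_left (by linarith), max_eq_right (by linarith), max_eq_right (by linarith), max_eq_right (by linarith)]; ring

lemma eta_bd (x : ℝ) : 0 ≤ eta x ∧ eta x ≤ 1 := by
  by_cases ha : x ≤ -1
  · rw [eta_eq_zero x (Or.inl ha)]; norm_num
  by_cases hb : 2 ≤ x
  · rw [eta_eq_zero x (Or.inr hb)]; norm_num
  push Not at ha hb
  by_cases hc : x ≤ 0
  · unfold eta pp
    rw [max_eq_left (by linarith : (0:ℝ) ≤ x - (-1)), max_eq_right (by linarith : x - 0 ≤ 0), max_eq_right (by linarith : x - 1 ≤ 0),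
      max_eq_right (by linarith : x - 3 / 2 ≤ 0), max_eq_right (by linarith : x - 2 ≤ 0)]
    rcases max_cases (x - (-1/2)) 0 with ⟨e, _⟩ | ⟨e, _⟩ <;> rw [e] <;> constructor <;> nlinarith
  by_cases hd : x ≤ 1
  · rw [eta_eq_one x (by linarith) hd]; norm_num
  · unfold eta pp
    rw [max_eq_left (by linarith : (0:ℝ) ≤ x - (-1)), max_eq_left (by linarith : (0:ℝ) ≤ x - (-1/2)), max_eq_left (by linarith : 0 ≤ x - 0), max_eq_left (by linarith : 0 ≤ x - 1),
      max_eq_right (by linarith : x - 2 ≤ 0)]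
    rcases max_cases (x - 3/2) 0 with ⟨e, _⟩ | ⟨e, _⟩ <;> rw [e] <;> constructor <;> nlinarith

end BR

namespace BR

lemma om_eq (M N : ℕ) (y : ℤ) : ((om M N y : ℝ) : ℂ) = 1 + (M : ℂ) ^ 2 * (2 - ee (y / N) - ee (-(y / N))) := by
  unfold om
  push_cast
  rw [← Complex.mul_conj', map_sub, conj_ee, map_one]
  have e : ee ((y : ℝ) / N) * ee (-((y : ℝ) / N)) = 1 := by rw [← ee_add]; simp [ee_zero]
  linear_combination ((M : ℂ) ^ 2) * e

lemma sum_shift (a b : ℤ) (F : ℤ → ℂ) (h0 : ∀ j, j ≤ a → F j = 0) (h1 : ∀ j, b ≤ j → F j = 0) (s : ℤ) (hs : |s| ≤ 1) :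
    ∑ j ∈ Finset.Icc a b, F (j + s) = ∑ j ∈ Finset.Icc a b, F j := by
  rw [abs_le] at hs
  have e1 : ∑ j ∈ Finset.Icc a b, F (j + s) = ∑ j ∈ Finset.Icc (a + s) (b + s), F j := by
    refine Finset.sum_nbij' (fun j => j + s) (fun j => j - s) ?_ ?_ ?_ ?_ ?_ <;> intro j hj <;>
      simp at hj ⊢ <;> omega
  have e2 : ∀ c e : ℤ, a - 1 ≤ c → c ≤ a + 1 → b - 1 ≤ e → e ≤ b + 1 → ∑ j ∈ Finset.Icc c e, F j = ∑ j ∈ Finset.Icc (a - 1) (b + 1), F j := by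
    intro c e h1' h2' h3' h4'
    refine Finset.sum_subset (Finset.Icc_subset_Icc h1' h4') ?_
    intro j hj hj'
    simp at hj hj'
    by_cases hc : c ≤ j
    · exact h1 j (by have := hj' hc; omega)
    · exact h0 j (by omega)
  rw [e1, e2 _ _ (by omega) (by omega) (by omega) (by omega), e2 a b (by omega) (by omega) (by omega) (by omega)]

lemma kernel1 (M N : ℕ) (hM : 0 < M) (hN : 3 * M + 1 ≤ N) (A : ℝ) (G : ℝ → ℂ) (hG : Nice A G)
    (h0 : ∀ v, v ≤ -1 → G v = 0) (h1 : ∀ v, 2 ≤ v → G v = 0) (z : ℤ) :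
    ∑ y ∈ Finset.Ico (0 : ℤ) N, (om M N (z - y) * ‖∑ j ∈ Finset.Icc (-(M : ℤ)) (2 * M), G (j / M) * ee ((z - y) * j / N)‖) ^ 2
      ≤ 36 * A ^ 2 * N * M := by
  obtain ⟨a0, a1, a2, ha0, ha1, ha2, hA, g0, _, g2⟩ := hG
  have hM' : (0 : ℝ) < M := by exact_mod_cast hM
  have hM1 : (1 : ℝ) ≤ M := by exact_mod_cast hM
  have hN0 : 0 < N := by omega
  set c : ℤ → ℂ := fun j => G (j / M) with hc
  have c0 : ∀ j : ℤ, j ≤ -(M : ℤ) → c j = 0 := by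
    intro j hj; apply h0
    rw [div_le_iff₀ hM']
    have : (j : ℝ) ≤ -(M : ℝ) := by exact_mod_cast hj
    linarith
  have c1 : ∀ j : ℤ, 2 * (M : ℤ) ≤ j → c j = 0 := by
    intro j hj; apply h1
    rw [le_div_iff₀ hM']
    exact_mod_cast hj
  set b : ℤ → ℂ := fun j => c j + (M : ℂ) ^ 2 * (2 * c j - c (j - 1) - c (j + 1)) with hb
  have hbb : ∀ j ∈ Finset.Icc (-(M : ℤ)) (2 * M), ‖b j‖ ≤ 2 * A := by
    intro j hj
    rw [Finset.mem_Icc] at hj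
    have j1 : -(M : ℝ) ≤ j := by exact_mod_cast hj.1
    have j2 : (j : ℝ) ≤ 2 * M := by exact_mod_cast hj.2
    have b1 : ‖c j‖ ≤ a0 := g0 _ (by rw [le_div_iff₀ hM']; linarith) (by rw [div_le_iff₀ hM']; linarith)
    have b2 := g2 ((j : ℝ) / M) (1 / M) (by positivity)
      (by rw [← sub_div, le_div_iff₀ hM']; linarith) (by rw [← add_div, div_le_iff₀ hM']; linarith)
    rw [← add_div, ← sub_div] at b2
    have b3 : ‖2 * c j - c (j - 1) - c (j + 1)‖ ≤ a2 * (1 / M) ^ 2 := by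
      rw [← norm_neg]
      refine le_trans (le_of_eq ?_) b2
      congr 1; simp only [hc]; push_cast; ring
    calc ‖b j‖ ≤ ‖c j‖ + ‖(M : ℂ) ^ 2 * (2 * c j - c (j - 1) - c (j + 1))‖ := norm_add_le _ _
      _ ≤ a0 + (M : ℝ) ^ 2 * (a2 * (1 / M) ^ 2) := by
        rw [norm_mul, norm_pow, Complex.norm_natCast]; gcongr
      _ = a0 + a2 := by field_simp
      _ ≤ 2 * A := by linarith
  have key : ∀ Y : ℤ, ((om M N Y : ℝ) : ℂ) * ∑ j ∈ Finset.Icc (-(M : ℤ)) (2 * M), c j * ee (Y * j / N)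
      = ∑ j ∈ Finset.Icc (-(M : ℤ)) (2 * M), b j * ee (Y * j / N) := by
    intro Y
    have s1 := sum_shift (-(M : ℤ)) (2 * M) (fun j => c j * ee (Y * (j + 1) / N)) (fun j hj => by simp [c0 j hj]) (fun j hj => by simp [c1 j hj])
    have s2 := sum_shift (-(M : ℤ)) (2 * M) (fun j => c j * ee (Y * (j - 1) / N)) (fun j hj => by simp [c0 j hj]) (fun j hj => by simp [c1 j hj])
    have t1 := s1 (-1) (by norm_num)
    have t2 := s2 1 (by norm_num)
    have u1 : ∑ j ∈ Finset.Icc (-(M : ℤ)) (2 * M), c (j - 1) * ee (Y * j / N) = ee (Y / N) * ∑ j ∈ Finset.Icc (-(M : ℤ)) (2 * M), c j * ee (Y * j / N) := by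
      rw [Finset.mul_sum]
      have : ∀ j : ℤ, ee ((Y : ℝ) / N) * (c j * ee (Y * j / N)) = c j * ee (Y * (j + 1) / N) := by
        intro j; rw [mul_left_comm, ← ee_add]; congr 2; ring
      simp only [this]
      rw [← t1]
      refine Finset.sum_congr rfl fun j _ => ?_
      rw [sub_eq_add_neg]; congr 3; push_cast; ring
    have u2 : ∑ j ∈ Finset.Icc (-(M : ℤ)) (2 * M), c (j + 1) * ee (Y * j / N) = ee (-(Y / N)) * ∑ j ∈ Finset.Icc (-(M : ℤ)) (2 * M), c j * ee (Y * j / N) := by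
      rw [Finset.mul_sum]
      have : ∀ j : ℤ, ee (-((Y : ℝ) / N)) * (c j * ee (Y * j / N)) = c j * ee (Y * (j - 1) / N) := by
        intro j; rw [mul_left_comm, ← ee_add]; congr 2; ring
      simp only [this]
      rw [← t2]
      refine Finset.sum_congr rfl fun j _ => ?_
      congr 3; push_cast; ring
    have e : ∑ j ∈ Finset.Icc (-(M : ℤ)) (2 * M), b j * ee (Y * j / N)
       = (1 + 2 * (M : ℂ) ^ 2) * (∑ j ∈ Finset.Icc (-(M : ℤ)) (2 * M), c j * ee (Y * j / N))
        - (M : ℂ) ^ 2 * (∑ j ∈ Finset.Icc (-(M : ℤ)) (2 * M), c (j - 1) * ee (Y * j / N))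
        - (M : ℂ) ^ 2 * (∑ j ∈ Finset.Icc (-(M : ℤ)) (2 * M), c (j + 1) * ee (Y * j / N)) := by
      simp only [Finset.mul_sum]
      rw [← Finset.sum_sub_distrib, ← Finset.sum_sub_distrib]
      refine Finset.sum_congr rfl fun j _ => ?_
      simp only [hb]; ring
    rw [e, u1, u2, om_eq]; ring
  have step : ∀ y : ℤ, (om M N (z - y) * ‖∑ j ∈ Finset.Icc (-(M : ℤ)) (2 * M), G (j / M) * ee ((z - y) * j / N)‖) ^ 2
      = ‖∑ j ∈ Finset.Icc (-(M : ℤ)) (2 * M), (b j * ee (z * j / N)) * ee (-(y * j / N))‖ ^ 2 := by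
    intro y
    have k := key (z - y)
    have n1 : om M N (z - y) = ‖((om M N (z - y) : ℝ) : ℂ)‖ := by
      rw [Complex.norm_real, Real.norm_eq_abs, abs_of_nonneg (by linarith [one_le_om M N (z - y)])]
    rw [n1, ← norm_mul]
    congr 2
    have cc : (((z - y : ℤ) : ℝ)) = (z : ℝ) - y := by push_cast; ring
    rw [cc] at k
    rw [k]
    refine Finset.sum_congr rfl fun j _ => ?_
    rw [mul_assoc, ← ee_add]; congr 2; ring
  simp only [step]
  rw [parseval (Finset.Ico (0 : ℤ) N) (Finset.Icc (-(M : ℤ)) (2 * M)) (fun j y => ee (-(y * j / N))) N]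
  · calc (N : ℝ) * ∑ j ∈ Finset.Icc (-(M : ℤ)) (2 * M), ‖b j * ee (z * j / N)‖ ^ 2
        ≤ (N : ℝ) * ∑ j ∈ Finset.Icc (-(M : ℤ)) (2 * M), (2 * A) ^ 2 := by
          gcongr with j hj
          rw [norm_mul, norm_ee, mul_one]; exact hbb j hj
      _ = (N : ℝ) * ((3 * M + 1) * (2 * A) ^ 2) := by
          rw [Finset.sum_const, Int.card_Icc, nsmul_eq_mul]
          congr 2
          have : (2 * (M : ℤ) + 1 - -(M : ℤ)).toNat = 3 * M + 1 := by omega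
          rw [this]; push_cast; ring
      _ ≤ (N : ℝ) * ((4 * M) * (2 * A) ^ 2) := by gcongr; linarith
      _ ≤ _ := by
          have : 0 ≤ A ^ 2 * N * M := by positivity
          nlinarith
  · intro u hu v hv
    have : ∀ x : ℤ, ee (-((x : ℝ) * u / N)) * (starRingEnd ℂ) (ee (-((x : ℝ) * v / N))) = ee (x * ((v - u : ℤ) : ℝ) / N) := by
      intro x; rw [conj_ee, ← ee_add]; congr 1; push_cast; ring
    simp only [this]
    rw [sum_Ico_ee N hN0]
    rw [Finset.mem_Icc] at hu hv
    by_cases huv : u = v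
    · subst huv; simp
    · rw [if_neg huv, if_neg]
      intro h
      have := Int.eq_zero_of_abs_lt_dvd h (by rw [abs_lt]; constructor <;> omega)
      omega

def CK : ℝ := 36 * (400 * Cee) ^ 2

/-- local coordinate in a cap -/
def vv {d : ℕ} (M : ℕ) (κ u : Fin d → ℤ) (i : Fin d) : ℝ := (u i : ℝ) / M - κ i

lemma kernel {d : ℕ} (M N ρ : ℕ) (hM : 0 < M) (hNM : N = M * ρ) (hρ : 4 ≤ ρ) (κ : Fin d → ℤ)
    (hκ1 : ∀ i, 1 ≤ κ i) (hκ2 : ∀ i, κ i + 3 ≤ ρ) (g : Fin d → ℝ → ℂ) (hg : ∀ i, Nice 1 (g i))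
    (l : ℤ) (hl0 : 0 ≤ l) (hl1 : l ≤ ρ) (h : (Fin d → ℤ) → ℂ) (x : Fin d → ℤ) :
    ‖∑ u ∈ box d N, (∏ i, ((eta (vv M κ u i) : ℝ) : ℂ) * g i (vv M κ u i)) * hat N h u * ee (lin N x u + (ρ * l) * quad N u)‖ ^ 2
      ≤ (CK / ρ) ^ d * ∑ x' ∈ box d N, ‖h x'‖ ^ 2 / (Om M N (x - x' + (2 * l) • κ)) ^ 2 := by
  have hM' : (0 : ℝ) < M := by exact_mod_cast hM
  have hρ' : (0 : ℝ) < ρ := by exact_mod_cast (by omega : 0 < ρ)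
  have hN0 : 0 < N := by rw [hNM]; positivity
  have hN' : (0 : ℝ) < N := by exact_mod_cast hN0
  have hMN : (N : ℝ) = M * ρ := by exact_mod_cast hNM
  set s : ℝ := l / ρ with hs
  have hs0 : 0 ≤ s := by have : (0 : ℝ) ≤ l := by exact_mod_cast hl0
                         positivity
  have hs1 : s ≤ 1 := by rw [hs, div_le_one hρ']; exact_mod_cast hl1
  set G : Fin d → ℝ → ℂ := fun i v => (((eta v : ℝ) : ℂ) * g i v) * ee (s * v ^ 2) with hG
  have hGn : ∀ i, Nice (400 * Cee) (G i) := by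
    intro i
    have := (Nice.eta.mul (hg i)).mul (Nice.ee_sq s hs0 hs1)
    rwa [mul_one] at this
  set k : Fin d → ℤ → ℂ := fun i Y => ∑ j ∈ Finset.Icc (-(M : ℤ)) (2 * M), G i (j / M) * ee (Y * j / N) with hk
  -- one-dimensional sums
  have one : ∀ (i : Fin d) (y : ℤ), ‖∑ w ∈ Finset.Ico (0 : ℤ) N, (((eta ((w : ℝ) / M - κ i) : ℝ) : ℂ) * g i ((w : ℝ) / M - κ i)) * ee (y * w / N + (ρ * l) * ((w : ℝ) ^ 2 / (N : ℝ) ^ 2))‖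
      = ‖k i (y + 2 * l * κ i)‖ := by
    intro i y
    have e1 : ∑ w ∈ Finset.Ico (0 : ℤ) N, (((eta ((w : ℝ) / M - κ i) : ℝ) : ℂ) * g i ((w : ℝ) / M - κ i)) * ee (y * w / N + (ρ * l) * ((w : ℝ) ^ 2 / (N : ℝ) ^ 2))
       = ∑ w ∈ Finset.Icc (M * κ i - (M : ℤ)) (M * κ i + 2 * M), (((eta ((w : ℝ) / M - κ i) : ℝ) : ℂ) * g i ((w : ℝ) / M - κ i)) * ee (y * w / N + (ρ * l) * ((w : ℝ) ^ 2 / (N : ℝ) ^ 2)) := by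
      symm
      refine Finset.sum_subset ?_ ?_
      · intro w hw
        rw [Finset.mem_Icc] at hw
        rw [Finset.mem_Ico]
        have a1 := hκ1 i
        have a2 := hκ2 i
        have a3 : (N : ℤ) = M * ρ := by exact_mod_cast hNM
        have a4 : (0 : ℤ) < M := by exact_mod_cast hM
        constructor
        · nlinarith
        · nlinarith
      · intro w _ hw
        rw [eta_eq_zero, Complex.ofReal_zero, zero_mul, zero_mul]
        rw [Finset.mem_Icc, not_and_or, not_le, not_le] at hw
        rcases hw with hw | hw
        · left
          have : (w : ℝ) < M * κ i - M := by exact_mod_cast hw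
          rw [sub_le_iff_le_add, div_le_iff₀ hM']; linarith
        · right
          have : (M : ℝ) * κ i + 2 * M < w := by exact_mod_cast hw
          rw [le_sub_iff_add_le, le_div_iff₀ hM']; linarith
    have e2 : ∑ w ∈ Finset.Icc (M * κ i - (M : ℤ)) (M * κ i + 2 * M), (((eta ((w : ℝ) / M - κ i) : ℝ) : ℂ) * g i ((w : ℝ) / M - κ i)) * ee (y * w / N + (ρ * l) * ((w : ℝ) ^ 2 / (N : ℝ) ^ 2))
      = ee (y * (M * κ i) / N + l * (κ i) ^ 2 / ρ) * k i (y + 2 * l * κ i) := by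
      rw [hk, Finset.mul_sum]
      refine Finset.sum_nbij' (fun w => w - M * κ i) (fun j => j + M * κ i) ?_ ?_ ?_ ?_ ?_
      · intro w hw; simp at hw ⊢; omega
      · intro w hw; simp at hw ⊢; omega
      · intro w hw; simp
      · intro w hw; simp
      · intro w hw
        have v1 : (w : ℝ) / M - κ i = ((w - M * κ i : ℤ) : ℝ) / M := by push_cast; field_simp
        rw [v1]; simp only [hG]
        have e3 : ee (y * w / N + (ρ * l) * ((w : ℝ) ^ 2 / (N : ℝ) ^ 2)) = ee (y * (M * κ i) / N + l * (κ i) ^ 2 / ρ)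
            * ee (s * (((w - M * κ i : ℤ) : ℝ) / M) ^ 2) * ee (((y + 2 * l * κ i : ℤ) : ℝ) * ((w - M * κ i : ℤ) : ℝ) / N) := by
          rw [← ee_add, ← ee_add]
          congr 1
          rw [hs, hMN]; push_cast; field_simp; ring
        rw [e3]; ring
    rw [e1, e2, norm_mul, norm_ee, one_mul]
  -- kernel
  set K : (Fin d → ℤ) → ℂ := fun y => ∑ u ∈ box d N, (∏ i, ((eta (vv M κ u i) : ℝ) : ℂ) * g i (vv M κ u i)) * ee (lin N y u + (ρ * l) * quad N u) with hK
  have hKn : ∀ y, ‖K y‖ = ∏ i, ‖k i (y i + 2 * l * κ i)‖ := by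
    intro y
    have : K y = ∏ i, ∑ w ∈ Finset.Ico (0 : ℤ) N, (((eta ((w : ℝ) / M - κ i) : ℝ) : ℂ) * g i ((w : ℝ) / M - κ i)) * ee (y i * w / N + (ρ * l) * ((w : ℝ) ^ 2 / (N : ℝ) ^ 2)) := by
      rw [← sum_box_prod d N (fun i w => (((eta ((w : ℝ) / M - κ i) : ℝ) : ℂ) * g i ((w : ℝ) / M - κ i)) * ee (y i * w / N + (ρ * l) * ((w : ℝ) ^ 2 / (N : ℝ) ^ 2)))]
      simp only [hK]
      refine Finset.sum_congr rfl fun u _ => ?_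
      rw [Finset.prod_mul_distrib (f := fun i => ((eta ((u i : ℝ) / M - κ i) : ℝ) : ℂ) * g i ((u i : ℝ) / M - κ i)), ← ee_sum, Finset.sum_add_distrib, ← Finset.mul_sum]
      rfl
    rw [this, norm_prod]
    exact Finset.prod_congr rfl fun i _ => one i (y i)
  have hrep : ∑ u ∈ box d N, (∏ i, ((eta (vv M κ u i) : ℝ) : ℂ) * g i (vv M κ u i)) * hat N h u * ee (lin N x u + (ρ * l) * quad N u)
      = ∑ x' ∈ box d N, h x' * (((N : ℂ) ^ d)⁻¹ * K (x - x')) := by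
    simp only [hK, hat, Finset.mul_sum, Finset.sum_mul]
    rw [Finset.sum_comm]
    refine Finset.sum_congr rfl fun x' _ => Finset.sum_congr rfl fun u _ => ?_
    have : ee (lin N (x - x') u + (ρ * l) * quad N u) = ee (-lin N x' u) * ee (lin N x u + (ρ * l) * quad N u) := by
      rw [← ee_add, lin_comm N (x - x'), lin_sub, lin_comm N u, lin_comm N u]; congr 1; ring
    rw [this]; ring
  rw [hrep]
  have cs : ‖∑ x' ∈ box d N, h x' * (((N : ℂ) ^ d)⁻¹ * K (x - x'))‖ ^ 2
      ≤ (∑ x' ∈ box d N, (‖h x'‖ / Om M N (x - x' + (2 * l) • κ)) ^ 2) * ∑ x' ∈ box d N, (((N : ℝ) ^ d)⁻¹ * (Om M N (x - x' + (2 * l) • κ) * ‖K (x - x')‖)) ^ 2 := by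
    refine le_trans (pow_le_pow_left₀ (norm_nonneg _) (norm_sum_le _ _) 2) ?_
    refine le_trans (le_of_eq ?_) (Finset.sum_mul_sq_le_sq_mul_sq _ _ _)
    congr 1
    refine Finset.sum_congr rfl fun x' _ => ?_
    have := (Om_pos M N (x - x' + (2 * l) • κ)).ne'
    generalize Om M N (x - x' + (2 * l) • κ) = W at this ⊢
    rw [norm_mul, norm_mul]; simp; field_simp
  refine cs.trans ?_
  rw [mul_comm]
  refine mul_le_mul ?_ (le_of_eq ?_) (Finset.sum_nonneg fun _ _ => by positivity) (by unfold CK; positivity)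
  · calc ∑ x' ∈ box d N, (((N : ℝ) ^ d)⁻¹ * (Om M N (x - x' + (2 * l) • κ) * ‖K (x - x')‖)) ^ 2
        = (((N : ℝ) ^ d)⁻¹) ^ 2 * ∑ x' ∈ box d N, ∏ i, (om M N ((x i + 2 * l * κ i) - x' i) * ‖k i ((x i + 2 * l * κ i) - x' i)‖) ^ 2 := by
          rw [Finset.mul_sum]
          refine Finset.sum_congr rfl fun x' _ => ?_
          rw [mul_pow, hKn, Finset.prod_pow, Finset.prod_mul_distrib]
          unfold Om
          congr 3
          · refine Finset.prod_congr rfl fun i _ => ?_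
            congr 1; simp; ring
          · refine Finset.prod_congr rfl fun i _ => ?_
            congr 2; simp; ring
      _ = (((N : ℝ) ^ d)⁻¹) ^ 2 * ∏ i, ∑ y ∈ Finset.Ico (0 : ℤ) N, (om M N ((x i + 2 * l * κ i) - y) * ‖k i ((x i + 2 * l * κ i) - y)‖) ^ 2 := by
          rw [sum_box_prod d N (fun i y => (om M N ((x i + 2 * l * κ i) - y) * ‖k i ((x i + 2 * l * κ i) - y)‖) ^ 2)]
      _ ≤ (((N : ℝ) ^ d)⁻¹) ^ 2 * ∏ i : Fin d, (36 * (400 * Cee) ^ 2 * N * M) := by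
          gcongr with i _
          have := kernel1 M N hM (by rw [hNM]; nlinarith) _ (G i) (hGn i)
            (fun v hv => by simp only [hG]; rw [eta_eq_zero v (Or.inl hv)]; simp)
            (fun v hv => by simp only [hG]; rw [eta_eq_zero v (Or.inr hv)]; simp) (x i + 2 * l * κ i)
          refine le_trans (le_of_eq ?_) this
          refine Finset.sum_congr rfl fun y _ => ?_
          simp only [hk]
          push_cast; rfl
      _ = (CK / ρ) ^ d := by
          rw [Finset.prod_const, Finset.card_univ, Fintype.card_fin]
          unfold CK
          rw [← inv_pow, ← pow_mul, mul_comm d 2, pow_mul, ← mul_pow]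
          congr 1
          rw [hMN]; field_simp
  · refine Finset.sum_congr rfl fun x' _ => by rw [div_pow]

end BR

namespace BR

def Nrm {α : Type*} (p : ℝ) (Z : Finset α) (h : α → ℂ) : ℝ := (∑ z ∈ Z, ‖h z‖ ^ p) ^ (1 / p)

section
variable {α : Type*} {p : ℝ} {Z : Finset α}

lemma Nrm_nonneg (h : α → ℂ) : 0 ≤ Nrm p Z h := by
  unfold Nrm; exact Real.rpow_nonneg (Finset.sum_nonneg fun z _ => Real.rpow_nonneg (norm_nonneg _) _) _

lemma Nrm_mono (hp : 1 ≤ p) {h g : α → ℂ} (hh : ∀ z ∈ Z, ‖h z‖ ≤ ‖g z‖) : Nrm p Z h ≤ Nrm p Z g := by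
  unfold Nrm
  gcongr with z hz
  · exact hh z hz

lemma Nrm_congr {h g : α → ℂ} (hh : ∀ z ∈ Z, ‖h z‖ = ‖g z‖) : Nrm p Z h = Nrm p Z g := by
  unfold Nrm
  rw [Finset.sum_congr rfl fun z hz => by rw [hh z hz]]

lemma Nrm_add (hp : 1 ≤ p) (h g : α → ℂ) : Nrm p Z (fun z => h z + g z) ≤ Nrm p Z h + Nrm p Z g := by
  unfold Nrm
  refine le_trans ?_ (Real.Lp_add_le_of_nonneg Z hp (fun z _ => norm_nonneg (h z)) (fun z _ => norm_nonneg (g z)))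
  gcongr with z hz
  · exact norm_add_le _ _

lemma Nrm_zero (hp : 1 ≤ p) : Nrm p Z (fun _ => 0) = 0 := by
  have : p ≠ 0 := by linarith
  simp [Nrm, Real.zero_rpow this, this]

lemma Nrm_sum (hp : 1 ≤ p) {β : Type*} (S : Finset β) (h : β → α → ℂ) :
    Nrm p Z (fun z => ∑ b ∈ S, h b z) ≤ ∑ b ∈ S, Nrm p Z (h b) := by
  classical
  induction S using Finset.induction_on with
  | empty => simp [Nrm_zero hp]
  | insert a s ha ih =>
    simp only [Finset.sum_insert ha]
    exact (Nrm_add hp _ _).trans (add_le_add le_rfl ih)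

lemma Nrm_mul (hp : 1 ≤ p) (c h : α → ℂ) (b : ℝ) (hb : 0 ≤ b) (hc : ∀ z ∈ Z, ‖c z‖ ≤ b) :
    Nrm p Z (fun z => c z * h z) ≤ b * Nrm p Z h := by
  unfold Nrm
  have hp0 : 0 < p := by linarith
  have : b * (∑ z ∈ Z, ‖h z‖ ^ p) ^ (1 / p) = (∑ z ∈ Z, (b * ‖h z‖) ^ p) ^ (1 / p) := by
    have e : ∑ z ∈ Z, (b * ‖h z‖) ^ p = b ^ p * ∑ z ∈ Z, ‖h z‖ ^ p := by
      rw [Finset.mul_sum]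
      exact Finset.sum_congr rfl fun z _ => Real.mul_rpow hb (norm_nonneg _)
    rw [e, Real.mul_rpow (Real.rpow_nonneg hb _) (Finset.sum_nonneg fun z _ => Real.rpow_nonneg (norm_nonneg _) _),
      ← Real.rpow_mul hb, mul_one_div_cancel hp0.ne', Real.rpow_one]
  rw [this]
  gcongr with z hz
  · rw [norm_mul]; exact mul_le_mul_of_nonneg_right (hc z hz) (norm_nonneg _)

lemma Nrm_le_l1 (hp : 1 ≤ p) (h : α → ℂ) : Nrm p Z h ≤ ∑ z ∈ Z, ‖h z‖ := by
  unfold Nrm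
  have hp0 : 0 < p := by linarith
  set S := ∑ z ∈ Z, ‖h z‖ with hS
  have hS0 : 0 ≤ S := Finset.sum_nonneg fun z _ => norm_nonneg _
  have : ∑ z ∈ Z, ‖h z‖ ^ p ≤ S ^ p := by
    calc ∑ z ∈ Z, ‖h z‖ ^ p ≤ ∑ z ∈ Z, ‖h z‖ * S ^ (p - 1) := by
          refine Finset.sum_le_sum fun z hz => ?_
          have e : ‖h z‖ ^ p = ‖h z‖ * ‖h z‖ ^ (p - 1) := by
            rcases eq_or_lt_of_le (norm_nonneg (h z)) with h0 | h0
            · rw [← h0, Real.zero_rpow hp0.ne', zero_mul]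
            · nth_rw 2 [← Real.rpow_one ‖h z‖]
              rw [← Real.rpow_add h0]; congr 1; ring
          rw [e]
          have : ‖h z‖ ≤ S := Finset.single_le_sum (f := fun z => ‖h z‖) (fun z _ => norm_nonneg _) hz
          have hp1 : 0 ≤ p - 1 := by linarith
          gcongr
      _ = S * S ^ (p - 1) := by rw [← Finset.sum_mul]
      _ = S ^ p := by
          rcases eq_or_lt_of_le hS0 with h0 | h0
          · rw [← h0, Real.zero_rpow hp0.ne', zero_mul]
          · nth_rw 1 [← Real.rpow_one S]
            rw [← Real.rpow_add h0]; congr 1; ring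
  calc _ ≤ (S ^ p) ^ (1 / p) := by
        gcongr
    _ = S := by rw [← Real.rpow_mul hS0, mul_one_div_cancel hp0.ne', Real.rpow_one]

lemma taylor (hp : 1 ≤ p) {β ι : Type*} [Fintype ι] (Q : Finset β) (A : α → β → ℂ) (X : α → ι → ℝ) (U : β → ι → ℝ)
    (b B : ℝ) (hb : 0 ≤ b) (hB : 0 ≤ B) (hX : ∀ z ∈ Z, ∀ i, |X z i| ≤ b)
    (h : ∀ (m : ℕ) (w : Fin m → ι), Nrm p Z (fun z => ∑ q ∈ Q, A z q * ((∏ l, U q (w l) : ℝ) : ℂ)) ≤ B) :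
    Nrm p Z (fun z => ∑ q ∈ Q, A z q * Complex.exp (Complex.I * ((∑ i, X z i * U q i : ℝ) : ℂ)))
      ≤ Real.exp (b * Fintype.card ι) * B := by
  classical
  set T : ℕ → α → ℂ := fun K z => ∑ q ∈ Q, A z q * ∑ m ∈ Finset.range K, (Complex.I * ((∑ i, X z i * U q i : ℝ) : ℂ)) ^ m / (m.factorial : ℂ) with hT
  have hlim : Filter.Tendsto (fun K => Nrm p Z (T K)) Filter.atTop (nhds (Nrm p Z (fun z => ∑ q ∈ Q, A z q * Complex.exp (Complex.I * ((∑ i, X z i * U q i : ℝ) : ℂ))))) := by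
    have hp0 : 0 < p := by linarith
    unfold Nrm
    refine Filter.Tendsto.rpow_const ?_ (Or.inr (by positivity))
    refine tendsto_finsetSum _ fun z _ => ?_
    refine Filter.Tendsto.rpow_const ?_ (Or.inr hp0.le)
    refine Filter.Tendsto.norm ?_
    refine tendsto_finsetSum _ fun q _ => ?_
    refine Filter.Tendsto.const_mul _ ?_
    rw [Complex.exp_eq_exp_ℂ]
    exact (NormedSpace.expSeries_div_hasSum_exp (Complex.I * ((∑ i, X z i * U q i : ℝ) : ℂ))).tendsto_sum_nat
  refine le_of_tendsto' hlim fun K => ?_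
  have e1 : T K = fun z => ∑ m ∈ Finset.range K, ∑ w : Fin m → ι, (Complex.I ^ m / (m.factorial : ℂ) * ((∏ l, X z (w l) : ℝ) : ℂ)) * (∑ q ∈ Q, A z q * ((∏ l, U q (w l) : ℝ) : ℂ)) := by
    funext z
    simp only [hT, Finset.mul_sum]
    rw [Finset.sum_comm]
    refine Finset.sum_congr rfl fun m _ => ?_
    rw [Finset.sum_comm]
    refine Finset.sum_congr rfl fun q _ => ?_
    rw [mul_pow, ← Complex.ofReal_pow, Fintype.sum_pow]
    push_cast
    rw [Finset.mul_sum, Finset.sum_div, Finset.mul_sum]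
    refine Finset.sum_congr rfl fun w _ => ?_
    rw [Finset.prod_mul_distrib]; ring
  rw [e1]
  refine (Nrm_sum hp _ _).trans ?_
  have e2 : ∀ m ∈ Finset.range K, Nrm p Z (fun z => ∑ w : Fin m → ι, (Complex.I ^ m / (m.factorial : ℂ) * ((∏ l, X z (w l) : ℝ) : ℂ)) * (∑ q ∈ Q, A z q * ((∏ l, U q (w l) : ℝ) : ℂ)))
      ≤ (b * Fintype.card ι) ^ m / m.factorial * B := by
    intro m _
    refine (Nrm_sum hp _ _).trans ?_
    calc _ ≤ ∑ w : Fin m → ι, (b ^ m / m.factorial) * B := by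
          refine Finset.sum_le_sum fun w _ => ?_
          refine (Nrm_mul hp _ _ (b ^ m / m.factorial) (by positivity) ?_).trans (mul_le_mul_of_nonneg_left (h m w) (by positivity))
          intro z hz
          rw [norm_mul, norm_div, norm_pow, Complex.norm_I, one_pow, Complex.norm_natCast, Complex.norm_real, Real.norm_eq_abs,
            Finset.abs_prod, one_div, div_eq_inv_mul]
          gcongr
          calc ∏ l, |X z (w l)| ≤ ∏ l : Fin m, b := Finset.prod_le_prod (fun _ _ => abs_nonneg _) fun l _ => hX z hz _
            _ = b ^ m := by simp
      _ = _ := by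
          rw [Finset.sum_const, Finset.card_univ, Fintype.card_fun, Fintype.card_fin, nsmul_eq_mul, mul_pow]
          push_cast; ring
  refine (Finset.sum_le_sum e2).trans ?_
  rw [← Finset.sum_mul]
  gcongr
  exact Real.sum_le_exp_of_nonneg (by positivity) K

lemma interp (h1 : 1 < p) (h2 : p ≤ 2) (h : α → ℂ) :
    ∑ z ∈ Z, ‖h z‖ ^ p ≤ (∑ z ∈ Z, ‖h z‖) ^ (2 - p) * (∑ z ∈ Z, ‖h z‖ ^ 2) ^ (p - 1) := by
  rcases eq_or_lt_of_le h2 with rfl | h2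
  · norm_num
  have hh := Real.inner_le_Lp_mul_Lq_of_nonneg (p := 1 / (2 - p)) (q := 1 / (p - 1)) Z (f := fun z => ‖h z‖ ^ (2 - p)) (g := fun z => (‖h z‖ ^ 2) ^ (p - 1))
    (by
      rw [Real.holderConjugate_iff]
      refine ⟨by rw [lt_div_iff₀ (by linarith)]; linarith, by simp; ring⟩)
    (fun z _ => by positivity) (fun z _ => by positivity)
  have a1 : 2 - p ≠ 0 := by linarith
  have a2 : p - 1 ≠ 0 := by linarith
  refine le_trans (le_of_eq ?_) (hh.trans (le_of_eq ?_))
  · refine Finset.sum_congr rfl fun z _ => ?_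
    rcases eq_or_lt_of_le (norm_nonneg (h z)) with h0 | h0
    · rw [← h0, Real.zero_rpow (by linarith), Real.zero_rpow a1, zero_mul]
    · rw [← Real.rpow_natCast, ← Real.rpow_mul h0.le, ← Real.rpow_add h0]
      congr 1; push_cast; ring
  · have b1 : ∀ z, (‖h z‖ ^ (2 - p)) ^ (1 / (2 - p)) = ‖h z‖ := fun z => by
      rw [← Real.rpow_mul (norm_nonneg _), mul_one_div_cancel a1, Real.rpow_one]
    have b2 : ∀ z, ((‖h z‖ ^ 2) ^ (p - 1)) ^ (1 / (p - 1)) = ‖h z‖ ^ 2 := fun z => by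
      rw [← Real.rpow_mul (by positivity), mul_one_div_cancel a2, Real.rpow_one]
    simp only [b1, b2, one_div_one_div]

end

end BR

namespace BR

section
variable {d : ℕ}

/-- integer height of a cap -/
def Hc (ρ : ℕ) (κ : Fin d → ℤ) : ℤ := ∑ i, κ i ^ 2 / (ρ : ℤ)

/-- phase of a cap on a cell -/
def ce (ρ : ℕ) (κ : Fin d → ℤ) (z : (Fin d → ℤ) × ℤ) : ℂ := ee (lin ρ z.1 κ + z.2 * Hc ρ κ / ρ)

/-- the cut-off to a cap -/
def cut (M : ℕ) (κ u : Fin d → ℤ) : ℂ := ∏ i, ((eta (vv M κ u i) : ℝ) : ℂ)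

def bq (M N ρ : ℕ) (a : Fin d → ℤ) (l : ℤ) (κ : Fin d → ℤ) (g : Fin d → ℝ → ℂ) (h : (Fin d → ℤ) → ℂ) : ℂ :=
  ∑ u ∈ box d N, (∏ i, ((eta (vv M κ u i) : ℝ) : ℂ) * g i (vv M κ u i)) * hat N h u * ee (lin N ((ρ : ℤ) • a) u + (ρ * l) * quad N u)

def FF (M N : ℕ) (Q : Finset (Fin d → ℤ)) (h : (Fin d → ℤ) → (Fin d → ℤ) → ℂ) (x : Fin d → ℤ) (t : ℤ) : ℂ :=
  ∑ κ ∈ Q, ∑ u ∈ box d N, cut M κ u * hat N (h κ) u * ee (lin N x u + t * quad N u)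

def cellZ (d ρ : ℕ) : Finset ((Fin d → ℤ) × ℤ) := box d ρ ×ˢ Finset.Ico (0 : ℤ) ρ

/-- Taylor variables -/
def Uf (ρ : ℕ) (κ : Fin d → ℤ) (s : Fin d × Bool) (v : ℝ) : ℝ :=
  (if s.2 then 2 * (κ s.1 / ρ) * v + v ^ 2 / ρ + ((κ s.1 : ℝ) ^ 2 / ρ - ((κ s.1 ^ 2 / (ρ : ℤ) : ℤ) : ℝ)) else v) / 25

def Xf (ρ : ℕ) (z : (Fin d → ℤ) × ℤ) (s : Fin d × Bool) : ℝ :=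
  2 * π * 25 * ((if s.2 then (z.2 : ℝ) else (z.1 s.1 : ℝ)) / ρ)

lemma Nice.Uf (ρ : ℕ) (hρ : 1 ≤ ρ) (κ : Fin d → ℤ) (h1 : ∀ i, 0 ≤ κ i) (h2 : ∀ i, κ i ≤ ρ) (s : Fin d × Bool) :
    Nice 1 (fun v => ((Uf ρ κ s v : ℝ) : ℂ)) := by
  have hρ' : (0 : ℝ) < ρ := by exact_mod_cast hρ
  have hρ1 : (1 : ℝ) ≤ ρ := by exact_mod_cast hρ
  unfold BR.Uf
  rcases s with ⟨i, b⟩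
  cases b
  · simp only [Bool.false_eq_true, if_false]
    have := (Nice.id).smul (1 / 25)
    refine (Nice.mono (A := ‖(1 / 25 : ℂ)‖ * 4) ?_ (by norm_num))
    convert this using 2
    push_cast; ring
  · simp only [if_true]
    have hk0 : (0 : ℝ) ≤ κ i / ρ := by
      have : (0 : ℝ) ≤ κ i := by exact_mod_cast h1 i
      positivity
    have hk1 : (κ i : ℝ) / ρ ≤ 1 := by
      rw [div_le_one hρ']; exact_mod_cast h2 i
    set fr : ℝ := (κ i : ℝ) ^ 2 / ρ - ((κ i ^ 2 / (ρ : ℤ) : ℤ) : ℝ) with hfr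
    have hf0 : 0 ≤ fr := by
      rw [hfr, sub_nonneg, le_div_iff₀ hρ']
      have : κ i ^ 2 / (ρ : ℤ) * ρ ≤ κ i ^ 2 := Int.ediv_mul_le _ (by omega)
      exact_mod_cast this
    have hf1 : fr ≤ 1 := by
      rw [hfr, sub_le_iff_le_add, div_le_iff₀ hρ']
      have : κ i ^ 2 < (κ i ^ 2 / (ρ : ℤ) + 1) * ρ := Int.lt_ediv_add_one_mul_self _ (by omega)
      have : ((κ i : ℝ)) ^ 2 < (((κ i ^ 2 / (ρ : ℤ) : ℤ) : ℝ) + 1) * ρ := by exact_mod_cast this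
      linarith
    have n1 := (Nice.id).smul ((2 * (κ i / ρ) : ℝ) : ℂ)
    have n2 := ((Nice.id).mul Nice.id).smul ((1 / ρ : ℝ) : ℂ)
    have n3 := ((n1.add n2).add (Nice.const (fr : ℂ))).smul ((1 / 25 : ℝ) : ℂ)
    have e1 : ‖((2 * (κ i / ρ) : ℝ) : ℂ)‖ ≤ 2 := by
      rw [Complex.norm_real, Real.norm_eq_abs, abs_of_nonneg (by positivity)]; linarith
    have e2 : ‖((1 / ρ : ℝ) : ℂ)‖ ≤ 1 := by
      rw [Complex.norm_real, Real.norm_eq_abs, abs_of_nonneg (by positivity), div_le_one hρ']; exact hρ1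
    have e3 : ‖(fr : ℂ)‖ ≤ 1 := by
      rw [Complex.norm_real, Real.norm_eq_abs, abs_of_nonneg hf0]; exact hf1
    have e4 : ‖((1 / 25 : ℝ) : ℂ)‖ = 1 / 25 := by
      rw [Complex.norm_real, Real.norm_eq_abs, abs_of_nonneg (by norm_num)]
    refine Nice.mono (A := ‖((1 / 25 : ℝ) : ℂ)‖ * (‖((2 * (κ i / ρ) : ℝ) : ℂ)‖ * 4 + ‖((1 / ρ : ℝ) : ℂ)‖ * (4 * 4) + ‖(fr : ℂ)‖)) ?_ ?_
    · convert n3 using 2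
      push_cast; ring
    · rw [e4]; linarith

lemma Nice.prod {ι : Type*} (S : Finset ι) (f : ι → ℝ → ℂ) (h : ∀ i ∈ S, Nice 1 (f i)) :
    Nice 1 (fun v => ∏ i ∈ S, f i v) := by
  classical
  induction S using Finset.induction_on with
  | empty => simpa using (Nice.const 1)
  | insert a s ha ih =>
    simp only [Finset.prod_insert ha]
    have := (h a (Finset.mem_insert_self _ _)).mul (ih fun i hi => h i (Finset.mem_insert_of_mem hi))
    rwa [mul_one] at this

def CT (d : ℕ) : ℝ := Real.exp (2 * π * 25 * Fintype.card (Fin d × Bool))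

lemma one_factor (M N ρ : ℕ) (hM : 0 < M) (hNM : N = M * ρ) (hρ : 1 ≤ ρ) (Q : Finset (Fin d → ℤ))
    (hQ1 : ∀ κ ∈ Q, ∀ i, 0 ≤ κ i) (hQ2 : ∀ κ ∈ Q, ∀ i, κ i ≤ ρ) (h : (Fin d → ℤ) → (Fin d → ℤ) → ℂ)
    (a : Fin d → ℤ) (l : ℤ) (P : (Fin d → ℤ) × ℤ → ℂ) (B : ℝ) (hB : 0 ≤ B)
    (hb : ∀ g : (Fin d → ℤ) → Fin d → ℝ → ℂ, (∀ κ ∈ Q, ∀ i, Nice 1 (g κ i)) →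
      Nrm 2 (cellZ d ρ) (fun z => P z * ∑ κ ∈ Q, bq M N ρ a l κ (g κ) (h κ) * ce ρ κ z) ≤ B) :
    Nrm 2 (cellZ d ρ) (fun z => P z * FF M N Q h ((ρ : ℤ) • a + z.1) (ρ * l + z.2)) ≤ CT d * B := by
  classical
  have hρ' : (0 : ℝ) < ρ := by exact_mod_cast hρ
  have hM' : (0 : ℝ) < M := by exact_mod_cast hM
  have hMN : (N : ℝ) = M * ρ := by exact_mod_cast hNM
  have T := taylor (p := 2) (Z := cellZ d ρ) (by norm_num) (Q ×ˢ box d N)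
    (fun z q => P z * (cut M q.1 q.2 * hat N (h q.1) q.2 * ee (lin N ((ρ : ℤ) • a) q.2 + (ρ * l) * quad N q.2) * ce ρ q.1 z))
    (Xf ρ) (fun q s => Uf ρ q.1 s (vv M q.1 q.2 s.1)) (2 * π * 25) B (by positivity) hB ?_ ?_
  · refine le_trans (le_of_eq ?_) T
    refine Nrm_congr fun z _ => ?_
    congr 1
    rw [Finset.sum_product]
    unfold FF
    rw [Finset.mul_sum]
    refine Finset.sum_congr rfl fun κ _ => ?_
    rw [Finset.mul_sum]
    refine Finset.sum_congr rfl fun u _ => ?_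
    have e : ee (lin N ((ρ : ℤ) • a + z.1) u + ((ρ * l + z.2 : ℤ) : ℝ) * quad N u)
      = ee (lin N ((ρ : ℤ) • a) u + (ρ * l) * quad N u) * ce ρ κ z * Complex.exp (Complex.I * ((∑ s, Xf ρ z s * Uf ρ κ s (vv M κ u s.1) : ℝ) : ℂ)) := by
      have e1 : Complex.exp (Complex.I * ((∑ s, Xf ρ z s * Uf ρ κ s (vv M κ u s.1) : ℝ) : ℂ))
          = ee ((∑ s, Xf ρ z s * Uf ρ κ s (vv M κ u s.1)) / (2 * π)) := by
        unfold ee; congr 1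
        have : 2 * π * ((∑ s, Xf ρ z s * Uf ρ κ s (vv M κ u s.1)) / (2 * π)) = ∑ s, Xf ρ z s * Uf ρ κ s (vv M κ u s.1) := by
          field_simp
        rw [this]; ring
      rw [e1]
      unfold ce
      rw [← ee_add, ← ee_add]
      congr 1
      rw [Fintype.sum_prod_type]
      unfold lin quad Hc
      simp only [Fintype.sum_bool, Xf, Uf, if_true, Bool.false_eq_true, if_false]
      push_cast
      simp only [Finset.mul_sum, Finset.sum_div, ← Finset.sum_add_distrib]
      refine Finset.sum_congr rfl fun i _ => ?_
      simp only [Pi.add_apply, Pi.smul_apply, smul_eq_mul, vv]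
      push_cast
      rw [hMN]; field_simp; ring
    simp only
    rw [e]; ring
  · intro z hz s
    rw [cellZ, Finset.mem_product, mem_box, Finset.mem_Ico] at hz
    unfold Xf
    rw [abs_mul, abs_of_pos (by positivity : (0 : ℝ) < 2 * π * 25)]
    have : |(if s.2 then (z.2 : ℝ) else (z.1 s.1 : ℝ)) / ρ| ≤ 1 := by
      split_ifs
      · have h1 : (0 : ℝ) ≤ z.2 := by exact_mod_cast hz.2.1
        have h2 : (z.2 : ℝ) ≤ ρ := by exact_mod_cast hz.2.2.le
        rw [abs_of_nonneg (by positivity), div_le_one hρ']; exact h2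
      · have h1 : (0 : ℝ) ≤ z.1 s.1 := by exact_mod_cast (hz.1 s.1).1
        have h2 : (z.1 s.1 : ℝ) ≤ ρ := by exact_mod_cast (hz.1 s.1).2.le
        rw [abs_of_nonneg (by positivity), div_le_one hρ']; exact h2
    have hpi : (0 : ℝ) < 2 * π * 25 := by positivity
    nlinarith
  · intro m w
    set g : (Fin d → ℤ) → Fin d → ℝ → ℂ := fun κ i v => ∏ j with (w j).1 = i, ((Uf ρ κ (w j) v : ℝ) : ℂ) with hg
    refine le_trans (le_of_eq ?_) (hb g ?_)
    · refine Nrm_congr fun z _ => ?_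
      congr 1
      rw [Finset.sum_product, Finset.mul_sum]
      refine Finset.sum_congr rfl fun κ _ => ?_
      unfold bq
      rw [Finset.sum_mul, Finset.mul_sum]
      refine Finset.sum_congr rfl fun u _ => ?_
      have : ((∏ j, Uf ρ κ (w j) (vv M κ u (w j).1) : ℝ) : ℂ) = ∏ i, g κ i (vv M κ u i) := by
        simp only [hg]
        push_cast
        rw [← Finset.prod_fiberwise (s := Finset.univ) (g := fun j => (w j).1)]
        refine Finset.prod_congr rfl fun i _ => Finset.prod_congr rfl fun j hj => ?_
        rw [(Finset.mem_filter.1 hj).2]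
      simp only
      rw [this, Finset.prod_mul_distrib]
      unfold cut; ring
    · intro κ hκ i
      exact Nice.prod _ _ fun j _ => Nice.Uf ρ hρ κ (hQ1 κ hκ) (hQ2 κ hκ) _

/-- local energy -/
def Eq (M N ρ : ℕ) (a : Fin d → ℤ) (l : ℤ) (κ : Fin d → ℤ) (h : (Fin d → ℤ) → ℂ) : ℝ :=
  ∑ x' ∈ box d N, ‖h x'‖ ^ 2 / (Om M N ((ρ : ℤ) • a - x' + (2 * l) • κ)) ^ 2

lemma Eq_nonneg (M N ρ : ℕ) (a : Fin d → ℤ) (l : ℤ) (κ : Fin d → ℤ) (h : (Fin d → ℤ) → ℂ) : 0 ≤ Eq M N ρ a l κ h :=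
  Finset.sum_nonneg fun _ _ => by positivity

lemma cell_orth (ρ : ℕ) (hρ : 0 < ρ) (Q1 Q2 : Finset (Fin d → ℤ))
    (hQ1 : ∀ κ ∈ Q1, ∀ i, 0 ≤ κ i ∧ 2 * d * κ i < ρ) (hQ2 : ∀ κ ∈ Q2, ∀ i, 0 ≤ κ i ∧ 2 * d * κ i < ρ)
    (b c : (Fin d → ℤ) → ℂ) (v : (Fin d → ℤ) → ℝ) (hv : ∀ κ ∈ Q1, 0 < v κ) (V : ℝ) (hV0 : 0 ≤ V)
    (hV : ∀ (σ : Fin d → ℤ) (τ : ℤ), ∑ q ∈ Q1 ×ˢ Q2 with q.1 + q.2 = σ ∧ Hc ρ q.1 + Hc ρ q.2 = τ, v q.1 ≤ V) :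
    ∑ z ∈ cellZ d ρ, ‖(∑ κ ∈ Q1, b κ * ce ρ κ z) * (∑ μ ∈ Q2, c μ * ce ρ μ z)‖ ^ 2
      ≤ (ρ : ℝ) ^ (d + 1) * V * ((∑ κ ∈ Q1, ‖b κ‖ ^ 2 / v κ) * ∑ μ ∈ Q2, ‖c μ‖ ^ 2) := by
  classical
  set T : Finset ((Fin d → ℤ) × ℤ) := (Q1 ×ˢ Q2).image fun q => (q.1 + q.2, Hc ρ q.1 + Hc ρ q.2) with hT
  set B : (Fin d → ℤ) × ℤ → ℂ := fun s => ∑ q ∈ Q1 ×ˢ Q2 with (q.1 + q.2, Hc ρ q.1 + Hc ρ q.2) = s, b q.1 * c q.2 with hBd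
  have hHc : ∀ κ : Fin d → ℤ, (∀ i, 0 ≤ κ i ∧ 2 * d * κ i < ρ) → 0 ≤ Hc ρ κ ∧ 2 * Hc ρ κ < ρ := by
    intro κ hκ
    constructor
    · exact Finset.sum_nonneg fun i _ => Int.ediv_nonneg (sq_nonneg _) (by omega)
    · unfold Hc
      rcases Nat.eq_zero_or_pos d with hd | hd
      · subst hd; simp; omega
      have h1 : ∀ i, d * (κ i ^ 2 / (ρ : ℤ)) ≤ κ i - 1 ∨ κ i = 0 := by
        intro i
        by_cases h0 : κ i = 0
        · right; exact h0
        left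
        have := hκ i
        have h2 : κ i ^ 2 / (ρ : ℤ) * ρ ≤ κ i ^ 2 := Int.ediv_mul_le _ (by omega)
        have h3 : 0 ≤ κ i ^ 2 / (ρ : ℤ) := Int.ediv_nonneg (sq_nonneg _) (by omega)
        by_contra hcon
        push Not at hcon
        have hd' : (0 : ℤ) < d := by exact_mod_cast hd
        have h5 : κ i ≤ d * (κ i ^ 2 / (ρ : ℤ)) := by omega
        have h6 : κ i * ρ ≤ d * κ i ^ 2 := by nlinarith
        have h7 : 0 < κ i := by omega
        nlinarith
      have h1' : ∀ i, d * (κ i ^ 2 / (ρ : ℤ)) ≤ κ i := by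
        intro i; rcases h1 i with h | h
        · omega
        · simp [h]
      have h8 : ∀ i, 2 * d * (d * (κ i ^ 2 / (ρ : ℤ))) ≤ (ρ : ℤ) - 1 := by
        intro i
        have := hκ i
        have := h1' i
        have hd' : (0 : ℤ) < d := by exact_mod_cast hd
        nlinarith
      have h9 : 2 * (d : ℤ) * (d * ∑ i, κ i ^ 2 / (ρ : ℤ)) ≤ d * ((ρ : ℤ) - 1) := by
        rw [Finset.mul_sum, Finset.mul_sum]
        refine (Finset.sum_le_sum fun i _ => h8 i).trans (le_of_eq ?_)
        simp; ring
      have hd' : (0 : ℤ) < d := by exact_mod_cast hd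
      have h10 : 2 * ((d : ℤ) * ∑ i, κ i ^ 2 / (ρ : ℤ)) ≤ (ρ : ℤ) - 1 := by
        by_contra hcon
        push Not at hcon
        nlinarith
      have h11 : 0 ≤ ∑ i, κ i ^ 2 / (ρ : ℤ) := Finset.sum_nonneg fun i _ => Int.ediv_nonneg (sq_nonneg _) (by omega)
      nlinarith
  have hrw : ∀ z, (∑ κ ∈ Q1, b κ * ce ρ κ z) * (∑ μ ∈ Q2, c μ * ce ρ μ z) = ∑ s ∈ T, B s * ee (lin ρ z.1 s.1 + z.2 * s.2 / ρ) := by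
    intro z
    rw [Finset.sum_mul_sum, ← Finset.sum_product', ← Finset.sum_fiberwise_of_maps_to (t := T) (g := fun q : (Fin d → ℤ) × (Fin d → ℤ) => (q.1 + q.2, Hc ρ q.1 + Hc ρ q.2))
      (fun q hq => Finset.mem_image_of_mem _ hq)]
    refine Finset.sum_congr rfl fun s _ => ?_
    rw [hBd, Finset.sum_mul]
    refine Finset.sum_congr rfl fun q hq => ?_
    rw [Finset.mem_filter] at hq
    rw [← hq.2]
    have : ee (lin ρ z.1 (q.1 + q.2) + z.2 * ((Hc ρ q.1 + Hc ρ q.2 : ℤ) : ℝ) / ρ) = ce ρ q.1 z * ce ρ q.2 z := by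
      unfold ce
      rw [← ee_add]; congr 1
      unfold lin
      push_cast
      rw [show ∀ A B C D : ℝ, A + B + (C + D) = (A + C) + (B + D) by intros; ring, ← Finset.sum_add_distrib]
      congr 1
      · refine Finset.sum_congr rfl fun i _ => ?_
        simp; ring
      · ring
    rw [this]; ring
  simp only [hrw]
  rw [parseval (cellZ d ρ) T (fun s z => ee (lin ρ z.1 s.1 + z.2 * s.2 / ρ)) ((ρ : ℝ) ^ (d + 1))]
  · rw [mul_assoc]
    refine mul_le_mul_of_nonneg_left ?_ (by positivity)
    have hB : ∀ s ∈ T, ‖B s‖ ^ 2 ≤ V * ∑ q ∈ Q1 ×ˢ Q2 with (q.1 + q.2, Hc ρ q.1 + Hc ρ q.2) = s, (‖b q.1‖ ^ 2 / v q.1) * ‖c q.2‖ ^ 2 := by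
      intro s _
      have hV' := hV s.1 s.2
      have hVs : ∑ q ∈ Q1 ×ˢ Q2 with (q.1 + q.2, Hc ρ q.1 + Hc ρ q.2) = s, v q.1 ≤ V := by
        refine le_trans (le_of_eq ?_) hV'
        refine Finset.sum_congr ?_ fun _ _ => rfl
        ext q; simp [Prod.ext_iff]
      refine (pow_le_pow_left₀ (norm_nonneg _) (norm_sum_le _ _) 2).trans ?_
      have hvp : ∀ q ∈ (Q1 ×ˢ Q2).filter (fun q => (q.1 + q.2, Hc ρ q.1 + Hc ρ q.2) = s), 0 < v q.1 := by
        intro q hq; exact hv _ (Finset.mem_product.1 (Finset.mem_filter.1 hq).1).1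
      have := Finset.sum_mul_sq_le_sq_mul_sq ((Q1 ×ˢ Q2).filter (fun q => (q.1 + q.2, Hc ρ q.1 + Hc ρ q.2) = s))
        (fun q => Real.sqrt (v q.1)) (fun q => ‖b q.1 * c q.2‖ / Real.sqrt (v q.1))
      refine le_trans (le_of_eq ?_) (this.trans ?_)
      · congr 1
        refine Finset.sum_congr rfl fun q hq => ?_
        have := Real.sqrt_pos.2 (hvp q hq)
        field_simp
      · refine mul_le_mul (le_trans (le_of_eq ?_) hVs) (le_of_eq ?_) (Finset.sum_nonneg fun _ _ => by positivity) hV0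
        · exact Finset.sum_congr rfl fun q hq => Real.sq_sqrt (hvp q hq).le
        · refine Finset.sum_congr rfl fun q hq => ?_
          rw [div_pow, Real.sq_sqrt (hvp q hq).le, norm_mul]; ring
    refine (Finset.sum_le_sum hB).trans ?_
    rw [← Finset.mul_sum, Finset.sum_fiberwise_of_maps_to (t := T) (g := fun q : (Fin d → ℤ) × (Fin d → ℤ) => (q.1 + q.2, Hc ρ q.1 + Hc ρ q.2))
      (fun q hq => Finset.mem_image_of_mem _ hq), Finset.sum_mul_sum, ← Finset.sum_product']
  · intro s hs s' hs'
    have : ∀ z : (Fin d → ℤ) × ℤ, ee (lin ρ z.1 s.1 + z.2 * s.2 / ρ) * (starRingEnd ℂ) (ee (lin ρ z.1 s'.1 + z.2 * s'.2 / ρ))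
        = ee (lin ρ z.1 (s.1 - s'.1)) * ee (z.2 * ((s.2 - s'.2 : ℤ) : ℝ) / ρ) := by
      intro z
      rw [conj_ee, ← ee_add, ← ee_add, lin_sub]; congr 1; push_cast; ring
    simp only [this]
    rw [cellZ, Finset.sum_product]
    simp only
    rw [← Finset.sum_mul_sum (f := fun x => ee (lin ρ x (s.1 - s'.1))) (g := fun y : ℤ => ee (y * ((s.2 - s'.2 : ℤ) : ℝ) / ρ)), sum_box_ee ρ hρ, sum_Ico_ee ρ hρ]
    have bd : ∀ s ∈ T, (∀ i, 0 ≤ s.1 i ∧ s.1 i < ρ) ∧ 0 ≤ s.2 ∧ s.2 < ρ := by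
      intro s hs
      rw [hT, Finset.mem_image] at hs
      obtain ⟨q, hq, rfl⟩ := hs
      rw [Finset.mem_product] at hq
      refine ⟨fun i => ?_, ?_⟩
      · have a1 := hQ1 _ hq.1 i
        have a2 := hQ2 _ hq.2 i
        have hd : 1 ≤ (d : ℤ) := by have := i.pos; omega
        simp only [Pi.add_apply]
        constructor
        · omega
        · nlinarith
      · have a1 := hHc _ (hQ1 _ hq.1)
        have a2 := hHc _ (hQ2 _ hq.2)
        simp only
        omega
    by_cases hss : s = s'
    · subst hss; simp; ring
    · rw [if_neg hss]
      have b1 := bd s hs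
      have b2 := bd s' hs'
      by_cases h1 : ∀ i, (ρ : ℤ) ∣ (s.1 - s'.1) i
      · by_cases h2 : (ρ : ℤ) ∣ s.2 - s'.2
        · exfalso; apply hss
          have := Int.eq_zero_of_abs_lt_dvd h2 (by rw [abs_lt]; constructor <;> omega)
          refine Prod.ext (box_inj s.1 (mem_box.2 b1.1) s'.1 (mem_box.2 b2.1) h1) (by omega)
        · rw [if_neg h2, mul_zero]
      · rw [if_neg h1, zero_mul]

lemma local_lemma (M N ρ : ℕ) (hM : 0 < M) (hNM : N = M * ρ) (hρ : 4 ≤ ρ) (Q1 Q2 : Finset (Fin d → ℤ))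
    (hQ1 : ∀ κ ∈ Q1, ∀ i, 1 ≤ κ i ∧ 2 * d * κ i < ρ ∧ κ i + 3 ≤ ρ) (hQ2 : ∀ κ ∈ Q2, ∀ i, 1 ≤ κ i ∧ 2 * d * κ i < ρ ∧ κ i + 3 ≤ ρ)
    (h1 h2 : (Fin d → ℤ) → (Fin d → ℤ) → ℂ) (a : Fin d → ℤ) (l : ℤ) (hl0 : 0 ≤ l) (hl1 : l ≤ ρ)
    (v : (Fin d → ℤ) → ℝ) (hv : ∀ κ ∈ Q1, 0 < v κ) (V : ℝ) (hV0 : 0 ≤ V)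
    (hV : ∀ (σ : Fin d → ℤ) (τ : ℤ), ∑ q ∈ Q1 ×ˢ Q2 with q.1 + q.2 = σ ∧ Hc ρ q.1 + Hc ρ q.2 = τ, v q.1 ≤ V) :
    ∑ z ∈ cellZ d ρ, ‖FF M N Q1 h1 ((ρ : ℤ) • a + z.1) (ρ * l + z.2) * FF M N Q2 h2 ((ρ : ℤ) • a + z.1) (ρ * l + z.2)‖ ^ 2
      ≤ CT d ^ 4 * ((ρ : ℝ) ^ (d + 1) * V * (((CK / ρ) ^ d * ∑ κ ∈ Q1, Eq M N ρ a l κ (h1 κ) / v κ) * ((CK / ρ) ^ d * ∑ μ ∈ Q2, Eq M N ρ a l μ (h2 μ)))) := by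
  set W := ((ρ : ℝ) ^ (d + 1) * V * (((CK / ρ) ^ d * ∑ κ ∈ Q1, Eq M N ρ a l κ (h1 κ) / v κ) * ((CK / ρ) ^ d * ∑ μ ∈ Q2, Eq M N ρ a l μ (h2 μ)))) with hW
  have hCK : 0 ≤ CK := by unfold CK; positivity
  have hEv : ∀ κ ∈ Q1, 0 ≤ Eq M N ρ a l κ (h1 κ) / v κ := fun κ hκ => div_nonneg (Eq_nonneg _ _ _ _ _ _ _) (hv κ hκ).le
  have s1 : 0 ≤ ∑ κ ∈ Q1, Eq M N ρ a l κ (h1 κ) / v κ := Finset.sum_nonneg hEv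
  have s2 : 0 ≤ ∑ μ ∈ Q2, Eq M N ρ a l μ (h2 μ) := Finset.sum_nonneg fun μ _ => Eq_nonneg _ _ _ _ _ _ _
  have hW0 : 0 ≤ W := by positivity
  have sqN : ∀ f : (Fin d → ℤ) × ℤ → ℂ, Nrm 2 (cellZ d ρ) f = Real.sqrt (∑ z ∈ cellZ d ρ, ‖f z‖ ^ 2) := by
    intro f; unfold Nrm; rw [Real.sqrt_eq_rpow]; norm_num
  have key : Nrm 2 (cellZ d ρ) (fun z => FF M N Q1 h1 ((ρ : ℤ) • a + z.1) (ρ * l + z.2) * FF M N Q2 h2 ((ρ : ℤ) • a + z.1) (ρ * l + z.2))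
      ≤ CT d * (CT d * Real.sqrt W) := by
    have hCT : 0 ≤ CT d := by unfold CT; positivity
    refine one_factor M N ρ hM hNM (by omega) Q2 (fun κ hκ i => by have := hQ2 κ hκ i; omega) (fun κ hκ i => by have := hQ2 κ hκ i; omega)
      h2 a l _ _ (by positivity) ?_
    intro g2 hg2
    refine le_trans (le_of_eq ?_) (one_factor M N ρ hM hNM (by omega) Q1 (fun κ hκ i => by have := hQ1 κ hκ i; omega) (fun κ hκ i => by have := hQ1 κ hκ i; omega)
      h1 a l (fun z => ∑ κ ∈ Q2, bq M N ρ a l κ (g2 κ) (h2 κ) * ce ρ κ z) (Real.sqrt W) (by positivity) ?_)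
    · congr 1; funext z; ring
    intro g1 hg1
    rw [sqN]
    apply Real.sqrt_le_sqrt
    have := cell_orth ρ (by omega) Q1 Q2 (fun κ hκ i => by have := hQ1 κ hκ i; omega) (fun κ hκ i => by have := hQ2 κ hκ i; omega)
      (fun κ => bq M N ρ a l κ (g1 κ) (h1 κ)) (fun κ => bq M N ρ a l κ (g2 κ) (h2 κ)) v hv V hV0 hV
    refine le_trans (le_of_eq ?_) (this.trans ?_)
    · refine Finset.sum_congr rfl fun z _ => ?_
      rw [mul_comm]
    · rw [hW]
      refine mul_le_mul_of_nonneg_left ?_ (by positivity)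
      refine mul_le_mul ?_ ?_ (Finset.sum_nonneg fun _ _ => by positivity) (by positivity)
      · rw [Finset.mul_sum]
        refine Finset.sum_le_sum fun κ hκ => ?_
        rw [← mul_div_assoc]
        refine div_le_div_of_nonneg_right ?_ (hv κ hκ).le
        exact kernel M N ρ hM hNM hρ κ (fun i => (hQ1 κ hκ i).1) (fun i => (hQ1 κ hκ i).2.2) _ (hg1 κ hκ) l hl0 hl1 _ _
      · rw [Finset.mul_sum]
        refine Finset.sum_le_sum fun κ hκ => ?_
        exact kernel M N ρ hM hNM hρ κ (fun i => (hQ2 κ hκ i).1) (fun i => (hQ2 κ hκ i).2.2) _ (hg2 κ hκ) l hl0 hl1 _ _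
  rw [sqN] at key
  have h3 := pow_le_pow_left₀ (Real.sqrt_nonneg _) key 2
  rw [Real.sq_sqrt (Finset.sum_nonneg fun _ _ => by positivity)] at h3
  refine h3.trans (le_of_eq ?_)
  rw [mul_pow, mul_pow, Real.sq_sqrt hW0]; ring

end

end BR

namespace BR

section
variable {d : ℕ}

lemma Hc_sq (ρ : ℕ) (hρ : 0 < ρ) (κ : Fin d → ℤ) : ρ * Hc ρ κ ≤ ∑ i, κ i ^ 2 ∧ ∑ i, κ i ^ 2 ≤ ρ * Hc ρ κ + d * ρ := by
  unfold Hc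
  rw [Finset.mul_sum]
  constructor
  · exact Finset.sum_le_sum fun i _ => Int.mul_ediv_self_le (by omega)
  · have : (d : ℤ) * ρ = ∑ _i : Fin d, (ρ : ℤ) := by simp
    rw [this, ← Finset.sum_add_distrib]
    refine Finset.sum_le_sum fun i _ => ?_
    have := Int.lt_mul_ediv_self_add (x := κ i ^ 2) (k := (ρ : ℤ)) (by omega)
    exact this.le

def CV (d c K : ℕ) : ℕ := (2 * ((1 + 2 * d * c) * K) + 1) ^ (d + 1)

set_option maxHeartbeats 1000000 in
lemma count (N ρ c K lam : ℕ) (hρ : 0 < ρ) (hl : ρ = lam * K) (hN : 16 * ρ ^ 2 ≤ N) (Q1 Q2 : Finset (Fin d → ℤ))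
    (hQ1 : ∀ κ ∈ Q1, ∀ i, 0 ≤ κ i ∧ κ i ≤ ρ) (hQ2 : ∀ κ ∈ Q2, ∀ i, 0 ≤ κ i ∧ κ i ≤ ρ)
    (hA : ∀ κ ∈ Q1, ∀ κ' ∈ Q1, ∀ μ ∈ Q2, ∀ μ' ∈ Q2, (ρ : ℤ) ^ 2 ≤ c * ∑ i, (κ i - μ i) * (κ' i - μ' i))
    (σ : Fin d → ℤ) (τ l : ℤ) (κ2 : Fin d → ℤ) (hκ2 : κ2 ∈ Q2) (J : Finset ℤ)
    (hJ : ∀ l' ∈ J, (lam : ℤ) ≤ |l' - l| ∧ |l' - l| ≤ ρ) (w : Fin d → ℤ)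
    (b : ((Fin d → ℤ) × (Fin d → ℤ)) × ℤ) (hb : b ∈ ((Q1 ×ˢ Q2).filter fun q => q.1 + q.2 = σ ∧ Hc ρ q.1 + Hc ρ q.2 = τ) ×ˢ J)
    (B : Finset (((Fin d → ℤ) × (Fin d → ℤ)) × ℤ)) (hB : B ⊆ ((Q1 ×ˢ Q2).filter fun q => q.1 + q.2 = σ ∧ Hc ρ q.1 + Hc ρ q.2 = τ) ×ˢ J)
    (h : ∀ b' ∈ B, ∀ i, ∃ z : ℤ, |(w + (2 * (b'.2 - l)) • (b'.1.1 - κ2)) i - (w + (2 * (b.2 - l)) • (b.1.1 - κ2)) i - N * z| < ρ) :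
    B.card ≤ CV d c K := by
  classical
  set H : ℕ := (1 + 2 * d * c) * K with hH
  have hρ' : (0 : ℤ) < ρ := by exact_mod_cast hρ
  rw [Finset.mem_product, Finset.mem_filter, Finset.mem_product] at hb
  obtain ⟨⟨⟨hb1, hb2⟩, hbσ, hbτ⟩, hbJ⟩ := hb
  obtain ⟨⟨κ', μ'⟩, l'⟩ := b
  simp only at hb1 hb2 hbσ hbτ hbJ h
  have key : ∀ b' ∈ B, |b'.2 - l'| ≤ H ∧ ∀ i, |b'.1.1 i - κ' i| ≤ H := by
    intro b' hb'
    have hb'A := hB hb'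
    rw [Finset.mem_product, Finset.mem_filter, Finset.mem_product] at hb'A
    obtain ⟨⟨⟨hc1, hc2⟩, hcσ, hcτ⟩, hcJ⟩ := hb'A
    have hh := h b' hb'
    obtain ⟨⟨κ, μ⟩, m⟩ := b'
    simp only at hc1 hc2 hcσ hcτ hcJ hh ⊢
    set L := m - l with hL
    set L' := l' - l with hL'
    have bL := hJ m hcJ
    have bL' := hJ l' hbJ
    rw [← hL] at bL
    rw [← hL'] at bL'
    have abs1 : ∀ i, |κ i - κ2 i| ≤ ρ := fun i => by
      have := hQ1 κ hc1 i; have := hQ2 κ2 hκ2 i; rw [abs_le]; constructor <;> omega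
    have abs2 : ∀ i, |κ' i - κ2 i| ≤ ρ := fun i => by
      have := hQ1 κ' hb1 i; have := hQ2 κ2 hκ2 i; rw [abs_le]; constructor <;> omega
    have abs3 : ∀ i, |κ i - μ' i| ≤ ρ := fun i => by
      have := hQ1 κ hc1 i; have := hQ2 μ' hb2 i; rw [abs_le]; constructor <;> omega
    -- no wrap
    have e1 : ∀ i, |2 * (L * (κ i - κ' i) + (m - l') * (κ' i - κ2 i))| < ρ := by
      intro i
      obtain ⟨z, hz⟩ := hh i
      simp only [Pi.add_apply, Pi.smul_apply, Pi.sub_apply, smul_eq_mul] at hz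
      have e : w i + 2 * L * (κ i - κ2 i) - (w i + 2 * L' * (κ' i - κ2 i)) = 2 * (L * (κ i - κ' i) + (m - l') * (κ' i - κ2 i)) := by
        rw [hL, hL']; ring
      have p1 : |L * (κ i - κ2 i)| ≤ (ρ : ℤ) ^ 2 := by
        rw [abs_mul, sq]; exact mul_le_mul bL.2 (abs1 i) (abs_nonneg _) (by omega)
      have p2 : |L' * (κ' i - κ2 i)| ≤ (ρ : ℤ) ^ 2 := by
        rw [abs_mul, sq]; exact mul_le_mul bL'.2 (abs2 i) (abs_nonneg _) (by omega)
      have hN' : 16 * (ρ : ℤ) ^ 2 ≤ N := by exact_mod_cast hN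
      have hz0 : z = 0 := by
        by_contra hz0
        rw [abs_le] at p1 p2
        rw [abs_lt] at hz
        have hrr : (ρ : ℤ) ≤ ρ ^ 2 := by nlinarith
        rcases lt_or_gt_of_ne hz0 with hneg | hpos
        · have : (N : ℤ) * z ≤ -N := by nlinarith
          nlinarith
        · have : (N : ℤ) ≤ N * z := by nlinarith
          nlinarith
      rw [hz0, mul_zero, sub_zero, e] at hz
      exact hz
    -- perpendicularity
    have hμ : ∀ i, μ i = κ' i + μ' i - κ i := fun i => by
      have a1 := congrFun hbσ i; have a2 := congrFun hcσ i
      simp at a1 a2; omega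
    have e2 : |∑ i, (κ i - κ' i) * (κ i - μ' i)| ≤ d * ρ := by
      have s1 := Hc_sq ρ hρ κ; have s2 := Hc_sq ρ hρ κ'; have s3 := Hc_sq ρ hρ μ; have s4 := Hc_sq ρ hρ μ'
      have : ∑ i, κ i ^ 2 + ∑ i, μ i ^ 2 - ∑ i, κ' i ^ 2 - ∑ i, μ' i ^ 2 = 2 * ∑ i, (κ i - κ' i) * (κ i - μ' i) := by
        rw [Finset.mul_sum, ← Finset.sum_add_distrib, ← Finset.sum_sub_distrib, ← Finset.sum_sub_distrib]
        refine Finset.sum_congr rfl fun i _ => ?_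
        rw [hμ i]; ring
      have hτ : (ρ : ℤ) * Hc ρ κ + ρ * Hc ρ μ = ρ * Hc ρ κ' + ρ * Hc ρ μ' := by
        rw [← mul_add, ← mul_add, hcτ, hbτ]
      rw [abs_le]; constructor <;> linarith
    have e3 : |2 * ∑ i, (L * (κ i - κ' i) + (m - l') * (κ' i - κ2 i)) * (κ i - μ' i)| ≤ d * (ρ : ℤ) ^ 2 := by
      rw [Finset.mul_sum]
      refine (Finset.abs_sum_le_sum_abs _ _).trans ?_
      have : (d : ℤ) * ρ ^ 2 = ∑ _i : Fin d, (ρ : ℤ) ^ 2 := by simp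
      rw [this]
      refine Finset.sum_le_sum fun i _ => ?_
      rw [← mul_assoc, abs_mul, sq]
      exact mul_le_mul (e1 i).le (abs3 i) (abs_nonneg _) (by omega)
    set P := ∑ i, (κ' i - κ2 i) * (κ i - μ' i) with hP
    have hPA := hA κ' hb1 κ hc1 κ2 hκ2 μ' hb2
    rw [← hP] at hPA
    have e4 : ∑ i, (L * (κ i - κ' i) + (m - l') * (κ' i - κ2 i)) * (κ i - μ' i) = L * ∑ i, (κ i - κ' i) * (κ i - μ' i) + (m - l') * P := by
      rw [hP, Finset.mul_sum, Finset.mul_sum, ← Finset.sum_add_distrib]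
      exact Finset.sum_congr rfl fun i _ => by ring
    rw [e4] at e3
    have e5 : |L * ∑ i, (κ i - κ' i) * (κ i - μ' i)| ≤ d * (ρ : ℤ) ^ 2 := by
      rw [abs_mul, show (d : ℤ) * ρ ^ 2 = ρ * (d * ρ) by ring]
      exact mul_le_mul bL.2 e2 (abs_nonneg _) (by omega)
    have hP0 : 0 ≤ P := by
      by_contra hn
      push Not at hn
      have : (c : ℤ) * P ≤ 0 := mul_nonpos_of_nonneg_of_nonpos (by omega) hn.le
      nlinarith
    have e6 : |m - l'| * P ≤ 2 * d * (ρ : ℤ) ^ 2 := by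
      have : |m - l'| * P = |(m - l') * P| := by rw [abs_mul, abs_of_nonneg hP0]
      rw [this]
      rw [abs_le] at e3 e5 ⊢
      have : (0 : ℤ) ≤ d * ρ ^ 2 := by positivity
      constructor <;> linarith
    have e7 : |m - l'| ≤ 2 * d * c := by
      have h1 : |m - l'| * (ρ : ℤ) ^ 2 ≤ (2 * d * c) * ρ ^ 2 := by
        calc |m - l'| * (ρ : ℤ) ^ 2 ≤ |m - l'| * (c * P) := mul_le_mul_of_nonneg_left hPA (abs_nonneg _)
          _ = c * (|m - l'| * P) := by ring
          _ ≤ c * (2 * d * (ρ : ℤ) ^ 2) := mul_le_mul_of_nonneg_left e6 (by omega)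
          _ = _ := by ring
      exact le_of_mul_le_mul_right h1 (by positivity)
    have hK : 1 ≤ K := by
      rcases Nat.eq_zero_or_pos K with h0 | h0
      · subst h0; simp at hl; omega
      · exact h0
    have hlam : (1 : ℤ) ≤ lam := by
      rcases Nat.eq_zero_or_pos lam with h0 | h0
      · subst h0; simp at hl; omega
      · exact_mod_cast h0
    have hρl : (ρ : ℤ) = lam * K := by exact_mod_cast hl
    have hK' : (1 : ℤ) ≤ K := by exact_mod_cast hK
    have hHc : (H : ℤ) = (1 + 2 * d * c) * K := by rw [hH]; push_cast; ring
    have hdc : (0 : ℤ) ≤ 2 * d * c := by positivity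
    refine ⟨?_, fun i => ?_⟩
    · rw [hHc]
      have : (1 + 2 * (d : ℤ) * c) * 1 ≤ (1 + 2 * d * c) * K := mul_le_mul_of_nonneg_left hK' (by omega)
      linarith
    · have f1 : |L| * |κ i - κ' i| ≤ (1 + 2 * d * c) * ρ := by
        rw [← abs_mul]
        have f2 := e1 i
        have f3 : |(m - l') * (κ' i - κ2 i)| ≤ (2 * d * c) * ρ := by
          rw [abs_mul]; exact mul_le_mul e7 (abs2 i) (abs_nonneg _) hdc
        rw [abs_lt] at f2
        rw [abs_le] at f3 ⊢
        constructor <;> linarith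
      have f4 : (lam : ℤ) * |κ i - κ' i| ≤ lam * H := by
        calc (lam : ℤ) * |κ i - κ' i| ≤ |L| * |κ i - κ' i| := mul_le_mul_of_nonneg_right bL.1 (abs_nonneg _)
          _ ≤ _ := f1
          _ = lam * H := by rw [hHc, hρl]; ring
      exact le_of_mul_le_mul_left f4 (by omega)
  have hcard : B.card ≤ ((Fintype.piFinset fun _ : Fin d => Finset.Icc (-(H : ℤ)) H) ×ˢ Finset.Icc (-(H : ℤ)) H).card := by
    refine Finset.card_le_card_of_injOn (fun b' => (fun i => b'.1.1 i - κ' i, b'.2 - l')) ?_ ?_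
    · intro b' hb'
      have := key b' hb'
      simp only [Finset.coe_product, Set.mem_prod, Finset.mem_coe, Fintype.mem_piFinset, Finset.mem_Icc]
      exact ⟨fun i => abs_le.1 (this.2 i), abs_le.1 this.1⟩
    · intro x hx y hy hxy
      have hx' := hB hx
      have hy' := hB hy
      rw [Finset.mem_product, Finset.mem_filter, Finset.mem_product] at hx' hy'
      simp only [Prod.mk.injEq] at hxy
      have g1 : x.1.1 = y.1.1 := by funext i; have := congrFun hxy.1 i; simp at this; exact this
      have g2 : x.2 = y.2 := by have := hxy.2; omega
      have g3 : x.1.2 = y.1.2 := by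
        have a1 := hx'.1.2.1; have a2 := hy'.1.2.1
        rw [g1] at a1; exact add_left_cancel (a1.trans a2.symm)
      exact Prod.ext (Prod.ext g1 g3) g2
  refine hcard.trans (le_of_eq ?_)
  rw [Finset.card_product, Fintype.card_piFinset]
  simp only [Int.card_Icc, Finset.prod_const, Finset.card_univ, Fintype.card_fin]
  rw [← pow_succ, CV, ← hH]
  congr 1
  omega

end
end BR

namespace BR

section
variable {d : ℕ}

lemma Om_tri (M N : ℕ) (A B : Fin d → ℤ) : (Om M N A)⁻¹ ≤ 2 ^ d * Om M N B * (Om M N (A - B))⁻¹ := by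
  have h := Om_add M N A (-B)
  rw [Om_neg, ← sub_eq_add_neg] at h
  have h1 := Om_pos M N A
  have h2 := Om_pos M N (A - B)
  rw [← div_eq_mul_inv, inv_le_iff_one_le_mul₀ h1, ← mul_div_right_comm, le_div_iff₀ h2]
  linarith

lemma sum_a (M N ρ : ℕ) (hN : 0 < N) (hM : N = M * ρ) (w : Fin d → ℤ) :
    ∑ a ∈ box d M, (Om M N ((ρ : ℤ) • a + w))⁻¹ ≤ Cw ^ d := by
  have hρ : 0 < ρ := by rcases Nat.eq_zero_or_pos ρ with h | h; (subst h; simp at hM; omega); exact h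
  refine (cell_sum M N ρ hN hM (box d M) (fun a => (ρ : ℤ) • a + w) 1 zero_le_one ?_).trans (by rw [one_mul])
  intro a ha B hB h
  have : B.card ≤ 1 := by
    have h0 : ∀ b ∈ B, b = a := by
      intro b hb
      refine box_inj b (hB hb) a ha fun i => ?_
      obtain ⟨z, hz⟩ := h b hb i
      refine ⟨z, ?_⟩
      simp only [Pi.add_apply, Pi.smul_apply, smul_eq_mul] at hz
      have hN' : (N : ℤ) = M * ρ := by exact_mod_cast hM
      have e : ρ * b i + w i - (ρ * a i + w i) - N * z = ρ * (b i - a i - M * z) := by rw [hN']; ring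
      rw [e, abs_mul, abs_of_nonneg (by omega : (0 : ℤ) ≤ ρ)] at hz
      have : |b i - a i - M * z| < 1 := by
        by_contra hcon
        push Not at hcon
        have : (ρ : ℤ) > 0 := by omega
        nlinarith
      rw [Int.abs_lt_one_iff] at this
      omega
    refine Finset.card_le_one.2 fun x hx y hy => by rw [h0 x hx, h0 y hy]
  exact_mod_cast this

variable {ι : Type*}

/-- local energy of a family -/
def eng (M N ρ : ℕ) (Q2 : Finset (Fin d → ℤ)) (I : Finset ι) (ψ : ι → (Fin d → ℤ) → (Fin d → ℤ) → ℂ) (a : Fin d → ℤ) (l : ℤ) : ℝ :=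
  ∑ i ∈ I, ∑ μ ∈ Q2, Eq M N ρ a l μ (ψ i μ)

/-- mass on a tube -/
def mm (M N ρ : ℕ) (e : (Fin d → ℤ) → ℤ → ℝ) (J : Finset ℤ) (κ x : Fin d → ℤ) : ℝ :=
  ∑ l ∈ J, ∑ a ∈ box d M, e a l * (Om M N ((ρ : ℤ) • a - x + (2 * l) • κ))⁻¹

def cvc (d c K : ℕ) : ℝ := 2 ^ d * Cw ^ d * (CV d c K * Cw ^ d)

lemma V_lemma (M N ρ c K lam : ℕ) (hρ : 0 < ρ) (hl : ρ = lam * K) (hN : 16 * ρ ^ 2 ≤ N) (hM : N = M * ρ) (Q1 Q2 : Finset (Fin d → ℤ))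
    (hQ1 : ∀ κ ∈ Q1, ∀ i, 0 ≤ κ i ∧ κ i ≤ ρ) (hQ2 : ∀ κ ∈ Q2, ∀ i, 0 ≤ κ i ∧ κ i ≤ ρ)
    (hA : ∀ κ ∈ Q1, ∀ κ' ∈ Q1, ∀ μ ∈ Q2, ∀ μ' ∈ Q2, (ρ : ℤ) ^ 2 ≤ c * ∑ i, (κ i - μ i) * (κ' i - μ' i))
    (σ : Fin d → ℤ) (τ l : ℤ) (J : Finset ℤ) (hJ : ∀ l' ∈ J, (lam : ℤ) ≤ |l' - l| ∧ |l' - l| ≤ ρ)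
    (I : Finset ι) (ψ : ι → (Fin d → ℤ) → (Fin d → ℤ) → ℂ) (a : Fin d → ℤ) :
    ∑ q ∈ Q1 ×ˢ Q2 with q.1 + q.2 = σ ∧ Hc ρ q.1 + Hc ρ q.2 = τ,
        mm M N ρ (eng M N ρ Q2 I ψ) J q.1 ((ρ : ℤ) • a + (2 * l) • q.1)
      ≤ cvc d c K * ∑ i ∈ I, ∑ μ ∈ Q2, ∑ x ∈ box d N, ‖ψ i μ x‖ ^ 2 := by
  have hN0 : 0 < N := by have : 0 < ρ ^ 2 := by positivity
                         omega
  set A := (Q1 ×ˢ Q2).filter fun q => q.1 + q.2 = σ ∧ Hc ρ q.1 + Hc ρ q.2 = τ with hAdef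
  have hCw : 0 ≤ Cw := by linarith [one_le_Cw]
  have single : ∀ μ ∈ Q2, ∀ x : Fin d → ℤ, ∑ q ∈ A, ∑ l' ∈ J, ∑ a' ∈ box d M,
      ((Om M N ((ρ : ℤ) • a' - x + (2 * l') • μ)) ^ 2)⁻¹ * (Om M N ((ρ : ℤ) • a' - ((ρ : ℤ) • a + (2 * l) • q.1) + (2 * l') • q.1))⁻¹ ≤ cvc d c K := by
    intro μ hμ x
    set y : ((Fin d → ℤ) × (Fin d → ℤ)) × ℤ → Fin d → ℤ := fun b => (x - (ρ : ℤ) • a - (2 * l) • μ) + (2 * (b.2 - l)) • (b.1.1 - μ) with hy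
    have s1 : ∑ b ∈ A ×ˢ J, (Om M N (y b))⁻¹ ≤ CV d c K * Cw ^ d := by
      refine cell_sum M N ρ hN0 hM (A ×ˢ J) y (CV d c K) (by positivity) ?_
      intro b hb B hB h
      exact_mod_cast count N ρ c K lam hρ hl hN Q1 Q2 hQ1 hQ2 hA σ τ l μ hμ J hJ _ b hb B hB h
    have s2 : ∀ q l', ∑ a' ∈ box d M,
      ((Om M N ((ρ : ℤ) • a' - x + (2 * l') • μ)) ^ 2)⁻¹ * (Om M N ((ρ : ℤ) • a' - ((ρ : ℤ) • a + (2 * l) • q.1) + (2 * l') • q.1))⁻¹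
        ≤ 2 ^ d * Cw ^ d * (Om M N (y (q, l')))⁻¹ := by
      intro q l'
      have hpos := Om_pos M N (y (q, l'))
      calc _ ≤ ∑ a' ∈ box d M, (2 ^ d * (Om M N (y (q, l')))⁻¹) * (Om M N ((ρ : ℤ) • a' + (- x + (2 * l') • μ)))⁻¹ := by
            refine Finset.sum_le_sum fun a' _ => ?_
            have t := Om_tri M N ((ρ : ℤ) • a' - ((ρ : ℤ) • a + (2 * l) • q.1) + (2 * l') • q.1) ((ρ : ℤ) • a' - x + (2 * l') • μ)
            have e : (ρ : ℤ) • a' - ((ρ : ℤ) • a + (2 * l) • q.1) + (2 * l') • q.1 - ((ρ : ℤ) • a' - x + (2 * l') • μ) = y (q, l') := by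
              rw [hy]; funext i; simp; ring
            rw [e] at t
            have e2 : (ρ : ℤ) • a' + (- x + (2 * l') • μ) = (ρ : ℤ) • a' - x + (2 * l') • μ := by
              funext i; simp; ring
            rw [e2]
            set Z := Om M N ((ρ : ℤ) • a' - x + (2 * l') • μ) with hZ
            have hZp : 0 < Z := Om_pos _ _ _
            calc (Z ^ 2)⁻¹ * _ ≤ (Z ^ 2)⁻¹ * (2 ^ d * Z * (Om M N (y (q, l')))⁻¹) := mul_le_mul_of_nonneg_left t (by positivity)
              _ = _ := by field_simp
        _ = (2 ^ d * (Om M N (y (q, l')))⁻¹) * ∑ a' ∈ box d M, (Om M N ((ρ : ℤ) • a' + (- x + (2 * l') • μ)))⁻¹ := by rw [Finset.mul_sum]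
        _ ≤ (2 ^ d * (Om M N (y (q, l')))⁻¹) * Cw ^ d := mul_le_mul_of_nonneg_left (sum_a M N ρ hN0 hM _) (by positivity)
        _ = _ := by ring
    calc _ ≤ ∑ q ∈ A, ∑ l' ∈ J, 2 ^ d * Cw ^ d * (Om M N (y (q, l')))⁻¹ := Finset.sum_le_sum fun q _ => Finset.sum_le_sum fun l' _ => s2 q l'
      _ = 2 ^ d * Cw ^ d * ∑ b ∈ A ×ˢ J, (Om M N (y b))⁻¹ := by rw [Finset.sum_product, Finset.mul_sum]; simp only [Finset.mul_sum]
      _ ≤ _ := by unfold cvc; exact mul_le_mul_of_nonneg_left s1 (by positivity)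
  have expand : ∑ q ∈ A, mm M N ρ (eng M N ρ Q2 I ψ) J q.1 ((ρ : ℤ) • a + (2 * l) • q.1)
      = ∑ i ∈ I, ∑ μ ∈ Q2, ∑ x ∈ box d N, ‖ψ i μ x‖ ^ 2 * ∑ q ∈ A, ∑ l' ∈ J, ∑ a' ∈ box d M,
      ((Om M N ((ρ : ℤ) • a' - x + (2 * l') • μ)) ^ 2)⁻¹ * (Om M N ((ρ : ℤ) • a' - ((ρ : ℤ) • a + (2 * l) • q.1) + (2 * l') • q.1))⁻¹ := by
    simp only [mm, eng, Eq, Finset.sum_mul, Finset.mul_sum]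
    have sw : ∀ F : ((Fin d → ℤ) × (Fin d → ℤ)) → ℤ → (Fin d → ℤ) → ι → (Fin d → ℤ) → (Fin d → ℤ) → ℝ,
      ∑ q ∈ A, ∑ l' ∈ J, ∑ a' ∈ box d M, ∑ i ∈ I, ∑ μ ∈ Q2, ∑ x ∈ box d N, F q l' a' i μ x
       = ∑ i ∈ I, ∑ μ ∈ Q2, ∑ x ∈ box d N, ∑ q ∈ A, ∑ l' ∈ J, ∑ a' ∈ box d M, F q l' a' i μ x := by
      intro F
      have := Finset.sum_comm (s := A ×ˢ J ×ˢ box d M) (t := I ×ˢ Q2 ×ˢ box d N) (f := fun q θ => F q.1 q.2.1 q.2.2 θ.1 θ.2.1 θ.2.2)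
      simpa only [Finset.sum_product] using this
    rw [sw]
    refine Finset.sum_congr rfl fun i _ => Finset.sum_congr rfl fun μ _ => Finset.sum_congr rfl fun x _ => Finset.sum_congr rfl fun q _ => Finset.sum_congr rfl fun l' _ => Finset.sum_congr rfl fun a' _ => ?_
    rw [div_eq_mul_inv, mul_assoc]
  rw [expand, Finset.mul_sum]
  refine Finset.sum_le_sum fun i _ => ?_
  rw [Finset.mul_sum]
  refine Finset.sum_le_sum fun μ hμ => ?_
  rw [Finset.mul_sum]
  refine Finset.sum_le_sum fun x _ => ?_
  rw [mul_comm (cvc d c K)]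
  exact mul_le_mul_of_nonneg_left (single μ hμ x) (by positivity)

end
end BR

namespace BR

section
variable {d : ℕ} {ι : Type*}

def slab (lam : ℕ) (s : ℕ) : Finset ℤ := Finset.Ico ((s : ℤ) * lam) ((s + 1) * lam)

/-- the weights -/
def wt (M N ρ lam : ℕ) (e : (Fin d → ℤ) → ℤ → ℝ) (κ : Fin d → ℤ) (s : ℕ) (x : Fin d → ℤ) : ℝ :=
  mm M N ρ e (slab lam s) κ x / mm M N ρ e (Finset.Ico (0 : ℤ) ρ) κ x

lemma mm_pos (M N ρ : ℕ) (hM : 0 < M) (e : (Fin d → ℤ) → ℤ → ℝ) (he : ∀ a l, 0 < e a l) (J : Finset ℤ) (hJ : J.Nonempty) (κ x : Fin d → ℤ) :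
    0 < mm M N ρ e J κ x := by
  unfold mm
  refine Finset.sum_pos (fun l _ => Finset.sum_pos (fun a _ => mul_pos (he _ _) (inv_pos.2 (Om_pos _ _ _))) ?_) hJ
  exact ⟨0, mem_box.2 fun i => ⟨le_rfl, by show (0 : ℤ) < M; exact_mod_cast hM⟩⟩

lemma mm_mono (M N ρ : ℕ) (e : (Fin d → ℤ) → ℤ → ℝ) (he : ∀ a l, 0 < e a l) (J J' : Finset ℤ) (hJ : J ⊆ J') (κ x : Fin d → ℤ) :
    mm M N ρ e J κ x ≤ mm M N ρ e J' κ x := by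
  unfold mm
  refine Finset.sum_le_sum_of_subset_of_nonneg hJ fun l _ _ => Finset.sum_nonneg fun a _ => mul_nonneg (he _ _).le (inv_pos.2 (Om_pos _ _ _)).le

lemma slab_sub (ρ K lam : ℕ) (hl : ρ = lam * K) (s : ℕ) (hs : s < K) : slab lam s ⊆ Finset.Ico (0 : ℤ) ρ := by
  unfold slab
  refine Finset.Ico_subset_Ico (by positivity) ?_
  have : (ρ : ℤ) = K * lam := by rw [hl]; push_cast; ring
  rw [this]
  have : (s : ℤ) + 1 ≤ K := by exact_mod_cast hs
  exact mul_le_mul_of_nonneg_right this (by positivity)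

lemma slab_far (ρ K lam : ℕ) (hl : ρ = lam * K) (s s' : ℕ) (hs : s < K) (hs' : s' < K) (hfar : s + 2 ≤ s' ∨ s' + 2 ≤ s)
    (l : ℤ) (h : l ∈ slab lam s) (l' : ℤ) (h' : l' ∈ slab lam s') : (lam : ℤ) ≤ |l' - l| ∧ |l' - l| ≤ ρ := by
  have a1 := Finset.mem_Ico.1 (slab_sub ρ K lam hl s hs h)
  have a2 := Finset.mem_Ico.1 (slab_sub ρ K lam hl s' hs' h')
  unfold slab at h h'
  rw [Finset.mem_Ico] at h h'
  constructor
  · rcases hfar with hf | hf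
    · have : ((s : ℤ) + 2) * lam ≤ s' * lam := mul_le_mul_of_nonneg_right (by exact_mod_cast hf) (by positivity)
      exact le_trans (by linarith) (le_abs_self _)
    · have : ((s' : ℤ) + 2) * lam ≤ s * lam := mul_le_mul_of_nonneg_right (by exact_mod_cast hf) (by positivity)
      exact le_trans (by linarith) (neg_le_abs _)
  · rw [abs_le]; constructor <;> omega

lemma sum_slab (ρ K lam : ℕ) (hl : ρ = lam * K) (hlam : 0 < lam) {R : Type*} [AddCommMonoid R] (F : ℤ → R) :
    ∑ s ∈ Finset.range K, ∑ l ∈ slab lam s, F l = ∑ l ∈ Finset.Ico (0 : ℤ) ρ, F l := by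
  subst hl
  induction K with
  | zero => simp
  | succ K ih =>
    rw [Finset.sum_range_succ, ih]
    unfold slab
    have h1 : ((lam * K : ℕ) : ℤ) = K * lam := by push_cast; ring
    have h2 : ((lam * (K + 1) : ℕ) : ℤ) = (K + 1) * lam := by push_cast; ring
    rw [h1, h2]
    rw [← Finset.sum_union (Finset.Ico_disjoint_Ico_consecutive _ _ _), Finset.Ico_union_Ico_eq_Ico (by positivity) (by nlinarith)]

def CD (d c K : ℕ) : ℝ := CT d ^ 4 * CK ^ d * CK ^ d * cvc d c K * 2 ^ d

set_option maxHeartbeats 1000000 in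
lemma D4 (M N ρ c K lam : ℕ) (hρ : 4 ≤ ρ) (hl : ρ = lam * K) (hN : 16 * ρ ^ 2 ≤ N) (hM : N = M * ρ) (Q1 Q2 : Finset (Fin d → ℤ))
    (hQ1 : ∀ κ ∈ Q1, ∀ i, 1 ≤ κ i ∧ 2 * d * κ i < ρ ∧ κ i + 3 ≤ ρ) (hQ2 : ∀ κ ∈ Q2, ∀ i, 1 ≤ κ i ∧ 2 * d * κ i < ρ ∧ κ i + 3 ≤ ρ)
    (hA : ∀ κ ∈ Q1, ∀ κ' ∈ Q1, ∀ μ ∈ Q2, ∀ μ' ∈ Q2, (ρ : ℤ) ^ 2 ≤ c * ∑ i, (κ i - μ i) * (κ' i - μ' i))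
    (s s' : ℕ) (hs : s < K) (hs' : s' < K) (hfar : s + 2 ≤ s' ∨ s' + 2 ≤ s)
    (I : Finset ι) (φ : (Fin d → ℤ) → (Fin d → ℤ) → ℂ) (ψ : ι → (Fin d → ℤ) → (Fin d → ℤ) → ℂ)
    (he : ∀ a l, 0 < eng M N ρ Q2 I ψ a l) :
    ∑ i ∈ I, ∑ a ∈ box d M, ∑ l ∈ slab lam s, ∑ z ∈ cellZ d ρ,
      ‖FF M N Q1 (fun κ x => (wt M N ρ lam (eng M N ρ Q2 I ψ) κ s' x : ℂ) * φ κ x) ((ρ : ℤ) • a + z.1) (ρ * l + z.2)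
        * FF M N Q2 (ψ i) ((ρ : ℤ) • a + z.1) (ρ * l + z.2)‖ ^ 2
      ≤ CD d c K * ((ρ : ℝ) ^ (d + 1) / (ρ : ℝ) ^ d / (ρ : ℝ) ^ d) * ((∑ κ ∈ Q1, ∑ x ∈ box d N, ‖φ κ x‖ ^ 2) * ∑ i ∈ I, ∑ μ ∈ Q2, ∑ x ∈ box d N, ‖ψ i μ x‖ ^ 2) := by
  have hN0 : 0 < N := by have : 0 < ρ ^ 2 := by positivity
                         omega
  have hM0 : 0 < M := by rcases Nat.eq_zero_or_pos M with h | h; (subst h; simp at hM; omega); exact h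
  have hρ0 : (0 : ℝ) < ρ := by exact_mod_cast (by omega : 0 < ρ)
  have hlam : 0 < lam := by rcases Nat.eq_zero_or_pos lam with h | h; (subst h; simp at hl; omega); exact h
  set e := eng M N ρ Q2 I ψ with hedef
  set EG := ∑ i ∈ I, ∑ μ ∈ Q2, ∑ x ∈ box d N, ‖ψ i μ x‖ ^ 2 with hEG
  have hEG0 : 0 ≤ EG := by positivity
  have hCw : 0 ≤ Cw := by linarith [one_le_Cw]
  have hcvc : 0 ≤ cvc d c K := by unfold cvc; positivity
  have hCK : 0 ≤ CK := by unfold CK; positivity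
  have hCT : 0 ≤ CT d := by unfold CT; positivity
  set V := cvc d c K * EG with hV
  set h1 : (Fin d → ℤ) → (Fin d → ℤ) → ℂ := fun κ x => (wt M N ρ lam e κ s' x : ℂ) * φ κ x with hh1
  set v : (Fin d → ℤ) → ℤ → (Fin d → ℤ) → ℝ := fun a l κ => mm M N ρ e (slab lam s') κ ((ρ : ℤ) • a + (2 * l) • κ) with hv
  have hne : (slab lam s').Nonempty := by
    unfold slab; rw [Finset.nonempty_Ico]
    have : (0 : ℤ) < lam := by exact_mod_cast hlam
    linarith
  have hvp : ∀ a l κ, 0 < v a l κ := fun a l κ => mm_pos M N ρ hM0 e he _ hne _ _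
  have hall : ∀ κ x, 0 < mm M N ρ e (Finset.Ico (0 : ℤ) ρ) κ x := fun κ x => mm_pos M N ρ hM0 e he _ ⟨0, by simp; omega⟩ _ _
  set X : (Fin d → ℤ) → ℤ → ℝ := fun a l => ∑ κ ∈ Q1, ∑ x ∈ box d N, ‖φ κ x‖ ^ 2 * (2 ^ d * (mm M N ρ e (Finset.Ico (0 : ℤ) ρ) κ x)⁻¹ * (Om M N ((ρ : ℤ) • a - x + (2 * l) • κ))⁻¹) with hX
  have hXle : ∀ a l, ∑ κ ∈ Q1, Eq M N ρ a l κ (h1 κ) / v a l κ ≤ X a l := by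
    intro a l
    refine Finset.sum_le_sum fun κ _ => ?_
    unfold Eq
    rw [Finset.sum_div]
    refine Finset.sum_le_sum fun x _ => ?_
    set B := Om M N ((ρ : ℤ) • a - x + (2 * l) • κ) with hB
    have hBp : 0 < B := Om_pos _ _ _
    have hcmp : mm M N ρ e (slab lam s') κ x ≤ 2 ^ d * B * v a l κ := by
      rw [hv]; unfold mm
      simp only [Finset.mul_sum]
      refine Finset.sum_le_sum fun l' _ => Finset.sum_le_sum fun a' _ => ?_
      have t := Om_tri M N ((ρ : ℤ) • a' - x + (2 * l') • κ) ((ρ : ℤ) • a - x + (2 * l) • κ)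
      have e2 : (ρ : ℤ) • a' - x + (2 * l') • κ - ((ρ : ℤ) • a - x + (2 * l) • κ) = (ρ : ℤ) • a' - ((ρ : ℤ) • a + (2 * l) • κ) + (2 * l') • κ := by
        funext i; simp; ring
      rw [e2] at t
      calc _ ≤ e a' l' * (2 ^ d * B * (Om M N ((ρ : ℤ) • a' - ((ρ : ℤ) • a + (2 * l) • κ) + (2 * l') • κ))⁻¹) := mul_le_mul_of_nonneg_left t (he _ _).le
        _ = _ := by ring
    set m0 := mm M N ρ e (Finset.Ico (0 : ℤ) ρ) κ x with hm0
    have hm0p : 0 < m0 := hall κ x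
    set m1 := mm M N ρ e (slab lam s') κ x with hm1
    have hm1p : 0 < m1 := mm_pos M N ρ hM0 e he _ hne _ _
    have hm1le : m1 ≤ m0 := mm_mono M N ρ e he _ _ (slab_sub ρ K lam hl s' hs') κ x
    have hwt : wt M N ρ lam e κ s' x = m1 / m0 := rfl
    have : ‖h1 κ x‖ ^ 2 = (m1 / m0) ^ 2 * ‖φ κ x‖ ^ 2 := by
      simp only [hh1]
      rw [norm_mul, mul_pow, Complex.norm_real, Real.norm_eq_abs, sq_abs, hwt]
    rw [this]
    have hvv := hvp a l κ
    have : (m1 / m0) ^ 2 / v a l κ ≤ 2 ^ d * B * m0⁻¹ := by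
      rw [div_le_iff₀ hvv, div_pow, div_le_iff₀ (by positivity)]
      calc m1 ^ 2 = m1 * m1 := by ring
        _ ≤ (2 ^ d * B * v a l κ) * m0 := mul_le_mul hcmp hm1le hm1p.le (by positivity)
        _ = _ := by field_simp
    calc (m1 / m0) ^ 2 * ‖φ κ x‖ ^ 2 / B ^ 2 / v a l κ = ‖φ κ x‖ ^ 2 * ((m1 / m0) ^ 2 / v a l κ * (B ^ 2)⁻¹) := by field_simp
      _ ≤ ‖φ κ x‖ ^ 2 * (2 ^ d * B * m0⁻¹ * (B ^ 2)⁻¹) := by gcongr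
      _ = _ := by field_simp
  have hloc : ∀ i ∈ I, ∀ a, ∀ l ∈ slab lam s, ∑ z ∈ cellZ d ρ, ‖FF M N Q1 h1 ((ρ : ℤ) • a + z.1) (ρ * l + z.2) * FF M N Q2 (ψ i) ((ρ : ℤ) • a + z.1) (ρ * l + z.2)‖ ^ 2
      ≤ CT d ^ 4 * ((ρ : ℝ) ^ (d + 1) * V * (((CK / ρ) ^ d * X a l) * ((CK / ρ) ^ d * ∑ μ ∈ Q2, Eq M N ρ a l μ (ψ i μ)))) := by
    intro i _ a l hlS
    have hl' := Finset.mem_Ico.1 (slab_sub ρ K lam hl s hs hlS)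
    have h := local_lemma M N ρ hM0 hM hρ Q1 Q2 hQ1 hQ2 h1 (ψ i) a l hl'.1 hl'.2.le (v a l) (fun κ _ => hvp a l κ) V (by positivity)
      (fun σ τ => V_lemma M N ρ c K lam (by omega) hl hN hM Q1 Q2 (fun κ hκ i => by have := hQ1 κ hκ i; omega) (fun κ hκ i => by have := hQ2 κ hκ i; omega)
        hA σ τ l (slab lam s') (fun l' hl' => slab_far ρ K lam hl s s' hs hs' hfar l hlS l' hl') I ψ a)
    refine h.trans ?_
    have hE : 0 ≤ ∑ μ ∈ Q2, Eq M N ρ a l μ (ψ i μ) := Finset.sum_nonneg fun μ _ => Eq_nonneg _ _ _ _ _ _ _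
    have := hXle a l
    gcongr
  have hsum : ∑ a ∈ box d M, ∑ l ∈ slab lam s, X a l * e a l ≤ 2 ^ d * ∑ κ ∈ Q1, ∑ x ∈ box d N, ‖φ κ x‖ ^ 2 := by
    have sw : ∑ a ∈ box d M, ∑ l ∈ slab lam s, X a l * e a l = ∑ κ ∈ Q1, ∑ x ∈ box d N, ‖φ κ x‖ ^ 2 * (2 ^ d * (mm M N ρ e (Finset.Ico (0 : ℤ) ρ) κ x)⁻¹ * mm M N ρ e (slab lam s) κ x) := by
      have mmS : ∀ κ x, mm M N ρ e (slab lam s) κ x = ∑ l ∈ slab lam s, ∑ a ∈ box d M, e a l * (Om M N ((ρ : ℤ) • a - x + (2 * l) • κ))⁻¹ := fun _ _ => rfl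
      simp only [hX, mmS, Finset.sum_mul, Finset.mul_sum]
      have := Finset.sum_comm (s := box d M ×ˢ slab lam s) (t := Q1 ×ˢ box d N) (f := fun p q => ‖φ q.1 q.2‖ ^ 2 * (2 ^ d * (mm M N ρ e (Finset.Ico (0 : ℤ) ρ) q.1 q.2)⁻¹ * (Om M N ((ρ : ℤ) • p.1 - q.2 + (2 * p.2) • q.1))⁻¹) * e p.1 p.2)
      simp only [Finset.sum_product] at this
      rw [this]
      refine Finset.sum_congr rfl fun κ _ => Finset.sum_congr rfl fun x _ => ?_
      rw [Finset.sum_comm]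
      refine Finset.sum_congr rfl fun l _ => Finset.sum_congr rfl fun a _ => ?_
      ring
    rw [sw, Finset.mul_sum]
    refine Finset.sum_le_sum fun κ _ => ?_
    rw [Finset.mul_sum]
    refine Finset.sum_le_sum fun x _ => ?_
    have h0 := hall κ x
    have h1 := mm_mono M N ρ e he _ _ (slab_sub ρ K lam hl s hs) κ x
    rw [mul_comm ((2 : ℝ) ^ d) (‖φ κ x‖ ^ 2)]
    refine mul_le_mul_of_nonneg_left ?_ (by positivity)
    rw [mul_assoc]
    refine mul_le_of_le_one_right (by positivity) ?_
    rw [inv_mul_le_iff₀ h0, mul_one]; exact h1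
  set G := CT d ^ 4 * ((ρ : ℝ) ^ (d + 1) * V * ((CK / ρ) ^ d * (CK / ρ) ^ d)) with hG
  calc _ ≤ ∑ i ∈ I, ∑ a ∈ box d M, ∑ l ∈ slab lam s, G * (X a l * ∑ μ ∈ Q2, Eq M N ρ a l μ (ψ i μ)) := by
        refine Finset.sum_le_sum fun i hi => Finset.sum_le_sum fun a _ => Finset.sum_le_sum fun l hl => (hloc i hi a l hl).trans (le_of_eq ?_)
        rw [hG]; ring
    _ = G * ∑ a ∈ box d M, ∑ l ∈ slab lam s, X a l * e a l := by
        rw [Finset.sum_comm, Finset.mul_sum]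
        refine Finset.sum_congr rfl fun a _ => ?_
        rw [Finset.sum_comm, Finset.mul_sum]
        refine Finset.sum_congr rfl fun l _ => ?_
        rw [hedef]; unfold eng
        rw [Finset.mul_sum, Finset.mul_sum]
    _ ≤ G * (2 ^ d * ∑ κ ∈ Q1, ∑ x ∈ box d N, ‖φ κ x‖ ^ 2) := mul_le_mul_of_nonneg_left hsum (by positivity)
    _ = _ := by
        rw [hG, hV]; unfold CD
        rw [div_pow]
        field_simp

end
end BR

namespace BR

section
variable {d : ℕ} {ι : Type*}

lemma sum_reindex (M N ρ : ℕ) (hM : N = M * ρ) (hρ : 0 < ρ) (F : (Fin d → ℤ) → ℝ) :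
    ∑ a ∈ box d M, ∑ w ∈ box d ρ, F ((ρ : ℤ) • a + w) = ∑ x ∈ box d N, F x := by
  have hρ' : (0 : ℤ) < ρ := by exact_mod_cast hρ
  rw [← Finset.sum_product']
  refine Finset.sum_nbij' (fun q => (ρ : ℤ) • q.1 + q.2) (fun x => (fun i => x i / ρ, fun i => x i % ρ)) ?_ ?_ ?_ ?_ ?_
  · intro q hq
    rw [Finset.mem_product, mem_box, mem_box] at hq
    rw [mem_box]; intro i
    have h1 := hq.1 i; have h2 := hq.2 i
    simp only [Pi.add_apply, Pi.smul_apply, smul_eq_mul]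
    have hN : (N : ℤ) = M * ρ := by exact_mod_cast hM
    constructor
    · have := mul_nonneg hρ'.le h1.1; omega
    · rw [hN]
      have : (q.1 i + 1) * ρ ≤ M * ρ := mul_le_mul_of_nonneg_right (by omega) hρ'.le
      linarith [h2.2]
  · intro x hx
    rw [mem_box] at hx
    rw [Finset.mem_product, mem_box, mem_box]
    have hN : (N : ℤ) = M * ρ := by exact_mod_cast hM
    refine ⟨fun i => ⟨Int.ediv_nonneg (hx i).1 hρ'.le, Int.ediv_lt_of_lt_mul hρ' (by rw [← hN]; exact (hx i).2)⟩,
      fun i => ⟨Int.emod_nonneg _ hρ'.ne', Int.emod_lt_of_pos _ hρ'⟩⟩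
  · intro q hq
    rw [Finset.mem_product, mem_box, mem_box] at hq
    refine Prod.ext (funext fun i => ?_) (funext fun i => ?_)
    · have h2 := hq.2 i
      simp only [Pi.add_apply, Pi.smul_apply, smul_eq_mul]
      rw [Int.add_comm, Int.add_mul_ediv_left _ _ hρ'.ne', Int.ediv_eq_zero_of_lt h2.1 h2.2, zero_add]
    · have h2 := hq.2 i
      simp only [Pi.add_apply, Pi.smul_apply, smul_eq_mul]
      rw [Int.mul_add_emod_self_left, Int.emod_eq_of_lt h2.1 h2.2]
  · intro x hx
    funext i
    simp only [Pi.add_apply, Pi.smul_apply, smul_eq_mul]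
    exact Int.mul_ediv_add_emod _ _
  · intro q _; rfl

lemma sum_reindex_t (ρ : ℕ) (hρ : 0 < ρ) (A B : ℤ) (F : ℤ → ℝ) :
    ∑ l ∈ Finset.Ico A B, ∑ t ∈ Finset.Ico (0 : ℤ) ρ, F (ρ * l + t) = ∑ t ∈ Finset.Ico (ρ * A) (ρ * B), F t := by
  have hρ' : (0 : ℤ) < ρ := by exact_mod_cast hρ
  rw [← Finset.sum_product']
  refine Finset.sum_nbij' (fun q => ρ * q.1 + q.2) (fun x => (x / ρ, x % ρ)) ?_ ?_ ?_ ?_ ?_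
  · intro q hq
    rw [Finset.mem_product, Finset.mem_Ico, Finset.mem_Ico] at hq
    rw [Finset.mem_Ico]
    constructor
    · have := mul_le_mul_of_nonneg_left hq.1.1 hρ'.le; linarith [hq.2.1]
    · have : ρ * (q.1 + 1) ≤ ρ * B := mul_le_mul_of_nonneg_left (by omega) hρ'.le
      linarith [hq.2.2]
  · intro x hx
    rw [Finset.mem_Ico] at hx
    rw [Finset.mem_product, Finset.mem_Ico, Finset.mem_Ico]
    refine ⟨⟨?_, ?_⟩, Int.emod_nonneg _ hρ'.ne', Int.emod_lt_of_pos _ hρ'⟩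
    · rw [Int.le_ediv_iff_mul_le hρ']; linarith [hx.1]
    · exact Int.ediv_lt_of_lt_mul hρ' (by linarith [hx.2])
  · intro q hq
    rw [Finset.mem_product, Finset.mem_Ico, Finset.mem_Ico] at hq
    refine Prod.ext ?_ ?_
    · simp only
      rw [Int.add_comm, Int.add_mul_ediv_left _ _ hρ'.ne', Int.ediv_eq_zero_of_lt hq.2.1 hq.2.2, zero_add]
    · simp only
      rw [Int.mul_add_emod_self_left, Int.emod_eq_of_lt hq.2.1 hq.2.2]
  · intro x hx
    exact Int.mul_ediv_add_emod _ _
  · intro q _; rfl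

def cap (M : ℕ) (u : Fin d → ℤ) : Fin d → ℤ := fun i => u i / (M : ℤ)

open Classical in
def fr (M : ℕ) (f : (Fin d → ℤ) → ℂ) (κ u : Fin d → ℤ) : ℂ := if cap M u = κ then f u else 0

def ph (M N : ℕ) (f : (Fin d → ℤ) → ℂ) (κ x : Fin d → ℤ) : ℂ := Phi N (fr M f κ) x 0

lemma cap_bd (M : ℕ) (hM : 0 < M) (u : Fin d → ℤ) (i : Fin d) : 0 ≤ vv M (cap M u) u i ∧ vv M (cap M u) u i < 1 := by
  unfold vv cap
  have hM' : (0 : ℝ) < M := by exact_mod_cast hM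
  have h1 : u i / (M : ℤ) * M ≤ u i := Int.ediv_mul_le _ (by omega)
  have h2 : u i < (u i / (M : ℤ) + 1) * M := Int.lt_ediv_add_one_mul_self _ (by omega)
  have h1' : ((u i / (M : ℤ) : ℤ) : ℝ) * M ≤ u i := by exact_mod_cast h1
  have h2' : (u i : ℝ) < (((u i / (M : ℤ) : ℤ) : ℝ) + 1) * M := by exact_mod_cast h2
  constructor
  · rw [sub_nonneg, le_div_iff₀ hM']; exact h1'
  · rw [sub_lt_iff_lt_add, div_lt_iff₀ hM', add_comm]; exact h2'

lemma cut_cap (M : ℕ) (hM : 0 < M) (u : Fin d → ℤ) : cut M (cap M u) u = 1 := by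
  unfold cut
  refine Finset.prod_eq_one fun i _ => ?_
  rw [eta_eq_one _ (cap_bd M hM u i).1 (cap_bd M hM u i).2.le]; simp

lemma cut_norm (M : ℕ) (κ u : Fin d → ℤ) : ‖cut M κ u‖ ≤ 1 := by
  unfold cut
  rw [norm_prod]
  refine Finset.prod_le_one (fun _ _ => norm_nonneg _) fun i _ => ?_
  rw [Complex.norm_real, Real.norm_eq_abs, abs_of_nonneg (eta_bd _).1]; exact (eta_bd _).2

lemma cut_supp (M : ℕ) (κ u : Fin d → ℤ) (h : cut M κ u ≠ 0) (i : Fin d) : -1 < vv M κ u i ∧ vv M κ u i < 2 := by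
  unfold cut at h
  rw [Finset.prod_ne_zero_iff] at h
  have := h i (Finset.mem_univ _)
  constructor
  · by_contra hc
    exact this (by rw [eta_eq_zero _ (Or.inl (not_lt.1 hc))]; simp)
  · by_contra hc
    exact this (by rw [eta_eq_zero _ (Or.inr (not_lt.1 hc))]; simp)

lemma cut_near (M : ℕ) (hM : 0 < M) (κ u : Fin d → ℤ) (h : cut M κ u ≠ 0) (i : Fin d) : κ i ∈ Finset.Icc (cap M u i - 1) (cap M u i + 1) := by
  have h1 := cut_supp M κ u h i
  have h2 := cap_bd M hM u i
  unfold vv at h1 h2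
  rw [Finset.mem_Icc]
  have a1 : (κ i : ℝ) < cap M u i + 2 := by linarith
  have a2 : (cap M u i : ℝ) - 2 < κ i := by linarith
  have a1' : κ i < cap M u i + 2 := by exact_mod_cast a1
  have a2' : cap M u i - 2 < κ i := by exact_mod_cast a2
  omega

lemma sum_fr (M : ℕ) (f : (Fin d → ℤ) → ℂ) (Q : Finset (Fin d → ℤ)) (u : Fin d → ℤ) (h : f u ≠ 0 → cap M u ∈ Q) :
    ∑ κ ∈ Q, fr M f κ u = f u := by
  classical
  by_cases h0 : f u = 0
  · rw [h0]; refine Finset.sum_eq_zero fun κ _ => ?_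
    unfold fr; split_ifs <;> simp [h0]
  · unfold fr
    rw [Finset.sum_ite_eq, if_pos (h h0)]

lemma cut_fr (M : ℕ) (hM : 0 < M) (f : (Fin d → ℤ) → ℂ) (κ u : Fin d → ℤ) : cut M κ u * fr M f κ u = fr M f κ u := by
  unfold fr; split_ifs with h
  · rw [← h, cut_cap M hM, one_mul]
  · simp

lemma FF_ph (M N : ℕ) (hM : 0 < M) (hN : 0 < N) (f : (Fin d → ℤ) → ℂ) (Q : Finset (Fin d → ℤ)) (h : ∀ u ∈ box d N, f u ≠ 0 → cap M u ∈ Q)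
    (x : Fin d → ℤ) (t : ℤ) : FF M N Q (ph M N f) x t = Phi N f x t := by
  unfold FF Phi
  rw [Finset.sum_comm]
  refine Finset.sum_congr rfl fun u hu => ?_
  rw [← Finset.sum_mul]
  congr 1
  rw [← sum_fr M f Q u (h u hu)]
  refine Finset.sum_congr rfl fun κ _ => ?_
  unfold ph
  rw [hat_Phi N hN _ u hu, cut_fr M hM]

lemma ph_energy (M N : ℕ) (hN : 0 < N) (f : (Fin d → ℤ) → ℂ) (Q : Finset (Fin d → ℤ)) :
    ∑ κ ∈ Q, ∑ x ∈ box d N, ‖ph M N f κ x‖ ^ 2 ≤ En N f := by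
  classical
  unfold ph
  simp only [energy N hN]
  unfold En
  rw [← Finset.mul_sum, Finset.sum_comm]
  refine mul_le_mul_of_nonneg_left (Finset.sum_le_sum fun u _ => ?_) (by positivity)
  unfold fr
  have : ∀ κ, ‖if cap M u = κ then f u else 0‖ ^ 2 = if cap M u = κ then ‖f u‖ ^ 2 else 0 := by
    intro κ; split_ifs <;> simp
  simp only [this]
  rw [Finset.sum_ite_eq]
  split_ifs
  · exact le_rfl
  · positivity

lemma sum_cut_sq (M : ℕ) (hM : 0 < M) (Q : Finset (Fin d → ℤ)) (u : Fin d → ℤ) (b : (Fin d → ℤ) → ℂ) :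
    ‖∑ κ ∈ Q, cut M κ u * b κ‖ ^ 2 ≤ 3 ^ d * ∑ κ ∈ Q, ‖b κ‖ ^ 2 := by
  classical
  set Q' := Q.filter fun κ => cut M κ u ≠ 0 with hQ'
  have e1 : ∑ κ ∈ Q, cut M κ u * b κ = ∑ κ ∈ Q', cut M κ u * b κ := by
    rw [hQ', Finset.sum_filter]
    refine Finset.sum_congr rfl fun κ _ => ?_
    split_ifs with h
    · rfl
    · push Not at h; rw [h, zero_mul]
  have card : (Q'.card : ℝ) ≤ 3 ^ d := by
    have : Q'.card ≤ (Fintype.piFinset fun i => Finset.Icc (cap M u i - 1) (cap M u i + 1)).card := by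
      refine Finset.card_le_card fun κ hκ => ?_
      rw [Fintype.mem_piFinset]
      exact fun i => cut_near M hM κ u (Finset.mem_filter.1 hκ).2 i
    rw [Fintype.card_piFinset] at this
    simp only [Int.card_Icc] at this
    have e : ∀ i, (cap M u i + 1 + 1 - (cap M u i - 1)).toNat = 3 := fun i => by omega
    simp only [e, Finset.prod_const, Finset.card_univ, Fintype.card_fin] at this
    exact_mod_cast this
  rw [e1]
  calc ‖∑ κ ∈ Q', cut M κ u * b κ‖ ^ 2 ≤ (∑ κ ∈ Q', ‖b κ‖) ^ 2 := by
        refine pow_le_pow_left₀ (norm_nonneg _) ((norm_sum_le _ _).trans (Finset.sum_le_sum fun κ _ => ?_)) 2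
        rw [norm_mul]; exact mul_le_of_le_one_left (norm_nonneg _) (cut_norm _ _ _)
    _ ≤ Q'.card * ∑ κ ∈ Q', ‖b κ‖ ^ 2 := sq_sum_le_card_mul_sum_sq
    _ ≤ 3 ^ d * ∑ κ ∈ Q, ‖b κ‖ ^ 2 := by
        refine mul_le_mul card (Finset.sum_le_sum_of_subset_of_nonneg (Finset.filter_subset _ _) fun _ _ _ => by positivity) (Finset.sum_nonneg fun _ _ => by positivity) (by positivity)

end
end BR

namespace BR

section
variable {d : ℕ} {ι : Type*}

def Good (M ρ c : ℕ) (S1 S2 : Finset (Fin d → ℤ)) : Prop :=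
  (∀ u ∈ S1, ∀ i, 1 ≤ cap M u i ∧ 2 * d * cap M u i < ρ ∧ cap M u i + 3 ≤ ρ) ∧
  (∀ u ∈ S2, ∀ i, 1 ≤ cap M u i ∧ 2 * d * cap M u i < ρ ∧ cap M u i + 3 ≤ ρ) ∧
  (∀ u ∈ S1, ∀ u' ∈ S1, ∀ v ∈ S2, ∀ v' ∈ S2, (ρ : ℤ) ^ 2 ≤ c * ∑ i, (cap M u i - cap M v i) * (cap M u' i - cap M v' i))

lemma Good.symm {M ρ c : ℕ} {S1 S2 : Finset (Fin d → ℤ)} (h : Good M ρ c S1 S2) : Good M ρ c S2 S1 := by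
  refine ⟨h.2.1, h.1, fun u hu u' hu' v hv v' hv' => ?_⟩
  refine (h.2.2 v hv v' hv' u hu u' hu').trans (le_of_eq ?_)
  congr 1
  exact Finset.sum_congr rfl fun i _ => by ring

/-- time interval of a slab -/
def tslab (ρ lam s : ℕ) : Finset ℤ := Finset.Ico ((ρ : ℤ) * (s * lam)) (ρ * ((s + 1) * lam))

lemma hat_sum (N : ℕ) {β : Type*} (S : Finset β) (h : β → (Fin d → ℤ) → ℂ) (u : Fin d → ℤ) :
    ∑ b ∈ S, hat N (h b) u = hat N (fun x => ∑ b ∈ S, h b x) u := by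
  unfold hat
  rw [← Finset.mul_sum, Finset.sum_comm]
  congr 1
  refine Finset.sum_congr rfl fun x _ => ?_
  rw [Finset.sum_mul]

lemma Phi_zero (N : ℕ) (f : (Fin d → ℤ) → ℂ) (h : ∀ u ∈ box d N, f u = 0) (x : Fin d → ℤ) (t : ℤ) : Phi N f x t = 0 := by
  unfold Phi; exact Finset.sum_eq_zero fun u hu => by rw [h u hu, zero_mul]

lemma CD_nonneg (d c K : ℕ) : 0 ≤ CD d c K := by
  have : 0 ≤ Cw := by linarith [one_le_Cw]
  unfold CD cvc CT CK; positivity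

set_option maxHeartbeats 1000000 in
lemma decomp (M N ρ c K lam : ℕ) (hρ : 4 ≤ ρ) (hl : ρ = lam * K) (hN : 16 * ρ ^ 2 ≤ N) (hM : N = M * ρ)
    (S1 S2 : Finset (Fin d → ℤ)) (hG : Good M ρ c S1 S2) (I : Finset ι) (f : (Fin d → ℤ) → ℂ) (g : ι → (Fin d → ℤ) → ℂ)
    (hf : ∀ u ∈ box d N, f u ≠ 0 → u ∈ S1) (hg : ∀ i ∈ I, ∀ u ∈ box d N, g i u ≠ 0 → u ∈ S2) :
    ∃ F : ℕ → (Fin d → ℤ) → ℂ, (∀ u ∈ box d N, ∑ s ∈ Finset.range K, F s u = f u) ∧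
      (∑ s ∈ Finset.range K, En N (F s) ≤ 3 ^ d * En N f) ∧
      (∀ s, ∀ u ∈ box d N, F s u ≠ 0 → ∃ u' ∈ S1, ∀ i, |u i - u' i| < 2 * M) ∧
      (∀ s < K, ∀ s' < K, (s + 2 ≤ s' ∨ s' + 2 ≤ s) → ∑ i ∈ I, ∑ x ∈ box d N, ∑ t ∈ tslab ρ lam s, ‖Phi N (F s') x t * Phi N (g i) x t‖ ^ 2
        ≤ CD d c K * ((ρ : ℝ) ^ (d + 1) / (ρ : ℝ) ^ d / (ρ : ℝ) ^ d) * (En N f * ∑ i ∈ I, En N (g i))) := by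
  classical
  have hN0 : 0 < N := by have : 0 < ρ ^ 2 := by positivity
                         omega
  have hM0 : 0 < M := by rcases Nat.eq_zero_or_pos M with h | h; (subst h; simp at hM; omega); exact h
  have hlam : 0 < lam := by rcases Nat.eq_zero_or_pos lam with h | h; (subst h; simp at hl; omega); exact h
  have hK : 0 < K := by rcases Nat.eq_zero_or_pos K with h | h; (subst h; simp at hl; omega); exact h
  have hNd : (0 : ℝ) < (N : ℝ) ^ d := by positivity
  by_cases hz : ∀ i ∈ I, ∀ u ∈ box d N, g i u = 0
  · refine ⟨fun s => if s = 0 then f else 0, ?_, ?_, ?_, ?_⟩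
    · intro u _
      rw [Finset.sum_eq_single_of_mem 0 (Finset.mem_range.2 hK)]
      · simp
      · intro s _ hs; simp [hs]
    · rw [Finset.sum_eq_single_of_mem 0 (Finset.mem_range.2 hK)]
      · simp only [if_true]
        have := En_nonneg N f
        have h3 : (1 : ℝ) ≤ 3 ^ d := one_le_pow₀ (by norm_num)
        nlinarith
      · intro s _ hs; simp [hs, En]
    · intro s u hu hne
      by_cases h : s = 0
      · simp only [h, if_true] at hne
        exact ⟨u, hf u hu hne, fun i => by simp; omega⟩
      · simp [h] at hne
    · intro s _ s' _ _
      refine le_trans (le_of_eq ?_) (mul_nonneg (mul_nonneg (CD_nonneg _ _ _) (by positivity)) (mul_nonneg (En_nonneg _ _) (Finset.sum_nonneg fun i _ => En_nonneg _ _)))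
      refine Finset.sum_eq_zero fun i hi => Finset.sum_eq_zero fun x _ => Finset.sum_eq_zero fun t _ => ?_
      rw [Phi_zero N (g i) (hz i hi)]; simp
  push Not at hz
  obtain ⟨i0, hi0, u0, hu0, hgu0⟩ := hz
  set Q1 := S1.image (cap M) with hQ1d
  set Q2 := S2.image (cap M) with hQ2d
  have hQ1 : ∀ κ ∈ Q1, ∀ i, 1 ≤ κ i ∧ 2 * d * κ i < ρ ∧ κ i + 3 ≤ ρ := by
    intro κ hκ; obtain ⟨u, hu, rfl⟩ := Finset.mem_image.1 hκ; exact hG.1 u hu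
  have hQ2 : ∀ κ ∈ Q2, ∀ i, 1 ≤ κ i ∧ 2 * d * κ i < ρ ∧ κ i + 3 ≤ ρ := by
    intro κ hκ; obtain ⟨u, hu, rfl⟩ := Finset.mem_image.1 hκ; exact hG.2.1 u hu
  have hA : ∀ κ ∈ Q1, ∀ κ' ∈ Q1, ∀ μ ∈ Q2, ∀ μ' ∈ Q2, (ρ : ℤ) ^ 2 ≤ c * ∑ i, (κ i - μ i) * (κ' i - μ' i) := by
    intro κ hκ κ' hκ' μ hμ μ' hμ'
    obtain ⟨u, hu, rfl⟩ := Finset.mem_image.1 hκ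
    obtain ⟨u', hu', rfl⟩ := Finset.mem_image.1 hκ'
    obtain ⟨v, hv, rfl⟩ := Finset.mem_image.1 hμ
    obtain ⟨v', hv', rfl⟩ := Finset.mem_image.1 hμ'
    exact hG.2.2 u hu u' hu' v hv v' hv'
  have hfQ : ∀ u ∈ box d N, f u ≠ 0 → cap M u ∈ Q1 := fun u hu h => Finset.mem_image_of_mem _ (hf u hu h)
  have hgQ : ∀ i ∈ I, ∀ u ∈ box d N, g i u ≠ 0 → cap M u ∈ Q2 := fun i hi u hu h => Finset.mem_image_of_mem _ (hg i hi u hu h)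
  set φ := ph M N f with hφ
  set ψ : ι → (Fin d → ℤ) → (Fin d → ℤ) → ℂ := fun i => ph M N (g i) with hψ
  have he : ∀ a l, 0 < eng M N ρ Q2 I ψ a l := by
    intro a l
    have hx : ∃ x ∈ box d N, ψ i0 (cap M u0) x ≠ 0 := by
      by_contra hcon
      push Not at hcon
      have h1 := hat_Phi N hN0 (fr M (g i0) (cap M u0)) u0 hu0
      have h2 : hat N (fun x => Phi N (fr M (g i0) (cap M u0)) x 0) u0 = hat N (fun _ => 0) u0 := hat_congr N (fun x hx => hcon x hx) u0
      rw [h2] at h1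
      have h3 : hat N (fun _ : Fin d → ℤ => (0 : ℂ)) u0 = 0 := by simp [hat]
      rw [h3] at h1
      unfold fr at h1
      simp at h1
      exact hgu0 h1.symm
    obtain ⟨x, hx, hxne⟩ := hx
    unfold eng
    refine Finset.sum_pos' (fun i _ => Finset.sum_nonneg fun μ _ => Eq_nonneg _ _ _ _ _ _ _) ⟨i0, hi0, ?_⟩
    refine Finset.sum_pos' (fun μ _ => Eq_nonneg _ _ _ _ _ _ _) ⟨cap M u0, hgQ i0 hi0 u0 hu0 hgu0, ?_⟩
    unfold Eq
    refine Finset.sum_pos' (fun _ _ => by positivity) ⟨x, hx, ?_⟩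
    have := Om_pos M N ((ρ : ℤ) • a - x + (2 * l) • cap M u0)
    have := norm_pos_iff.2 hxne
    positivity
  set e := eng M N ρ Q2 I ψ with hedef
  set h1 : ℕ → (Fin d → ℤ) → (Fin d → ℤ) → ℂ := fun s κ x => (wt M N ρ lam e κ s x : ℂ) * φ κ x with hh1
  have hall : ∀ κ x, 0 < mm M N ρ e (Finset.Ico (0 : ℤ) ρ) κ x := fun κ x => mm_pos M N ρ hM0 e he _ ⟨0, by simp; omega⟩ _ _
  have hw0 : ∀ κ s x, 0 ≤ wt M N ρ lam e κ s x := by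
    intro κ s x; unfold wt
    refine div_nonneg ?_ (hall κ x).le
    unfold mm
    exact Finset.sum_nonneg fun l _ => Finset.sum_nonneg fun a _ => mul_nonneg (he _ _).le (inv_pos.2 (Om_pos _ _ _)).le
  have hw1 : ∀ κ x, ∑ s ∈ Finset.range K, wt M N ρ lam e κ s x = 1 := by
    intro κ x
    unfold wt
    rw [← Finset.sum_div]
    have : ∑ s ∈ Finset.range K, mm M N ρ e (slab lam s) κ x = mm M N ρ e (Finset.Ico (0 : ℤ) ρ) κ x := by
      unfold mm; exact sum_slab ρ K lam hl hlam _
    rw [this]; exact div_self (hall κ x).ne'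
  set F : ℕ → (Fin d → ℤ) → ℂ := fun s u => ∑ κ ∈ Q1, cut M κ u * hat N (h1 s κ) u with hF
  have hFF : ∀ s x t, Phi N (F s) x t = FF M N Q1 (h1 s) x t := by
    intro s x t
    unfold Phi FF
    rw [Finset.sum_comm]
    exact Finset.sum_congr rfl fun u _ => by rw [hF, Finset.sum_mul]
  refine ⟨F, ?_, ?_, ?_, ?_⟩
  · intro u hu
    simp only [hF]
    rw [Finset.sum_comm]
    rw [← sum_fr M f Q1 u (hfQ u hu)]
    refine Finset.sum_congr rfl fun κ _ => ?_
    rw [← Finset.mul_sum, hat_sum]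
    have : (fun x => ∑ s ∈ Finset.range K, h1 s κ x) = ph M N f κ := by
      funext x
      simp only [hh1]
      rw [← Finset.sum_mul]
      have := hw1 κ x
      have h2 : (∑ s ∈ Finset.range K, (wt M N ρ lam e κ s x : ℂ)) = 1 := by exact_mod_cast this
      rw [h2, one_mul]
    rw [this]
    unfold ph
    rw [hat_Phi N hN0 _ u hu, cut_fr M hM0]
  · calc ∑ s ∈ Finset.range K, En N (F s) ≤ ∑ s ∈ Finset.range K, (N : ℝ) ^ d * ∑ u ∈ box d N, 3 ^ d * ∑ κ ∈ Q1, ‖hat N (h1 s κ) u‖ ^ 2 := by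
          refine Finset.sum_le_sum fun s _ => ?_
          unfold En
          exact mul_le_mul_of_nonneg_left (Finset.sum_le_sum fun u _ => sum_cut_sq M hM0 Q1 u _) hNd.le
      _ = ∑ s ∈ Finset.range K, 3 ^ d * ∑ κ ∈ Q1, ∑ x ∈ box d N, ‖h1 s κ x‖ ^ 2 := by
          refine Finset.sum_congr rfl fun s _ => ?_
          rw [← Finset.mul_sum, Finset.sum_comm]
          rw [Finset.mul_sum, Finset.mul_sum, Finset.mul_sum]
          refine Finset.sum_congr rfl fun κ _ => ?_
          rw [← hat_energy N hN0 (h1 s κ)]; ring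
      _ ≤ 3 ^ d * ∑ κ ∈ Q1, ∑ x ∈ box d N, ‖φ κ x‖ ^ 2 := by
          rw [← Finset.mul_sum, Finset.sum_comm]
          refine mul_le_mul_of_nonneg_left (Finset.sum_le_sum fun κ _ => ?_) (by positivity)
          rw [Finset.sum_comm]
          refine Finset.sum_le_sum fun x _ => ?_
          have : ∀ s ∈ Finset.range K, ‖h1 s κ x‖ ^ 2 ≤ wt M N ρ lam e κ s x * ‖φ κ x‖ ^ 2 := by
            intro s hs
            simp only [hh1]
            rw [norm_mul, mul_pow, Complex.norm_real, Real.norm_eq_abs, sq_abs]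
            refine mul_le_mul_of_nonneg_right ?_ (by positivity)
            have le1 : wt M N ρ lam e κ s x ≤ 1 := by
              rw [← hw1 κ x]; exact Finset.single_le_sum (f := fun s => wt M N ρ lam e κ s x) (fun s _ => hw0 κ s x) hs
            have := hw0 κ s x
            nlinarith
          refine (Finset.sum_le_sum this).trans ?_
          rw [← Finset.sum_mul, hw1, one_mul]
      _ ≤ _ := mul_le_mul_of_nonneg_left (ph_energy M N hN0 f Q1) (by positivity)
  · intro s u hu hne
    obtain ⟨κ, hκ, hκne⟩ := Finset.exists_ne_zero_of_sum_ne_zero hne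
    obtain ⟨u', hu', rfl⟩ := Finset.mem_image.1 hκ
    refine ⟨u', hu', fun i => ?_⟩
    have c1 := cut_supp M _ u (left_ne_zero_of_mul hκne) i
    have c2 := cap_bd M hM0 u' i
    unfold vv at c1 c2
    have hM' : (0 : ℝ) < M := by exact_mod_cast hM0
    have c3 : (u i : ℝ) / M - u' i / M < 2 := by linarith
    have c4 : -2 < (u i : ℝ) / M - u' i / M := by linarith
    rw [← sub_div, div_lt_iff₀ hM'] at c3
    rw [← sub_div, lt_div_iff₀ hM'] at c4
    rw [abs_lt]
    constructor
    · have : ((-(2 * M) : ℤ) : ℝ) < ((u i - u' i : ℤ) : ℝ) := by push_cast; linarith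
      exact_mod_cast this
    · have : ((u i - u' i : ℤ) : ℝ) < ((2 * M : ℤ) : ℝ) := by push_cast; linarith
      exact_mod_cast this
  · intro s hs s' hs' hfar
    have h4 := D4 M N ρ c K lam hρ hl hN hM Q1 Q2 hQ1 hQ2 hA s s' hs hs' hfar I φ ψ he
    refine le_trans (le_of_eq ?_) (h4.trans ?_)
    · refine Finset.sum_congr rfl fun i hi => ?_
      rw [← sum_reindex M N ρ hM (by omega)]
      refine Finset.sum_congr rfl fun a _ => ?_
      unfold slab cellZ tslab
      simp only [Finset.sum_product]
      rw [Finset.sum_comm (s := Finset.Ico ((s : ℤ) * lam) ((s + 1) * lam))]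
      refine Finset.sum_congr rfl fun w _ => ?_
      rw [← sum_reindex_t ρ (by omega)]
      refine Finset.sum_congr rfl fun l _ => Finset.sum_congr rfl fun t _ => ?_
      rw [hFF, ← FF_ph M N hM0 hN0 (g i) Q2 (hgQ i hi)]
    · refine mul_le_mul_of_nonneg_left ?_ (mul_nonneg (CD_nonneg _ _ _) (by positivity))
      refine mul_le_mul (ph_energy M N hN0 f Q1) (Finset.sum_le_sum fun i _ => ph_energy M N hN0 (g i) Q2) (by positivity) (En_nonneg _ _)

end
end BR

namespace BR

section
variable {d : ℕ}

lemma Phi_sum (N : ℕ) {β : Type*} (S : Finset β) (F : β → (Fin d → ℤ) → ℂ) (x : Fin d → ℤ) (t : ℤ) :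
    Phi N (fun u => ∑ s ∈ S, F s u) x t = ∑ s ∈ S, Phi N (F s) x t := by
  unfold Phi
  rw [Finset.sum_comm]
  exact Finset.sum_congr rfl fun u _ => by rw [Finset.sum_mul]

lemma Phi_congr (N : ℕ) {f g : (Fin d → ℤ) → ℂ} (h : ∀ u ∈ box d N, f u = g u) (x : Fin d → ℤ) (t : ℤ) :
    Phi N f x t = Phi N g x t := by
  unfold Phi; exact Finset.sum_congr rfl fun u hu => by rw [h u hu]

lemma En_sum (N : ℕ) {β : Type*} (S : Finset β) (F : β → (Fin d → ℤ) → ℂ) :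
    En N (fun u => ∑ s ∈ S, F s u) ≤ S.card * ∑ s ∈ S, En N (F s) := by
  unfold En
  rw [← Finset.mul_sum, Finset.sum_comm, mul_left_comm, Finset.mul_sum (a := (S.card : ℝ))]
  gcongr with u hu
  refine (pow_le_pow_left₀ (norm_nonneg _) (norm_sum_le _ _) 2).trans ?_
  exact sq_sum_le_card_mul_sum_sq

lemma Phi_shift (N : ℕ) (f : (Fin d → ℤ) → ℂ) (x : Fin d → ℤ) (t0 t : ℤ) :
    Phi N f x (t0 + t) = Phi N (fun u => f u * ee (t0 * quad N u)) x t := by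
  unfold Phi
  refine Finset.sum_congr rfl fun u _ => ?_
  rw [mul_assoc, ← ee_add]
  congr 2; push_cast; ring

lemma En_shift (N : ℕ) (f : (Fin d → ℤ) → ℂ) (w : (Fin d → ℤ) → ℝ) :
    En N (fun u => f u * ee (w u)) = En N f := by
  unfold En; simp [norm_ee]

lemma l1 (N : ℕ) (hN : 0 < N) (f g : (Fin d → ℤ) → ℂ) (T : Finset ℤ) :
    ∑ z ∈ box d N ×ˢ T, ‖Phi N f z.1 z.2 * Phi N g z.1 z.2‖ ≤ T.card * (√(En N f) * √(En N g)) := by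
  rw [Finset.sum_product_right, ← nsmul_eq_mul]
  refine Finset.sum_le_card_nsmul _ _ _ fun t _ => ?_
  simp only [norm_mul]
  refine (Real.sum_mul_le_sqrt_mul_sqrt _ _ _).trans ?_
  rw [energy N hN, energy N hN]

lemma nonloc {α : Type*} {p : ℝ} (hd : 1 ≤ d) (hp : p = (d + 3) / (d + 1)) (Z : Finset α) (h : α → ℂ) (ρ C E : ℝ) (hρ : 0 < ρ)
    (hC : 1 ≤ C) (hE : 0 ≤ E) (h1 : ∑ z ∈ Z, ‖h z‖ ≤ C * (ρ ^ 2 * E))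
    (h2 : ∑ z ∈ Z, ‖h z‖ ^ 2 ≤ C * (ρ ^ (d + 1) / ρ ^ d / ρ ^ d) * E ^ 2) : Nrm p Z h ≤ C * E := by
  have hd' : (1 : ℝ) ≤ d := by exact_mod_cast hd
  have hp1 : 1 < p := by rw [hp, lt_div_iff₀ (by positivity)]; linarith
  have hp2 : p ≤ 2 := by rw [hp, div_le_iff₀ (by positivity)]; linarith
  have hpd : p * (d + 1) = d + 3 := by rw [hp]; field_simp
  have hC0 : 0 < C := by linarith
  have key : ∑ z ∈ Z, ‖h z‖ ^ p ≤ C * E ^ p := by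
    refine (interp hp1 hp2 h).trans ?_
    have e1 : (∑ z ∈ Z, ‖h z‖) ^ (2 - p) ≤ (C * (ρ ^ 2 * E)) ^ (2 - p) :=
      Real.rpow_le_rpow (by positivity) h1 (by linarith)
    have e2 : (∑ z ∈ Z, ‖h z‖ ^ 2) ^ (p - 1) ≤ (C * (ρ ^ (d + 1) / ρ ^ d / ρ ^ d) * E ^ 2) ^ (p - 1) :=
      Real.rpow_le_rpow (by positivity) h2 (by linarith)
    refine (mul_le_mul e1 e2 (by positivity) (by positivity)).trans (le_of_eq ?_)
    rcases eq_or_lt_of_le hE with rfl | hE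
    · have : p - 1 ≠ 0 := by linarith
      have h0 : p ≠ 0 := by linarith
      rw [show C * (ρ ^ (d + 1) / ρ ^ d / ρ ^ d) * 0 ^ 2 = 0 by ring, Real.zero_rpow this, Real.zero_rpow h0]; ring
    have e3 : (ρ ^ (d + 1) / ρ ^ d / ρ ^ d) = ρ ^ (1 - d : ℝ) := by
      rw [Real.rpow_sub hρ, Real.rpow_one, Real.rpow_natCast, pow_succ]; field_simp
    rw [e3, Real.mul_rpow (by positivity) (by positivity), Real.mul_rpow (by positivity) (by positivity), Real.mul_rpow (by positivity) (by positivity), Real.mul_rpow (by positivity) (by positivity),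
      ← Real.rpow_natCast ρ 2, ← Real.rpow_natCast E 2, ← Real.rpow_mul hρ.le, ← Real.rpow_mul hρ.le, ← Real.rpow_mul hE.le]
    have a1 : C ^ (2 - p) * C ^ (p - 1) = C := by rw [← Real.rpow_add hC0]; ring_nf; simp
    have a2 : ρ ^ ((2 : ℕ) * (2 - p)) * ρ ^ ((1 - d) * (p - 1)) = 1 := by
      rw [← Real.rpow_add hρ]
      have : ((2 : ℕ) : ℝ) * (2 - p) + (1 - d) * (p - 1) = 0 := by push_cast; linarith
      rw [this, Real.rpow_zero]
    have a3 : E ^ (2 - p) * E ^ ((2 : ℕ) * (p - 1)) = E ^ p := by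
      rw [← Real.rpow_add hE]; congr 1; push_cast; ring
    calc _ = (C ^ (2 - p) * C ^ (p - 1)) * (ρ ^ ((2 : ℕ) * (2 - p)) * ρ ^ ((1 - d) * (p - 1))) * (E ^ (2 - p) * E ^ ((2 : ℕ) * (p - 1))) := by ring
      _ = _ := by rw [a1, a2, a3]; ring
  unfold Nrm
  have hp0 : 0 < p := by linarith
  refine (Real.rpow_le_rpow (by positivity) key (by positivity)).trans ?_
  rw [Real.mul_rpow (by positivity) (by positivity), ← Real.rpow_mul hE, mul_one_div_cancel hp0.ne', Real.rpow_one]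
  refine mul_le_mul_of_nonneg_right ?_ hE
  calc C ^ (1 / p) ≤ C ^ (1 : ℝ) := Real.rpow_le_rpow_of_exponent_le hC (by rw [div_le_one hp0]; linarith)
    _ = C := Real.rpow_one _

lemma Nrm_union {α β : Type*} {p : ℝ} (hp : 1 ≤ p) (Z : Finset α) (S : Finset β) (Y : β → Finset α) (h : α → ℂ)
    (hZ : ∀ F : α → ℝ, ∑ z ∈ Z, F z = ∑ s ∈ S, ∑ z ∈ Y s, F z) : Nrm p Z h ≤ ∑ s ∈ S, Nrm p (Y s) h := by
  have h1 := Nrm_le_l1 (Z := S) hp (fun s => (Nrm p (Y s) h : ℂ))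
  have h2 : ∀ s, ‖(Nrm p (Y s) h : ℂ)‖ = Nrm p (Y s) h := fun s => by
    rw [Complex.norm_real, Real.norm_eq_abs, abs_of_nonneg (Nrm_nonneg h)]
  simp only [h2] at h1
  refine le_trans (le_of_eq ?_) h1
  have hp0 : p ≠ 0 := by linarith
  unfold Nrm at h2 ⊢
  simp only [h2]
  rw [hZ]
  congr 1
  refine Finset.sum_congr rfl fun s _ => ?_
  rw [← Real.rpow_mul (by positivity), one_div_mul_cancel hp0, Real.rpow_one]

lemma tslab_sum (ρ K lam : ℕ) (hl : ρ = lam * K) (h0 : 0 < ρ) (hlam : 0 < lam) (F : ℤ → ℝ) :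
    ∑ t ∈ Finset.Ico (0 : ℤ) (ρ ^ 2 : ℕ), F t = ∑ s ∈ Finset.range K, ∑ t ∈ tslab ρ lam s, F t := by
  rw [← sum_slab (ρ ^ 2) K (ρ * lam) (by rw [mul_assoc, ← hl]; ring) (by positivity) F]
  refine Finset.sum_congr rfl fun s _ => ?_
  unfold slab tslab
  congr 2 <;> push_cast <;> ring

def Est (p : ℝ) (N ρ : ℕ) (S1 S2 : Finset (Fin d → ℤ)) (A : ℝ) : Prop :=
  ∀ f g : (Fin d → ℤ) → ℂ, (∀ u ∈ box d N, f u ≠ 0 → u ∈ S1) → (∀ u ∈ box d N, g u ≠ 0 → u ∈ S2) →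
    Nrm p (box d N ×ˢ Finset.Ico (0 : ℤ) (ρ ^ 2 : ℕ)) (fun z => Phi N f z.1 z.2 * Phi N g z.1 z.2) ≤ A * (√(En N f) * √(En N g))

def nr (K s : ℕ) : Finset ℕ := (Finset.range K).filter fun s' => ¬ (s + 2 ≤ s' ∨ s' + 2 ≤ s)
def fa (K s : ℕ) : Finset ℕ := (Finset.range K).filter fun s' => (s + 2 ≤ s' ∨ s' + 2 ≤ s)

lemma nr_card (K s : ℕ) : (nr K s).card ≤ 3 := by
  have : nr K s ⊆ Finset.Icc (s - 1) (s + 1) := by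
    intro a ha; simp only [nr, Finset.mem_filter, Finset.mem_range] at ha; simp only [Finset.mem_Icc]; omega
  refine (Finset.card_le_card this).trans ?_
  simp; omega

lemma fa_card (K s : ℕ) : (fa K s).card ≤ K := (Finset.card_filter_le _ _).trans (by simp)

lemma nr_fa (K s : ℕ) (F : ℕ → ℂ) : ∑ s' ∈ Finset.range K, F s' = ∑ s' ∈ nr K s, F s' + ∑ s' ∈ fa K s, F s' := by
  unfold nr fa; rw [add_comm, Finset.sum_filter_add_sum_filter_not]

lemma nr_double (K : ℕ) (b : ℕ → ℝ) (hb : ∀ s, 0 ≤ b s) : ∑ s ∈ Finset.range K, ∑ s' ∈ nr K s, b s' ≤ 3 * ∑ s ∈ Finset.range K, b s := by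
  rw [Finset.sum_comm' (t' := Finset.range K) (s' := fun s' => nr K s') (by intro x y; simp only [nr, Finset.mem_filter, Finset.mem_range]; omega), Finset.mul_sum]
  refine Finset.sum_le_sum fun s _ => ?_
  rw [Finset.sum_const, nsmul_eq_mul]
  exact mul_le_mul_of_nonneg_right (by exact_mod_cast nr_card K s) (hb s)

/-- energies of near parts -/
lemma En_near (N K : ℕ) (f : (Fin d → ℤ) → ℂ) (F : ℕ → (Fin d → ℤ) → ℂ) (hF : ∑ s ∈ Finset.range K, En N (F s) ≤ 3 ^ d * En N f) :
    ∑ s ∈ Finset.range K, En N (fun u => ∑ s' ∈ nr K s, F s' u) ≤ 9 * 3 ^ d * En N f := by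
  calc _ ≤ ∑ s ∈ Finset.range K, 3 * ∑ s' ∈ nr K s, En N (F s') := by
        refine Finset.sum_le_sum fun s _ => (En_sum N _ _).trans ?_
        exact mul_le_mul_of_nonneg_right (by exact_mod_cast nr_card K s) (Finset.sum_nonneg fun _ _ => En_nonneg _ _)
    _ ≤ 3 * (3 * ∑ s ∈ Finset.range K, En N (F s)) := by
        rw [← Finset.mul_sum]
        exact mul_le_mul_of_nonneg_left (nr_double K _ fun s => En_nonneg _ _) (by norm_num)
    _ ≤ _ := by linarith

lemma slab_local {p : ℝ} (N ρ lam ρ' s : ℕ) (hρ' : ρ' ^ 2 = ρ * lam) (S1 S2 : Finset (Fin d → ℤ)) (A : ℝ) (hE : Est p N ρ' S1 S2 A)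
    (f g : (Fin d → ℤ) → ℂ) (hf : ∀ u ∈ box d N, f u ≠ 0 → u ∈ S1) (hg : ∀ u ∈ box d N, g u ≠ 0 → u ∈ S2) :
    Nrm p (box d N ×ˢ tslab ρ lam s) (fun z => Phi N f z.1 z.2 * Phi N g z.1 z.2) ≤ A * (√(En N f) * √(En N g)) := by
  set t0 : ℤ := ρ * (s * lam)
  have h := hE (fun u => f u * ee (t0 * quad N u)) (fun u => g u * ee (t0 * quad N u))
    (fun u hu h => hf u hu (left_ne_zero_of_mul h)) (fun u hu h => hg u hu (left_ne_zero_of_mul h))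
  rw [En_shift N f (fun u => t0 * quad N u), En_shift N g (fun u => t0 * quad N u)] at h
  refine le_trans (le_of_eq ?_) h
  unfold Nrm
  congr 1
  rw [Finset.sum_product, Finset.sum_product]
  refine Finset.sum_congr rfl fun x _ => ?_
  have : tslab ρ lam s = (Finset.Ico (0 : ℤ) (ρ' ^ 2 : ℕ)).image (fun t => t0 + t) := by
    rw [Finset.image_add_left_Ico, hρ']
    unfold tslab; rw [add_zero]; congr 1
    push_cast; ring
  rw [this, Finset.sum_image (fun a _ b _ h => by simpa using h)]
  exact Finset.sum_congr rfl fun t _ => by simp only [Phi_shift]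

set_option maxHeartbeats 1000000 in
lemma step {p : ℝ} (hd : 1 ≤ d) (hp : p = (d + 3) / (d + 1)) (M N ρ c K lam ρ' : ℕ) (hρ : 4 ≤ ρ) (hl : ρ = lam * K) (hN : 16 * ρ ^ 2 ≤ N) (hM : N = M * ρ)
    (hρ' : ρ' ^ 2 = ρ * lam) (S1 S2 S1' S2' : Finset (Fin d → ℤ)) (hS : S1 ⊆ S1') (hG : Good M ρ c S1' S2)
    (hS1 : ∀ u ∈ box d N, (∃ u' ∈ S1, ∀ i, |u i - u' i| < 2 * (M : ℤ)) → u ∈ S1') (hS2 : ∀ u ∈ box d N, (∃ u' ∈ S2, ∀ i, |u i - u' i| < 2 * (M : ℤ)) → u ∈ S2')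
    (A : ℝ) (hA : 0 ≤ A) (hE : Est p N ρ' S1' S2' A) :
    Est p N ρ S1 S2 (9 * 3 ^ d * A + 2 * K ^ 2 * ((CD d c K + 1) * (9 * 3 ^ d))) := by
  intro f g hf hg
  have hd' : (1 : ℝ) ≤ d := by exact_mod_cast hd
  have hp1 : 1 ≤ p := by rw [hp, le_div_iff₀ (by positivity)]; linarith
  have hN0 : 0 < N := by have : 0 < ρ ^ 2 := by positivity
                         omega
  have hlam : 0 < lam := by rcases Nat.eq_zero_or_pos lam with h | h; (subst h; simp at hl; omega); exact h
  have hρ0 : (0 : ℝ) < ρ := by have : 0 < ρ := by omega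
                               exact_mod_cast this
  have hK1 : 1 ≤ K := by rcases Nat.eq_zero_or_pos K with h | h; (subst h; simp at hl; omega); exact h
  have hG1 : Good M ρ c S1 S2 := ⟨fun u hu => hG.1 u (hS hu), hG.2.1, fun u hu u' hu' => hG.2.2 u (hS hu) u' (hS hu')⟩
  obtain ⟨F, F1, F2, F3, F4⟩ := decomp M N ρ c K lam hρ hl hN hM S1 S2 hG1 ({()} : Finset Unit) f (fun _ => g) hf (fun _ _ => hg)
  set Fn : ℕ → (Fin d → ℤ) → ℂ := fun s u => ∑ s' ∈ nr K s, F s' u with hFn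
  have hFn1 : ∀ s, ∀ u ∈ box d N, Fn s u ≠ 0 → u ∈ S1' := by
    intro s u hu h
    obtain ⟨s', _, h'⟩ := Finset.exists_ne_zero_of_sum_ne_zero h
    exact hS1 u hu (F3 s' u hu h')
  obtain ⟨G, G1, G2, G3, G4⟩ := decomp M N ρ c K lam hρ hl hN hM S2 S1' hG.symm (Finset.range K) g Fn hg (fun s _ => hFn1 s)
  set Gn : ℕ → (Fin d → ℤ) → ℂ := fun s u => ∑ s' ∈ nr K s, G s' u with hGn
  have hGn1 : ∀ s, ∀ u ∈ box d N, Gn s u ≠ 0 → u ∈ S2' := by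
    intro s u hu h
    obtain ⟨s', _, h'⟩ := Finset.exists_ne_zero_of_sum_ne_zero h
    exact hS2 u hu (G3 s' u hu h')
  have eF := En_near N K f F F2
  have eG := En_near N K g G G2
  set E := √(En N f) * √(En N g) with hEdef
  have hE0 : 0 ≤ E := by positivity
  have hE2 : E ^ 2 = En N f * En N g := by rw [hEdef, mul_pow, Real.sq_sqrt (En_nonneg _ _), Real.sq_sqrt (En_nonneg _ _)]
  set C := (CD d c K + 1) * (9 * 3 ^ d) with hC
  have hCD := CD_nonneg d c K
  have h3 : (1 : ℝ) ≤ 3 ^ d := one_le_pow₀ (by norm_num)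
  have hC1 : 1 ≤ C := by rw [hC]; nlinarith
  have hC9 : 9 * 3 ^ d ≤ C := by rw [hC]; nlinarith
  have hCDC : CD d c K * (9 * 3 ^ d) ≤ C := by rw [hC]; nlinarith
  have hcard : ∀ s, ((tslab ρ lam s).card : ℝ) ≤ ρ ^ 2 := by
    intro s
    have h1 : (tslab ρ lam s).card = ρ * lam := by
      unfold tslab; rw [Int.card_Ico]
      have : (ρ : ℤ) * ((s + 1) * lam) - ρ * (s * lam) = ((ρ * lam : ℕ) : ℤ) := by push_cast; ring
      rw [this, Int.toNat_natCast]
    rw [h1]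
    have : lam ≤ ρ := by rw [hl]; exact Nat.le_mul_of_pos_right _ hK1
    have : ρ * lam ≤ ρ ^ 2 := by rw [sq]; exact Nat.mul_le_mul_left _ this
    exact_mod_cast this
  have hsq : ∀ a b : ℝ, 0 ≤ a → 0 ≤ b → a ≤ 9 * 3 ^ d * En N f → b ≤ 9 * 3 ^ d * En N g → √a * √b ≤ 9 * 3 ^ d * E := by
    intro a b ha hb h1 h2
    have : √a * √b ≤ √(9 * 3 ^ d * En N f) * √(9 * 3 ^ d * En N g) := mul_le_mul (Real.sqrt_le_sqrt h1) (Real.sqrt_le_sqrt h2) (by positivity) (by positivity)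
    refine this.trans (le_of_eq ?_)
    rw [Real.sqrt_mul (show (0 : ℝ) ≤ 9 * 3 ^ d by positivity), Real.sqrt_mul (show (0 : ℝ) ≤ 9 * 3 ^ d by positivity), hEdef]
    have := Real.mul_self_sqrt (show (0 : ℝ) ≤ 9 * 3 ^ d by positivity)
    linear_combination (√(En N f) * √(En N g)) * this
  -- nonlocal estimates
  have hnl : ∀ (s : ℕ) (a b : (Fin d → ℤ) → ℂ), En N a ≤ 9 * 3 ^ d * En N f → En N b ≤ 9 * 3 ^ d * En N g →
      (∑ x ∈ box d N, ∑ t ∈ tslab ρ lam s, ‖Phi N a x t * Phi N b x t‖ ^ 2 ≤ CD d c K * ((ρ : ℝ) ^ (d + 1) / (ρ : ℝ) ^ d / (ρ : ℝ) ^ d) * (9 * 3 ^ d * E ^ 2)) →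
      Nrm p (box d N ×ˢ tslab ρ lam s) (fun z => Phi N a z.1 z.2 * Phi N b z.1 z.2) ≤ C * E := by
    intro s a b ha hb hab
    refine nonloc hd hp _ _ ρ C E hρ0 hC1 hE0 ?_ ?_
    · refine (l1 N hN0 a b _).trans ?_
      have := hsq _ _ (En_nonneg N a) (En_nonneg N b) ha hb
      calc _ ≤ (ρ : ℝ) ^ 2 * (9 * 3 ^ d * E) := mul_le_mul (hcard s) this (by positivity) (by positivity)
        _ ≤ (ρ : ℝ) ^ 2 * (C * E) := by gcongr
        _ = _ := by ring
    · rw [Finset.sum_product]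
      refine hab.trans ?_
      calc _ = CD d c K * (9 * 3 ^ d) * ((ρ : ℝ) ^ (d + 1) / (ρ : ℝ) ^ d / (ρ : ℝ) ^ d) * E ^ 2 := by ring
        _ ≤ _ := by gcongr
  have hEf := En_nonneg N f
  have hEg := En_nonneg N g
  have hFs : ∀ s ∈ Finset.range K, En N (F s) ≤ 9 * 3 ^ d * En N f := fun s hs => by
    have := (Finset.single_le_sum (f := fun s => En N (F s)) (fun s _ => En_nonneg N _) hs).trans F2
    nlinarith [mul_nonneg (show (0 : ℝ) ≤ 3 ^ d by positivity) hEf]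
  have hGs : ∀ s ∈ Finset.range K, En N (G s) ≤ 9 * 3 ^ d * En N g := fun s hs => by
    have := (Finset.single_le_sum (f := fun s => En N (G s)) (fun s _ => En_nonneg N _) hs).trans G2
    nlinarith [mul_nonneg (show (0 : ℝ) ≤ 3 ^ d by positivity) hEg]
  have hFns : ∀ s ∈ Finset.range K, En N (Fn s) ≤ 9 * 3 ^ d * En N f := fun s hs =>
    (Finset.single_le_sum (f := fun s => En N (Fn s)) (fun s _ => En_nonneg N _) hs).trans eF
  have hsl : ∀ s ∈ Finset.range K, Nrm p (box d N ×ˢ tslab ρ lam s) (fun z => Phi N f z.1 z.2 * Phi N g z.1 z.2)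
      ≤ A * (√(En N (Fn s)) * √(En N (Gn s))) + 2 * K * (C * E) := by
    intro s hs
    have hsK := Finset.mem_range.1 hs
    have hdec : ∀ z : (Fin d → ℤ) × ℤ, Phi N f z.1 z.2 * Phi N g z.1 z.2 = Phi N (Fn s) z.1 z.2 * Phi N (Gn s) z.1 z.2
        + (∑ s' ∈ fa K s, Phi N (G s') z.1 z.2 * Phi N (Fn s) z.1 z.2 + ∑ s' ∈ fa K s, Phi N (F s') z.1 z.2 * Phi N g z.1 z.2) := by
      intro z
      have e1 : Phi N f z.1 z.2 = Phi N (Fn s) z.1 z.2 + ∑ s' ∈ fa K s, Phi N (F s') z.1 z.2 := by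
        rw [← Phi_congr N F1, Phi_sum, nr_fa K s, hFn, Phi_sum]
      have e2 : Phi N g z.1 z.2 = Phi N (Gn s) z.1 z.2 + ∑ s' ∈ fa K s, Phi N (G s') z.1 z.2 := by
        rw [← Phi_congr N G1, Phi_sum, nr_fa K s, hGn, Phi_sum]
      rw [← Finset.sum_mul, ← Finset.sum_mul]
      calc _ = Phi N (Fn s) z.1 z.2 * Phi N g z.1 z.2 + (∑ s' ∈ fa K s, Phi N (F s') z.1 z.2) * Phi N g z.1 z.2 := by rw [e1]; ring
        _ = Phi N (Fn s) z.1 z.2 * (Phi N (Gn s) z.1 z.2 + ∑ s' ∈ fa K s, Phi N (G s') z.1 z.2) + (∑ s' ∈ fa K s, Phi N (F s') z.1 z.2) * Phi N g z.1 z.2 := by rw [← e2]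
        _ = _ := by ring
    simp only [hdec]
    refine (Nrm_add hp1 _ _).trans (add_le_add (slab_local N ρ lam ρ' s hρ' S1' S2' A hE _ _ (hFn1 s) (hGn1 s)) ?_)
    refine (Nrm_add hp1 _ _).trans ?_
    have hfK : ((fa K s).card : ℝ) ≤ K := by exact_mod_cast fa_card K s
    have n1 : Nrm p (box d N ×ˢ tslab ρ lam s) (fun z => ∑ s' ∈ fa K s, Phi N (G s') z.1 z.2 * Phi N (Fn s) z.1 z.2) ≤ K * (C * E) := by
      refine (Nrm_sum hp1 _ _).trans ((Finset.sum_le_card_nsmul _ _ (C * E) fun s' hs' => ?_).trans ?_)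
      · simp only [fa, Finset.mem_filter] at hs'
        have h4 := G4 s hsK s' (Finset.mem_range.1 hs'.1) hs'.2
        have : (fun z : (Fin d → ℤ) × ℤ => Phi N (G s') z.1 z.2 * Phi N (Fn s) z.1 z.2) = fun z => Phi N (Fn s) z.1 z.2 * Phi N (G s') z.1 z.2 := by
          funext z; ring
        rw [this]
        refine hnl s _ _ (hFns s hs) (hGs s' hs'.1) ?_
        refine le_trans ?_ (h4.trans ?_)
        · refine le_trans (le_of_eq ?_) (Finset.single_le_sum (f := fun s => ∑ x ∈ box d N, ∑ t ∈ tslab ρ lam _, ‖Phi N (G s') x t * Phi N (Fn s) x t‖ ^ 2) (fun _ _ => by positivity) hs)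
          exact Finset.sum_congr rfl fun x _ => Finset.sum_congr rfl fun t _ => by rw [mul_comm]
        · refine mul_le_mul_of_nonneg_left ?_ (by positivity)
          rw [hE2]
          calc _ ≤ En N g * (9 * 3 ^ d * En N f) := mul_le_mul_of_nonneg_left eF hEg
            _ = _ := by ring
      · rw [nsmul_eq_mul]; gcongr
    have n2 : Nrm p (box d N ×ˢ tslab ρ lam s) (fun z => ∑ s' ∈ fa K s, Phi N (F s') z.1 z.2 * Phi N g z.1 z.2) ≤ K * (C * E) := by
      refine (Nrm_sum hp1 _ _).trans ((Finset.sum_le_card_nsmul _ _ (C * E) fun s' hs' => ?_).trans ?_)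
      · simp only [fa, Finset.mem_filter] at hs'
        have h4 := F4 s hsK s' (Finset.mem_range.1 hs'.1) hs'.2
        simp only [Finset.sum_singleton] at h4
        refine hnl s _ _ (hFs s' hs'.1) (by nlinarith) (h4.trans ?_)
        refine mul_le_mul_of_nonneg_left ?_ (by positivity)
        rw [hE2]
        nlinarith [mul_nonneg hEf hEg]
      · rw [nsmul_eq_mul]; gcongr
    linarith
  have hU := Nrm_union hp1 (box d N ×ˢ Finset.Ico (0 : ℤ) (ρ ^ 2 : ℕ)) (Finset.range K) (fun s => box d N ×ˢ tslab ρ lam s)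
    (fun z => Phi N f z.1 z.2 * Phi N g z.1 z.2) (by
      intro F
      simp only [Finset.sum_product]
      rw [Finset.sum_comm (s := Finset.range K)]
      exact Finset.sum_congr rfl fun x _ => tslab_sum ρ K lam hl (by omega) hlam _)
  refine hU.trans ((Finset.sum_le_sum hsl).trans ?_)
  rw [Finset.sum_add_distrib, ← Finset.mul_sum, Finset.sum_const, Finset.card_range, nsmul_eq_mul]
  have hcs : ∑ s ∈ Finset.range K, √(En N (Fn s)) * √(En N (Gn s)) ≤ 9 * 3 ^ d * E := by
    refine (Real.sum_sqrt_mul_sqrt_le _ (fun s => En_nonneg N (Fn s)) (fun s => En_nonneg N (Gn s))).trans ?_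
    exact hsq _ _ (Finset.sum_nonneg fun _ _ => En_nonneg _ _) (Finset.sum_nonneg fun _ _ => En_nonneg _ _) eF eG
  nlinarith [mul_le_mul_of_nonneg_left hcs hA]

end
end BR

namespace BR

section
variable {d : ℕ}

open Classical in
def Fat (N : ℕ) (P : Set (Fin d → ℝ)) (r : ℝ) : Finset (Fin d → ℤ) :=
  (box d N).filter fun u => ∃ ζ ∈ P, ∀ i, |(u i : ℝ) / N - ζ i| ≤ r

lemma mem_Fat {N : ℕ} {P : Set (Fin d → ℝ)} {r : ℝ} {u : Fin d → ℤ} :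
    u ∈ Fat N P r ↔ u ∈ box d N ∧ ∃ ζ ∈ P, ∀ i, |(u i : ℝ) / N - ζ i| ≤ r := by
  unfold Fat; simp only [Finset.mem_filter]

def PB (P : Set (Fin d → ℝ)) : Prop := ∀ ζ ∈ P, ∀ i, 1 / (8 * d) ≤ ζ i ∧ ζ i ≤ 3 / (8 * (d : ℝ))
def PT (c0 : ℝ) (P1 P2 : Set (Fin d → ℝ)) : Prop :=
  ∀ ζ ∈ P1, ∀ ζ' ∈ P1, ∀ η ∈ P2, ∀ η' ∈ P2, c0 ≤ ∑ i, (ζ i - η i) * (ζ' i - η' i)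

lemma cap_fat (M N ρ : ℕ) (hM0 : 0 < M) (hρ : 0 < ρ) (hM : N = M * ρ) (P : Set (Fin d → ℝ)) (r : ℝ) (hr : r ≤ 4 / ρ)
    (u : Fin d → ℤ) (hu : u ∈ Fat N P r) : ∃ ζ ∈ P, ∀ i, |(cap M u i : ℝ) - ρ * ζ i| ≤ 5 := by
  obtain ⟨ζ, hζ, h⟩ := (mem_Fat.1 hu).2
  refine ⟨ζ, hζ, fun i => ?_⟩
  have h1 := cap_bd M hM0 u i
  unfold vv at h1
  have h2 := abs_le.1 ((h i).trans hr)
  have hρ' : (0 : ℝ) < ρ := by exact_mod_cast hρ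
  have hM' : (0 : ℝ) < M := by exact_mod_cast hM0
  have e : (u i : ℝ) / M = ρ * (u i / N) := by rw [hM]; push_cast; field_simp
  rw [e] at h1
  have h3 : ρ * ((u i : ℝ) / N - ζ i) ≤ 4 := by
    calc _ ≤ ρ * (4 / ρ : ℝ) := mul_le_mul_of_nonneg_left h2.2 hρ'.le
      _ = 4 := by field_simp
  have h4 : -4 ≤ ρ * ((u i : ℝ) / N - ζ i) := by
    calc (-4 : ℝ) = ρ * (-(4 / ρ : ℝ)) := by field_simp
      _ ≤ _ := mul_le_mul_of_nonneg_left h2.1 hρ'.le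
  rw [abs_le]; constructor <;> linarith

lemma good_of (hd : 1 ≤ d) (M N ρ c : ℕ) (hM0 : 0 < M) (hM : N = M * ρ) (P1 P2 : Set (Fin d → ℝ)) (c0 : ℝ)
    (hP1 : PB P1) (hP2 : PB P2) (hT : PT c0 P1 P2) (r1 r2 : ℝ) (hr1 : r1 ≤ 4 / ρ) (hr2 : r2 ≤ 4 / ρ)
    (hρ1 : 64 * d ≤ ρ) (hρ2 : 80 * d ≤ ρ * c0) (hc : 2 ≤ c * c0) : Good M ρ c (Fat N P1 r1) (Fat N P2 r2) := by
  have hρ0 : 0 < ρ := by omega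
  have hρr : (64 * d : ℝ) ≤ ρ := by exact_mod_cast hρ1
  have hd' : (1 : ℝ) ≤ d := by exact_mod_cast hd
  have hb : ∀ (P : Set (Fin d → ℝ)) (r : ℝ), PB P → r ≤ 4 / ρ → ∀ u ∈ Fat N P r, ∀ i, 1 ≤ cap M u i ∧ 2 * d * cap M u i < ρ ∧ cap M u i + 3 ≤ ρ := by
    intro P r hP hr u hu i
    obtain ⟨ζ, hζ, h⟩ := cap_fat M N ρ hM0 hρ0 hM P r hr u hu
    have h1 := abs_le.1 (h i)
    obtain ⟨h2, h3⟩ := hP ζ hζ i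
    have h4 : 8 ≤ ρ * ζ i := by
      calc (8 : ℝ) = (64 * d) * (1 / (8 * d)) := by field_simp; norm_num
        _ ≤ ρ * ζ i := mul_le_mul hρr h2 (by positivity) (by linarith)
    have h5 : 2 * d * (ρ * ζ i) ≤ 3 / 4 * ρ := by
      calc 2 * d * (ρ * ζ i) ≤ 2 * d * (ρ * (3 / (8 * d))) := by gcongr
        _ = _ := by field_simp; norm_num
    have h6 : ρ * ζ i ≤ 3 / 8 * ρ := by nlinarith
    refine ⟨?_, ?_, ?_⟩
    · have : (1 : ℝ) ≤ cap M u i := by linarith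
      exact_mod_cast this
    · have : 2 * d * (cap M u i : ℝ) < ρ := by nlinarith
      exact_mod_cast this
    · have : (cap M u i : ℝ) + 3 ≤ ρ := by linarith
      exact_mod_cast this
  refine ⟨hb P1 r1 hP1 hr1, hb P2 r2 hP2 hr2, fun u hu u' hu' v hv v' hv' => ?_⟩
  obtain ⟨ζ, hζ, h⟩ := cap_fat M N ρ hM0 hρ0 hM P1 r1 hr1 u hu
  obtain ⟨ζ', hζ', h'⟩ := cap_fat M N ρ hM0 hρ0 hM P1 r1 hr1 u' hu'
  obtain ⟨η, hη, k⟩ := cap_fat M N ρ hM0 hρ0 hM P2 r2 hr2 v hv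
  obtain ⟨η', hη', k'⟩ := cap_fat M N ρ hM0 hρ0 hM P2 r2 hr2 v' hv'
  have hle1 : 3 / (8 * (d : ℝ)) ≤ 1 := by rw [div_le_one (by positivity)]; linarith
  have h01 : (0 : ℝ) ≤ 1 / (8 * d) := by positivity
  have key : ∀ i, (ρ : ℝ) ^ 2 * ((ζ i - η i) * (ζ' i - η' i)) - 40 * ρ ≤ ((cap M u i : ℝ) - cap M v i) * (cap M u' i - cap M v' i) := by
    intro i
    have a1 := hP1 ζ hζ i
    have a2 := hP1 ζ' hζ' i
    have a3 := hP2 η hη i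
    have a4 := hP2 η' hη' i
    have b1 := abs_le.1 (h i)
    have b2 := abs_le.1 (h' i)
    have b3 := abs_le.1 (k i)
    have b4 := abs_le.1 (k' i)
    set x := ζ i - η i with hx
    set y := ζ' i - η' i with hy
    set e := (cap M u i : ℝ) - cap M v i - ρ * x with he
    set e' := (cap M u' i : ℝ) - cap M v' i - ρ * y with he'
    have e1 : |e| ≤ 10 := by rw [he, hx, abs_le]; constructor <;> linarith
    have e2 : |e'| ≤ 10 := by rw [he', hy, abs_le]; constructor <;> linarith
    have x1 : |x| ≤ 1 := by rw [hx, abs_le]; constructor <;> linarith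
    have y1 : |y| ≤ 1 := by rw [hy, abs_le]; constructor <;> linarith
    have p1 : |x * e'| ≤ 10 := by rw [abs_mul]; nlinarith [abs_nonneg x, abs_nonneg e']
    have p2 : |y * e| ≤ 10 := by rw [abs_mul]; nlinarith [abs_nonneg y, abs_nonneg e]
    have p3 : |e * e'| ≤ 100 := by rw [abs_mul]; nlinarith [abs_nonneg e, abs_nonneg e']
    have q1 := (abs_le.1 p1).1
    have q2 := (abs_le.1 p2).1
    have q3 := (abs_le.1 p3).1
    have : ((cap M u i : ℝ) - cap M v i) * (cap M u' i - cap M v' i) = ρ ^ 2 * (x * y) + ρ * (x * e') + ρ * (y * e) + e * e' := by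
      rw [he, he']; ring
    rw [this]
    have hρ5 : (64 : ℝ) ≤ ρ := by linarith
    have w1 : 0 ≤ ρ * (x * e' + 10) := mul_nonneg (by linarith) (by linarith)
    have w2 : 0 ≤ ρ * (y * e + 10) := mul_nonneg (by linarith) (by linarith)
    linarith
  have hs := Finset.sum_le_sum fun i (_ : i ∈ Finset.univ) => key i
  rw [Finset.sum_sub_distrib, ← Finset.mul_sum, Finset.sum_const, Finset.card_univ, Fintype.card_fin, nsmul_eq_mul] at hs
  have ht := hT ζ hζ ζ' hζ' η hη η' hη'
  have hρr0 : (0 : ℝ) < ρ := by linarith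
  have hfin : (ρ : ℝ) ^ 2 ≤ c * ∑ i, ((cap M u i : ℝ) - cap M v i) * (cap M u' i - cap M v' i) := by
    have g1 : (ρ : ℝ) ^ 2 * c0 / 2 ≤ ∑ i, ((cap M u i : ℝ) - cap M v i) * (cap M u' i - cap M v' i) := by
      have := mul_le_mul_of_nonneg_left ht (sq_nonneg (ρ : ℝ))
      have := mul_le_mul_of_nonneg_left hρ2 hρr0.le
      nlinarith
    calc (ρ : ℝ) ^ 2 = ρ ^ 2 * 2 / 2 := by ring
      _ ≤ ρ ^ 2 * (c * c0) / 2 := by gcongr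
      _ = c * (ρ ^ 2 * c0 / 2) := by ring
      _ ≤ _ := by gcongr
  exact_mod_cast hfin

lemma fat_sub (M N ρ : ℕ) (hM0 : 0 < M) (hρ : 0 < ρ) (hM : N = M * ρ) (P : Set (Fin d → ℝ)) (r r' : ℝ) (hr : r + 2 / ρ ≤ r') :
    ∀ u ∈ box d N, (∃ u' ∈ Fat N P r, ∀ i, |u i - u' i| < 2 * (M : ℤ)) → u ∈ Fat N P r' := by
  rintro u hu ⟨u', hu', h⟩
  obtain ⟨ζ, hζ, h2⟩ := (mem_Fat.1 hu').2
  refine mem_Fat.2 ⟨hu, ζ, hζ, fun i => ?_⟩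
  have hρ' : (0 : ℝ) < ρ := by exact_mod_cast hρ
  have hM' : (0 : ℝ) < M := by exact_mod_cast hM0
  have h3 : |(u i : ℝ) / N - u' i / N| ≤ 2 / ρ := by
    have : |(u i : ℝ) - u' i| ≤ 2 * M := by exact_mod_cast (h i).le
    rw [← sub_div, abs_div, hM]; push_cast
    rw [abs_of_pos (by positivity : (0 : ℝ) < M * ρ), div_le_div_iff₀ (by positivity) (by positivity)]
    nlinarith
  have := abs_sub_le ((u i : ℝ) / N) (u' i / N) (ζ i)
  linarith [h2 i]

lemma fat_mono (N : ℕ) (P : Set (Fin d → ℝ)) (r r' : ℝ) (h : r ≤ r') : Fat N P r ⊆ Fat N P r' := by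
  intro u hu
  obtain ⟨h1, ζ, hζ, h2⟩ := mem_Fat.1 hu
  exact mem_Fat.2 ⟨h1, ζ, hζ, fun i => (h2 i).trans h⟩

lemma Est_mono {p : ℝ} {N ρ : ℕ} {S1 S2 S1' S2' : Finset (Fin d → ℤ)} {A A' : ℝ} (h1 : S1 ⊆ S1') (h2 : S2 ⊆ S2') (hA : A ≤ A')
    (h : Est p N ρ S1' S2' A) : Est p N ρ S1 S2 A' := fun f g hf hg =>
  (h f g (fun u hu h => h1 (hf u hu h)) (fun u hu h => h2 (hg u hu h))).trans (mul_le_mul_of_nonneg_right hA (by positivity))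

lemma Est_base {p : ℝ} (hp : 1 ≤ p) (N ρ : ℕ) (hN : 0 < N) (S1 S2 : Finset (Fin d → ℤ)) : Est p N ρ S1 S2 ((ρ : ℝ) ^ 2) := by
  intro f g _ _
  refine (Nrm_le_l1 hp _).trans ((l1 N hN f g _).trans (le_of_eq ?_))
  rw [Int.card_Ico, sub_zero, Int.toNat_natCast]; push_cast; rfl

theorem iter (hd : 1 ≤ d) {p : ℝ} (hp : p = (d + 3) / (d + 1)) (c0 ε : ℝ) (hc0 : 0 < c0) (hε : 0 < ε) :
    ∃ k : ℕ, 2 ≤ k ∧ ∃ C : ℝ, 0 < C ∧ ∀ (J : ℕ) (P1 P2 : Set (Fin d → ℝ)), PB P1 → PB P2 → PT c0 P1 P2 →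
      Est p (16 * (k ^ J) ^ 2) (k ^ J) (Fat (16 * (k ^ J) ^ 2) P1 (2 / (k ^ J : ℕ))) (Fat (16 * (k ^ J) ^ 2) P2 (2 / (k ^ J : ℕ))) (C * ((k ^ J : ℕ) : ℝ) ^ ε) := by
  have hd' : (1 : ℝ) ≤ d := by exact_mod_cast hd
  have hp1 : 1 ≤ p := by rw [hp, le_div_iff₀ (by positivity)]; linarith
  have ev : ∀ᶠ k : ℕ in Filter.atTop, 2 * (9 * 3 ^ d) ≤ (k : ℝ) ^ ε := by
    have := (tendsto_rpow_atTop hε).comp (tendsto_natCast_atTop_atTop (R := ℝ))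
    exact this.eventually_ge_atTop _
  obtain ⟨k, ⟨hk1, hk2⟩, hk3⟩ := ((ev.and (Filter.eventually_ge_atTop (64 * d))).and (Filter.eventually_ge_atTop ⌈80 * d / c0⌉₊)).exists
  obtain ⟨c, hc⟩ := exists_nat_ge (2 / c0)
  have hc' : 2 ≤ c * c0 := by rwa [div_le_iff₀ hc0] at hc
  have hk3' : 80 * d ≤ k * c0 := by
    have := Nat.ceil_le.1 hk3
    rwa [div_le_iff₀ hc0] at this
  set C0 : ℝ := 9 * 3 ^ d with hC0
  have h3 : (1 : ℝ) ≤ 3 ^ d := one_le_pow₀ (by norm_num)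
  have hC01 : 1 ≤ C0 := by rw [hC0]; linarith
  set Ck : ℝ := 2 * (k ^ 2 : ℕ) ^ 2 * ((CD d c (k ^ 2) + 1) * C0) with hCk
  have hCk0 : 0 ≤ Ck := by have := CD_nonneg d c (k ^ 2); positivity
  set B : ℝ := Ck + k ^ 2 with hB
  have hk0 : 0 < k := by omega
  have hkr : (1 : ℝ) ≤ k := by exact_mod_cast hk0
  have hB0 : 1 ≤ B := by have : (1 : ℝ) ≤ k ^ 2 := one_le_pow₀ hkr
                         linarith
  refine ⟨k, by omega, B, by linarith, fun J P1 P2 hP1 hP2 hT => ?_⟩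
  set N := 16 * (k ^ J) ^ 2 with hN
  have hN0 : 0 < N := by positivity
  have main : ∀ j ≤ J, Est p N (k ^ j) (Fat N P1 (2 / (k ^ j : ℕ))) (Fat N P2 (2 / (k ^ j : ℕ))) (B * (2 * C0) ^ j) := by
    intro j
    induction j with
    | zero =>
      intro _
      refine Est_mono (fun _ h => h) (fun _ h => h) ?_ (Est_base hp1 N (k ^ 0) hN0 _ _)
      simpa using hB0
    | succ j ih =>
      intro hj
      rcases Nat.eq_zero_or_pos j with rfl | hj0
      · refine Est_mono (fun _ h => h) (fun _ h => h) ?_ (Est_base hp1 N (k ^ (0 + 1)) hN0 _ _)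
        simp only [zero_add, pow_one]
        have : (k : ℝ) ^ 2 ≤ B := by linarith
        nlinarith
      obtain ⟨j', rfl⟩ : ∃ j', j = j' + 1 := ⟨j - 1, by omega⟩
      obtain ⟨m, rfl⟩ : ∃ m, J = j' + 1 + 1 + m := ⟨J - (j' + 1 + 1), by omega⟩
      set ρ := k ^ (j' + 1 + 1) with hρ
      have hkρ : k ≤ ρ := by rw [hρ]; exact Nat.le_self_pow (by omega) k
      have hρ0 : 0 < ρ := by positivity
      set M := 16 * k ^ (j' + 1 + 1 + 2 * m) with hM
      have hM0 : 0 < M := by positivity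
      have hMN : N = M * ρ := by rw [hN, hM, hρ]; ring
      have hkr2 : (k : ℝ) ≤ ρ := by exact_mod_cast hkρ
      have hρr : (0 : ℝ) < ρ := by exact_mod_cast hρ0
      have hr : 2 / (ρ : ℝ) + 2 / ρ ≤ 2 / (k ^ (j' + 1) : ℕ) := by
        have : (2 : ℝ) / (k ^ (j' + 1) : ℕ) = 2 * k / ρ := by rw [hρ, pow_succ k (j' + 1)]; push_cast; rw [mul_div_mul_right _ _ (by positivity)]
        rw [this, ← add_div]
        have : (2 : ℝ) ≤ k := by exact_mod_cast (by omega : 2 ≤ k)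
        gcongr; linarith
      have hpos : 0 ≤ 2 / (ρ : ℝ) := by positivity
      have hS : Fat N P1 (2 / ρ) ⊆ Fat N P1 (4 / ρ) := fat_mono N P1 _ _ (by gcongr; norm_num)
      have hG := good_of hd M N ρ c hM0 hMN P1 P2 c0 hP1 hP2 hT (4 / ρ) (2 / ρ) le_rfl (by gcongr; norm_num) (hk2.trans hkρ)
        (hk3'.trans (by gcongr)) hc'
      have h4 : 4 / (ρ : ℝ) = 2 / ρ + 2 / ρ := by ring
      have st := step hd hp M N ρ c (k ^ 2) (k ^ j') (k ^ (j' + 1)) (by omega) (by rw [hρ]; ring) (by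
          rw [hN, hρ]; gcongr) hMN (by rw [hρ]; ring) (Fat N P1 (2 / ρ)) (Fat N P2 (2 / ρ)) (Fat N P1 (4 / ρ)) (Fat N P2 (4 / ρ)) hS hG
          (fat_sub M N ρ hM0 hρ0 hMN P1 _ _ h4.ge) (fat_sub M N ρ hM0 hρ0 hMN P2 _ _ h4.ge) (B * (2 * C0) ^ (j' + 1)) (by positivity)
          (Est_mono (fat_mono N P1 _ _ (by rw [h4]; exact hr)) (fat_mono N P2 _ _ (by rw [h4]; exact hr)) le_rfl (ih (by omega)))
      refine Est_mono (fun _ h => h) (fun _ h => h) ?_ st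
      have hpw : (1 : ℝ) ≤ (2 * C0) ^ (j' + 1) := one_le_pow₀ (by linarith)
      have : Ck ≤ B * (C0 * (2 * C0) ^ (j' + 1)) := by
        have : Ck ≤ B := by rw [hB]; nlinarith
        have : 1 ≤ C0 * (2 * C0) ^ (j' + 1) := by nlinarith
        nlinarith
      rw [pow_succ _ (j' + 1)]
      linarith
  refine Est_mono (fun _ h => h) (fun _ h => h) ?_ (main J le_rfl)
  refine mul_le_mul_of_nonneg_left ?_ (by linarith)
  push_cast
  rw [← Real.rpow_natCast (k : ℝ) J, ← Real.rpow_mul (by positivity), mul_comm (J : ℝ), Real.rpow_mul (by positivity), Real.rpow_natCast]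
  exact pow_le_pow_left₀ (by positivity) hk1 J

end
end BR

namespace BR

section
variable {d : ℕ} {β : Type*}

def Psi (Q : Finset β) (Z : β → Fin d → ℝ) (α : β → ℂ) (z : (Fin d → ℤ) × ℤ) : ℂ :=
  ∑ q ∈ Q, α q * ee (∑ i, (z.1 i : ℝ) * Z q i + z.2 * ∑ i, Z q i ^ 2)

def fl (N : ℕ) (ζ : Fin d → ℝ) : Fin d → ℤ := fun i => ⌊N * ζ i⌋

def Gsum (N : ℕ) (Q : Finset β) (Z : β → Fin d → ℝ) (α : β → ℂ) (z : (Fin d → ℤ) × ℤ) : ℂ :=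
  ∑ q ∈ Q, α q * ee (lin N z.1 (fl N (Z q)) + z.2 * quad N (fl N (Z q)))

open Classical in
def gr (N : ℕ) (Q : Finset β) (Z : β → Fin d → ℝ) (α : β → ℂ) : (Fin d → ℤ) → ℂ :=
  fun u => ∑ q ∈ Q, if fl N (Z q) = u then α q else 0

lemma gr_Phi (N : ℕ) (Q : Finset β) (Z : β → Fin d → ℝ) (α : β → ℂ) (hQ : ∀ q ∈ Q, fl N (Z q) ∈ box d N) (z : (Fin d → ℤ) × ℤ) :
    Phi N (gr N Q Z α) z.1 z.2 = Gsum N Q Z α z := by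
  classical
  unfold Phi gr Gsum
  simp only [Finset.sum_mul, ite_mul, zero_mul]
  rw [Finset.sum_comm]
  refine Finset.sum_congr rfl fun q hq => ?_
  rw [Finset.sum_ite_eq, if_pos (hQ q hq)]

lemma gr_En (N : ℕ) (Q : Finset β) (Z : β → Fin d → ℝ) (α : β → ℂ)
    (hi : ∀ q ∈ Q, ∀ q' ∈ Q, fl N (Z q) = fl N (Z q') → q = q') : En N (gr N Q Z α) ≤ (N : ℝ) ^ d * ∑ q ∈ Q, ‖α q‖ ^ 2 := by
  classical
  unfold En
  refine mul_le_mul_of_nonneg_left ?_ (by positivity)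
  calc _ ≤ ∑ u ∈ box d N, ∑ q ∈ Q, if fl N (Z q) = u then ‖α q‖ ^ 2 else 0 := by
        refine Finset.sum_le_sum fun u _ => ?_
        unfold gr
        rw [← Finset.sum_filter, ← Finset.sum_filter]
        have hc : (Q.filter fun q => fl N (Z q) = u).card ≤ 1 := by
          rw [Finset.card_le_one]
          intro a ha b hb
          simp only [Finset.mem_filter] at ha hb
          exact hi a ha.1 b hb.1 (ha.2.trans hb.2.symm)
        refine (pow_le_pow_left₀ (norm_nonneg _) (norm_sum_le _ _) 2).trans (sq_sum_le_card_mul_sum_sq.trans ?_)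
        refine (mul_le_mul_of_nonneg_right (by exact_mod_cast hc) (by positivity)).trans (one_mul _).le
    _ = ∑ q ∈ Q, ∑ u ∈ box d N, if fl N (Z q) = u then ‖α q‖ ^ 2 else 0 := Finset.sum_comm
    _ ≤ _ := by
        refine Finset.sum_le_sum fun q _ => ?_
        rw [Finset.sum_ite_eq]; split_ifs
        · exact le_rfl
        · positivity

/-- grid rounding coordinates -/
def XX (N : ℕ) (z : (Fin d → ℤ) × ℤ) : Fin d ⊕ Fin d → ℝ := Sum.elim (fun i => 2 * π * z.1 i / N) (fun _ => 4 * π * z.2 / N)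
def UU (N : ℕ) (Z : β → Fin d → ℝ) (q : β) : Fin d ⊕ Fin d → ℝ :=
  Sum.elim (fun i => N * Z q i - fl N (Z q) i) (fun i => (N * Z q i ^ 2 - (fl N (Z q) i : ℝ) ^ 2 / N) / 2)

lemma UU_bd (N : ℕ) (hN : 0 < N) (Z : β → Fin d → ℝ) (q : β) (hZ : ∀ i, 0 ≤ Z q i ∧ Z q i ≤ 1) (j) : |UU N Z q j| ≤ 1 := by
  have hN' : (0 : ℝ) < N := by exact_mod_cast hN
  have hf : ∀ i, (fl N (Z q) i : ℝ) ≤ N * Z q i ∧ N * Z q i < fl N (Z q) i + 1 ∧ (0 : ℝ) ≤ fl N (Z q) i := fun i =>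
    ⟨Int.floor_le _, Int.lt_floor_add_one _, by exact_mod_cast Int.floor_nonneg.2 (mul_nonneg hN'.le (hZ i).1)⟩
  rcases j with i | i
  · simp only [UU, Sum.elim_inl]
    obtain ⟨h1, h2, h3⟩ := hf i
    rw [abs_le]; constructor <;> linarith
  · simp only [UU, Sum.elim_inr]
    obtain ⟨h1, h2, h3⟩ := hf i
    have e : (N * Z q i ^ 2 - (fl N (Z q) i : ℝ) ^ 2 / N) / 2 = (N * Z q i - fl N (Z q) i) * ((N * Z q i + fl N (Z q) i) / (2 * N)) := by field_simp; ring
    have g1 : (N * Z q i + fl N (Z q) i) / (2 * N) ≤ 1 := by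
      rw [div_le_one (by positivity)]
      have := mul_le_mul_of_nonneg_left (hZ i).2 hN'.le
      linarith
    have g0 : 0 ≤ (N * Z q i + fl N (Z q) i) / (2 * N) := div_nonneg (by linarith) (by positivity)
    rw [e, abs_mul, abs_of_nonneg g0, abs_of_nonneg (by linarith)]
    nlinarith

lemma ee_XU (N : ℕ) (hN : 0 < N) (Z : β → Fin d → ℝ) (q : β) (z : (Fin d → ℤ) × ℤ) :
    ee (∑ i, (z.1 i : ℝ) * Z q i + z.2 * ∑ i, Z q i ^ 2) = ee (lin N z.1 (fl N (Z q)) + z.2 * quad N (fl N (Z q)))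
      * Complex.exp (Complex.I * ((∑ j, XX N z j * UU N Z q j : ℝ) : ℂ)) := by
  have hN' : (N : ℝ) ≠ 0 := by exact_mod_cast hN.ne'
  have : Complex.exp (Complex.I * ((∑ j, XX N z j * UU N Z q j : ℝ) : ℂ)) = ee ((∑ j, XX N z j * UU N Z q j) / (2 * π)) := by
    unfold ee; congr 1; push_cast
    have : (π : ℂ) ≠ 0 := by exact_mod_cast Real.pi_ne_zero
    field_simp
  rw [this, ← ee_add]
  congr 1
  rw [Fintype.sum_sum_type]
  simp only [XX, UU, Sum.elim_inl, Sum.elim_inr]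
  unfold lin quad
  rw [← Finset.sum_add_distrib, Finset.sum_div, Finset.mul_sum, Finset.mul_sum, ← Finset.sum_add_distrib, ← Finset.sum_add_distrib, ← Finset.sum_add_distrib]
  refine Finset.sum_congr rfl fun i _ => ?_
  field_simp
  ring

/-- one factor may be rounded -/
lemma round {p : ℝ} (hp : 1 ≤ p) (N ρ : ℕ) (hN : N = 16 * ρ ^ 2) (hρ : 0 < ρ) (Q : Finset β) (Z : β → Fin d → ℝ) (hZ : ∀ q ∈ Q, ∀ i, 0 ≤ Z q i ∧ Z q i ≤ 1)
    (α : β → ℂ) (g : (Fin d → ℤ) × ℤ → ℂ) (B : ℝ) (hB : 0 ≤ B)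
    (h : ∀ α' : β → ℂ, (∀ q ∈ Q, ‖α' q‖ ≤ ‖α q‖) → Nrm p (box d (ρ ^ 2) ×ˢ Finset.Ico (0 : ℤ) (ρ ^ 2 : ℕ)) (fun z => Gsum N Q Z α' z * g z) ≤ B) :
    Nrm p (box d (ρ ^ 2) ×ˢ Finset.Ico (0 : ℤ) (ρ ^ 2 : ℕ)) (fun z => Psi Q Z α z * g z) ≤ Real.exp (2 * d) * B := by
  have hN0 : 0 < N := by rw [hN]; positivity
  have hNr : (N : ℝ) = 16 * (ρ : ℝ) ^ 2 := by rw [hN]; push_cast; ring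
  have hρr : (0 : ℝ) < ρ := by exact_mod_cast hρ
  have ht := taylor (Z := box d (ρ ^ 2) ×ˢ Finset.Ico (0 : ℤ) (ρ ^ 2 : ℕ)) hp Q (fun z q => α q * ee (lin N z.1 (fl N (Z q)) + z.2 * quad N (fl N (Z q))) * g z) (XX N) (UU N Z) 1 B zero_le_one hB ?_ ?_
  · have e : (1 : ℝ) * Fintype.card (Fin d ⊕ Fin d) = 2 * d := by simp; ring
    rw [e] at ht
    refine le_trans (le_of_eq (Nrm_congr fun z _ => ?_)) ht
    congr 1
    unfold Psi
    rw [Finset.sum_mul]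
    refine Finset.sum_congr rfl fun q _ => ?_
    rw [ee_XU N hN0]; ring
  · intro z hz j
    obtain ⟨h1, h2⟩ := Finset.mem_product.1 hz
    have key : ∀ n : ℤ, 0 ≤ n → n < (ρ ^ 2 : ℕ) → |4 * π * n / N| ≤ 1 := by
      intro n hn0 hn
      have a0 : (0 : ℝ) ≤ n := by exact_mod_cast hn0
      have a1 : (n : ℝ) < ρ ^ 2 := by exact_mod_cast hn
      rw [abs_of_nonneg (by positivity), hNr, div_le_one (by positivity)]
      nlinarith [Real.pi_le_four, Real.pi_pos]
    rcases j with i | i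
    · have := key (z.1 i) (mem_box.1 h1 i).1 (mem_box.1 h1 i).2
      simp only [XX, Sum.elim_inl]
      have e : 4 * π * (z.1 i : ℝ) / N = 2 * (2 * π * z.1 i / N) := by ring
      rw [e, abs_mul, abs_two] at this
      linarith [abs_nonneg (2 * π * (z.1 i : ℝ) / N)]
    · exact key z.2 (Finset.mem_Ico.1 h2).1 (Finset.mem_Ico.1 h2).2
  · intro m w
    refine le_trans (le_of_eq (Nrm_congr fun z _ => ?_)) (h (fun q => α q * ((∏ l, UU N Z q (w l) : ℝ) : ℂ)) ?_)
    · congr 1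
      unfold Gsum
      rw [Finset.sum_mul]
      exact Finset.sum_congr rfl fun q _ => by ring
    · intro q hq
      rw [norm_mul, Complex.norm_real, Real.norm_eq_abs, Finset.abs_prod]
      refine mul_le_of_le_one_right (norm_nonneg _) (Finset.prod_le_one (fun _ _ => abs_nonneg _) fun l _ => UU_bd N hN0 Z q (hZ q hq) _)

lemma disc {p : ℝ} (hp : 1 ≤ p) (N ρ : ℕ) (hN : N = 16 * ρ ^ 2) (hρ : 0 < ρ) (Q1 Q2 : Finset β) (Z : β → Fin d → ℝ)
    (h1 : ∀ q ∈ Q1, ∀ i, 0 ≤ Z q i ∧ Z q i < 1) (h2 : ∀ q ∈ Q2, ∀ i, 0 ≤ Z q i ∧ Z q i < 1)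
    (i1 : ∀ q ∈ Q1, ∀ q' ∈ Q1, fl N (Z q) = fl N (Z q') → q = q') (i2 : ∀ q ∈ Q2, ∀ q' ∈ Q2, fl N (Z q) = fl N (Z q') → q = q')
    (A : ℝ) (hA : 0 ≤ A) (hE : Est p N ρ (Fat N (Z '' Q1) (2 / ρ)) (Fat N (Z '' Q2) (2 / ρ)) A) (α α2 : β → ℂ) :
    Nrm p (box d (ρ ^ 2) ×ˢ Finset.Ico (0 : ℤ) (ρ ^ 2 : ℕ)) (fun z => Psi Q1 Z α z * Psi Q2 Z α2 z)
      ≤ Real.exp (2 * d) * (Real.exp (2 * d) * (A * ((N : ℝ) ^ d * (√(∑ q ∈ Q1, ‖α q‖ ^ 2) * √(∑ q ∈ Q2, ‖α2 q‖ ^ 2))))) := by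
  have hN0 : 0 < N := by rw [hN]; positivity
  have hN' : (0 : ℝ) < N := by exact_mod_cast hN0
  have hρr : (1 : ℝ) ≤ ρ := by exact_mod_cast hρ
  have hNr : (N : ℝ) = 16 * (ρ : ℝ) ^ 2 := by rw [hN]; push_cast; ring
  have hbox : ∀ Q : Finset β, (∀ q ∈ Q, ∀ i, 0 ≤ Z q i ∧ Z q i < 1) → ∀ q ∈ Q, fl N (Z q) ∈ box d N := by
    intro Q hQ q hq
    rw [mem_box]
    intro i
    refine ⟨Int.floor_nonneg.2 (mul_nonneg hN'.le (hQ q hq i).1), ?_⟩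
    unfold fl; rw [Int.floor_lt]; push_cast
    have := mul_lt_mul_of_pos_left (hQ q hq i).2 hN'
    linarith
  have hfat : ∀ (Q : Finset β) (α : β → ℂ), ∀ u ∈ box d N, gr N Q Z α u ≠ 0 → u ∈ Fat N (Z '' Q) (2 / ρ) := by
    classical
    intro Q α u hu hne
    obtain ⟨q, hq, hq'⟩ := Finset.exists_ne_zero_of_sum_ne_zero hne
    have hu' : fl N (Z q) = u := by by_contra hcon; simp [hcon] at hq'
    refine mem_Fat.2 ⟨hu, Z q, ⟨q, hq, rfl⟩, fun i => ?_⟩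
    rw [← hu']
    have f1 : ((fl N (Z q) i : ℤ) : ℝ) ≤ N * Z q i := Int.floor_le _
    have f2 : N * Z q i < (fl N (Z q) i : ℤ) + 1 := Int.lt_floor_add_one _
    have : (fl N (Z q) i : ℝ) / N - Z q i = (fl N (Z q) i - N * Z q i) / N := by field_simp
    rw [this, abs_div, abs_of_pos hN', div_le_div_iff₀ hN' (by linarith)]
    have : |(fl N (Z q) i : ℝ) - N * Z q i| ≤ 1 := by rw [abs_le]; constructor <;> linarith
    have : |(fl N (Z q) i : ℝ) - N * Z q i| * ρ ≤ 1 * ρ := mul_le_mul_of_nonneg_right this (by linarith)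
    nlinarith
  have hsub : box d (ρ ^ 2) ⊆ box d N := by
    intro u hu; rw [mem_box] at hu ⊢; intro i
    refine ⟨(hu i).1, (hu i).2.trans_le ?_⟩
    rw [hN]; push_cast; nlinarith [sq_nonneg (ρ : ℤ)]
  refine round hp N ρ hN hρ Q1 Z (fun q hq i => ⟨(h1 q hq i).1, (h1 q hq i).2.le⟩) α _ _ (by positivity) fun α' hα' => ?_
  simp only [mul_comm (Gsum N Q1 Z α' _)]
  refine round hp N ρ hN hρ Q2 Z (fun q hq i => ⟨(h2 q hq i).1, (h2 q hq i).2.le⟩) α2 _ _ (by positivity) fun α2' hα2' => ?_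
  have e := hE (gr N Q1 Z α') (gr N Q2 Z α2') (hfat Q1 α') (hfat Q2 α2')
  refine le_trans ?_ (e.trans ?_)
  · unfold Nrm
    have : 0 ≤ 1 / p := by positivity
    refine Real.rpow_le_rpow (by positivity) ?_ this
    refine le_trans (le_of_eq ?_) (Finset.sum_le_sum_of_subset_of_nonneg (Finset.product_subset_product_left hsub) fun z _ _ => by positivity)
    refine Finset.sum_congr rfl fun z _ => ?_
    beta_reduce
    rw [gr_Phi N Q1 Z α' (hbox Q1 h1), gr_Phi N Q2 Z α2' (hbox Q2 h2), mul_comm]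
  · refine mul_le_mul_of_nonneg_left ?_ hA
    have b1 : En N (gr N Q1 Z α') ≤ (N : ℝ) ^ d * ∑ q ∈ Q1, ‖α q‖ ^ 2 := (gr_En N Q1 Z α' i1).trans (by gcongr with q hq; exact hα' q hq)
    have b2 : En N (gr N Q2 Z α2') ≤ (N : ℝ) ^ d * ∑ q ∈ Q2, ‖α2 q‖ ^ 2 := (gr_En N Q2 Z α2' i2).trans (by gcongr with q hq; exact hα2' q hq)
    refine (mul_le_mul (Real.sqrt_le_sqrt b1) (Real.sqrt_le_sqrt b2) (by positivity) (by positivity)).trans (le_of_eq ?_)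
    have hpos : (0 : ℝ) ≤ (N : ℝ) ^ d := by positivity
    rw [Real.sqrt_mul hpos, Real.sqrt_mul hpos]
    have := Real.mul_self_sqrt hpos
    linear_combination (√(∑ q ∈ Q1, ‖α q‖ ^ 2) * √(∑ q ∈ Q2, ‖α2 q‖ ^ 2)) * this

end
end BR

namespace BR

section
variable {d : ℕ} {β : Type*}

lemma fl_inj (hd : 1 ≤ d) (N : ℕ) (hN : 0 < N) (Q : Finset β) (Z : β → Fin d → ℝ) (h : ∀ q ∈ Q, ∀ q' ∈ Q, q ≠ q' → 1 / (N : ℝ) ≤ dist (Z q) (Z q')) :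
    ∀ q ∈ Q, ∀ q' ∈ Q, fl N (Z q) = fl N (Z q') → q = q' := by
  intro q hq q' hq' he
  by_contra hne
  have h1 := h q hq q' hq' hne
  have hN' : (0 : ℝ) < N := by exact_mod_cast hN
  have : dist (Z q) (Z q') < 1 / N := by
    rw [dist_pi_lt_iff (by positivity)]
    intro i
    have a := Int.floor_le (N * Z q i)
    have a2 := Int.lt_floor_add_one (N * Z q i)
    have b := Int.floor_le (N * Z q' i)
    have b2 := Int.lt_floor_add_one (N * Z q' i)
    have e : ⌊N * Z q i⌋ = ⌊N * Z q' i⌋ := congrFun he i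
    rw [e] at a a2
    rw [Real.dist_eq, lt_div_iff₀ hN', ← abs_of_pos hN', ← abs_mul, abs_lt]
    constructor <;> nlinarith
  linarith

/-- pieces -/
def lab (Z : β → Fin d → ℝ) (q : β) : Fin d → ℤ := fl (40 * d ^ 2) (Z q)

open Classical in
def pc (Q : Finset β) (Z : β → Fin d → ℝ) (l : Fin d → ℤ) : Finset β := Q.filter fun q => lab Z q = l

lemma mem_pc {Q : Finset β} {Z : β → Fin d → ℝ} {l : Fin d → ℤ} {q : β} : q ∈ pc Q Z l ↔ q ∈ Q ∧ lab Z q = l := by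
  unfold pc; simp only [Finset.mem_filter]

lemma lab_mem (hd : 1 ≤ d) (Q : Finset β) (Z : β → Fin d → ℝ) (hP : PB (Z '' Q)) (q : β) (hq : q ∈ Q) : lab Z q ∈ box d (40 * d ^ 2) := by
  have hd' : (1 : ℝ) ≤ d := by exact_mod_cast hd
  rw [mem_box]
  intro i
  obtain ⟨h1, h2⟩ := hP (Z q) ⟨q, hq, rfl⟩ i
  have h0 : (0 : ℝ) ≤ 1 / (8 * d) := by positivity
  refine ⟨Int.floor_nonneg.2 (mul_nonneg (by positivity) (by linarith)), ?_⟩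
  unfold lab fl
  rw [Int.floor_lt]
  push_cast
  have : 3 / (8 * (d : ℝ)) < 1 := by rw [div_lt_one (by positivity)]; linarith
  have : Z q i < 1 := by linarith
  have hh : (0 : ℝ) < 40 * d ^ 2 := by positivity
  nlinarith

lemma Psi_pc (hd : 1 ≤ d) (Q : Finset β) (Z : β → Fin d → ℝ) (hP : PB (Z '' Q)) (α : β → ℂ) (z : (Fin d → ℤ) × ℤ) :
    Psi Q Z α z = ∑ l ∈ box d (40 * d ^ 2), Psi (pc Q Z l) Z α z := by
  classical
  unfold Psi pc
  rw [← Finset.sum_fiberwise_of_maps_to (lab_mem hd Q Z hP)]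

lemma pc_PT (hd : 1 ≤ d) (Q1 Q2 : Finset β) (Z : β → Fin d → ℝ) (i0 : Fin d)
    (hs : ∀ q ∈ Q1, ∀ q' ∈ Q1, ∀ r ∈ Q2, ∀ r' ∈ Q2, (1 / (20 * d : ℝ)) ^ 2 ≤ (Z q i0 - Z r i0) * (Z q' i0 - Z r' i0)) (l l' : Fin d → ℤ) :
    PT (1 / (800 * d ^ 2)) (Z '' (pc Q1 Z l : Set β)) (Z '' (pc Q2 Z l' : Set β)) := by
  have hd' : (1 : ℝ) ≤ d := by exact_mod_cast hd
  rintro _ ⟨q, hq, rfl⟩ _ ⟨q', hq', rfl⟩ _ ⟨r, hr, rfl⟩ _ ⟨r', hr', rfl⟩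
  simp only [Finset.mem_coe, mem_pc] at hq hq' hr hr'
  have cl : ∀ a b : β, lab Z a = lab Z b → ∀ i, |Z a i - Z b i| ≤ 1 / (40 * d ^ 2) := by
    intro a b hab i
    have e : ⌊((40 * d ^ 2 : ℕ) : ℝ) * Z a i⌋ = ⌊((40 * d ^ 2 : ℕ) : ℝ) * Z b i⌋ := congrFun hab i
    have a1 := Int.floor_le (((40 * d ^ 2 : ℕ) : ℝ) * Z a i)
    have a2 := Int.lt_floor_add_one (((40 * d ^ 2 : ℕ) : ℝ) * Z a i)
    have b1 := Int.floor_le (((40 * d ^ 2 : ℕ) : ℝ) * Z b i)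
    have b2 := Int.lt_floor_add_one (((40 * d ^ 2 : ℕ) : ℝ) * Z b i)
    rw [e] at a1 a2
    push_cast at a1 a2 b1 b2
    have hh : (0 : ℝ) < 40 * d ^ 2 := by positivity
    rw [le_div_iff₀ hh, ← abs_of_pos hh, ← abs_mul, abs_le]
    constructor <;> nlinarith
  set s : ℝ := 1 / (40 * d ^ 2) with hsd
  have k1 := cl q q' (hq.2.trans hq'.2.symm)
  have k2 := cl r r' (hr.2.trans hr'.2.symm)
  have ge : ∀ i, -s ^ 2 ≤ (Z q i - Z r i) * (Z q' i - Z r' i) := by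
    intro i
    have h1 := abs_le.1 (k1 i)
    have h2 := abs_le.1 (k2 i)
    have h3 : |(Z q i - Z r i) - (Z q' i - Z r' i)| ≤ 2 * s := by rw [abs_le]; constructor <;> linarith
    have h4 := sq_le_sq' (abs_le.1 h3).1 (abs_le.1 h3).2
    nlinarith [sq_nonneg ((Z q i - Z r i) + (Z q' i - Z r' i))]
  rw [← Finset.add_sum_erase _ _ (Finset.mem_univ i0)]
  have g1 := hs q hq.1 q' hq'.1 r hr.1 r' hr'.1
  have g2 : -(d * s ^ 2) ≤ ∑ i ∈ Finset.univ.erase i0, (Z q i - Z r i) * (Z q' i - Z r' i) := by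
    have := Finset.card_nsmul_le_sum (Finset.univ.erase i0) (fun i => (Z q i - Z r i) * (Z q' i - Z r' i)) (-s ^ 2) (fun i _ => ge i)
    refine le_trans ?_ this
    rw [nsmul_eq_mul]
    have : ((Finset.univ.erase i0).card : ℝ) ≤ d := by
      have := Finset.card_le_univ (Finset.univ.erase i0)
      rw [Fintype.card_fin] at this; exact_mod_cast this
    nlinarith [sq_nonneg s]
  have g3 : d * s ^ 2 ≤ 1 / (1600 * d ^ 2) := by
    rw [hsd, div_pow, one_pow, mul_one_div, div_le_div_iff₀ (by positivity) (by positivity)]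
    have : (d : ℝ) ^ 3 ≤ d ^ 4 := pow_le_pow_right₀ hd' (by norm_num)
    nlinarith
  have g4 : (1 / (20 * d : ℝ)) ^ 2 = 4 / (1600 * d ^ 2) := by field_simp; norm_num
  have g5 : (1 : ℝ) / (800 * d ^ 2) = 2 / (1600 * d ^ 2) := by field_simp; norm_num
  rw [g4] at g1
  rw [g5]
  have : (0 : ℝ) ≤ 1 / (1600 * d ^ 2) := by positivity
  have e4 : (4 : ℝ) / (1600 * d ^ 2) = 4 * (1 / (1600 * d ^ 2)) := by ring
  have e2 : (2 : ℝ) / (1600 * d ^ 2) = 2 * (1 / (1600 * d ^ 2)) := by ring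
  rw [e4] at g1; rw [e2]
  linarith

theorem discrete (hd : 1 ≤ d) {p : ℝ} (hp : p = (d + 3) / (d + 1)) (ε : ℝ) (hε : 0 < ε) :
    ∃ k : ℕ, 2 ≤ k ∧ ∃ C : ℝ, 0 < C ∧ ∀ (J ρ : ℕ), ρ = k ^ J → ∀ (Q1 Q2 : Finset (Fin d → ℝ)) (Z : (Fin d → ℝ) → Fin d → ℝ) (i0 : Fin d), PB (Z '' Q1) → PB (Z '' Q2) →
      (∀ q ∈ Q1, ∀ q' ∈ Q1, ∀ r ∈ Q2, ∀ r' ∈ Q2, (1 / (20 * d : ℝ)) ^ 2 ≤ (Z q i0 - Z r i0) * (Z q' i0 - Z r' i0)) →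
      (∀ q ∈ Q1, ∀ q' ∈ Q1, q ≠ q' → 1 / (ρ : ℝ) ^ 2 ≤ dist (Z q) (Z q')) → (∀ q ∈ Q2, ∀ q' ∈ Q2, q ≠ q' → 1 / (ρ : ℝ) ^ 2 ≤ dist (Z q) (Z q')) →
      ∀ α α2 : (Fin d → ℝ) → ℂ, Nrm p (box d (ρ ^ 2) ×ˢ Finset.Ico (0 : ℤ) (ρ ^ 2 : ℕ)) (fun z => Psi Q1 Z α z * Psi Q2 Z α2 z)
        ≤ C * (ρ : ℝ) ^ ε * ((ρ : ℝ) ^ 2) ^ d * (√(∑ q ∈ Q1, ‖α q‖ ^ 2) * √(∑ q ∈ Q2, ‖α2 q‖ ^ 2)) := by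
  have hd' : (1 : ℝ) ≤ d := by exact_mod_cast hd
  have hp1 : 1 ≤ p := by rw [hp, le_div_iff₀ (by positivity)]; linarith
  obtain ⟨k, hk, C, hC, H⟩ := iter hd hp (1 / (800 * d ^ 2)) ε (by positivity) hε
  set L := box d (40 * d ^ 2) with hL
  refine ⟨k, hk, ((L.card : ℝ) * L.card + 1) * (Real.exp (2 * d) * Real.exp (2 * d) * C * 16 ^ d), by positivity, ?_⟩
  rintro J ρ hρ Q1 Q2 Z i0 hP1 hP2 hs s1 s2 α α2
  have hρ0 : 0 < ρ := by rw [hρ]; positivity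
  have hρr : (0 : ℝ) < ρ := by exact_mod_cast hρ0
  set N := 16 * ρ ^ 2 with hN
  have hN0 : 0 < N := by positivity
  have hNr : (N : ℝ) = 16 * (ρ : ℝ) ^ 2 := by rw [hN]; push_cast; ring
  have hle : 1 / (N : ℝ) ≤ 1 / (ρ : ℝ) ^ 2 := by
    rw [hNr]; apply one_div_le_one_div_of_le (by positivity); nlinarith [sq_nonneg (ρ : ℝ)]
  have hr01 : ∀ Q : Finset (Fin d → ℝ), PB (Z '' Q) → ∀ q ∈ Q, ∀ i, 0 ≤ Z q i ∧ Z q i < 1 := by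
    intro Q hP q hq i
    obtain ⟨h1, h2⟩ := hP (Z q) ⟨q, hq, rfl⟩ i
    have h0 : (0 : ℝ) ≤ 1 / (8 * d) := by positivity
    have : 3 / (8 * (d : ℝ)) < 1 := by rw [div_lt_one (by positivity)]; linarith
    exact ⟨by linarith, by linarith⟩
  have hsubP : ∀ Q : Finset (Fin d → ℝ), PB (Z '' Q) → ∀ l, PB (Z '' (pc Q Z l : Set (Fin d → ℝ))) := by
    rintro Q hP l _ ⟨q, hq, rfl⟩
    exact hP (Z q) ⟨q, (mem_pc.1 hq).1, rfl⟩
  have hsq : ∀ (Q : Finset (Fin d → ℝ)) (α : (Fin d → ℝ) → ℂ) (l), √(∑ q ∈ pc Q Z l, ‖α q‖ ^ 2) ≤ √(∑ q ∈ Q, ‖α q‖ ^ 2) := fun Q α l =>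
    Real.sqrt_le_sqrt (Finset.sum_le_sum_of_subset_of_nonneg (fun q hq => (mem_pc.1 hq).1) fun _ _ _ => by positivity)
  set E := √(∑ q ∈ Q1, ‖α q‖ ^ 2) * √(∑ q ∈ Q2, ‖α2 q‖ ^ 2) with hE
  set W := Real.exp (2 * d) * (Real.exp (2 * d) * ((C * (ρ : ℝ) ^ ε) * ((N : ℝ) ^ d * E))) with hW
  have hW0 : 0 ≤ W := by positivity
  have piece : ∀ l l', Nrm p (box d (ρ ^ 2) ×ˢ Finset.Ico (0 : ℤ) (ρ ^ 2 : ℕ)) (fun z => Psi (pc Q1 Z l) Z α z * Psi (pc Q2 Z l') Z α2 z) ≤ W := by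
    intro l l'
    have h := H J (Z '' (pc Q1 Z l : Set (Fin d → ℝ))) (Z '' (pc Q2 Z l' : Set (Fin d → ℝ))) (hsubP Q1 hP1 l) (hsubP Q2 hP2 l') (pc_PT hd Q1 Q2 Z i0 hs l l')
    rw [← hρ] at h
    refine (disc hp1 N ρ hN hρ0 (pc Q1 Z l) (pc Q2 Z l') Z (hr01 _ (hsubP Q1 hP1 l)) (hr01 _ (hsubP Q2 hP2 l'))
      (fl_inj hd N hN0 _ Z fun q hq q' hq' hne => hle.trans (s1 q (mem_pc.1 hq).1 q' (mem_pc.1 hq').1 hne))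
      (fl_inj hd N hN0 _ Z fun q hq q' hq' hne => hle.trans (s2 q (mem_pc.1 hq).1 q' (mem_pc.1 hq').1 hne)) (C * (ρ : ℝ) ^ ε) (by positivity) h α α2).trans ?_
    rw [hW, hE]
    gcongr
    · exact fun q hq => (mem_pc.1 hq).1
    · exact fun q hq => (mem_pc.1 hq).1
  have e : ∀ z, Psi Q1 Z α z * Psi Q2 Z α2 z = ∑ l ∈ L, ∑ l' ∈ L, Psi (pc Q1 Z l) Z α z * Psi (pc Q2 Z l') Z α2 z := by
    intro z
    rw [Psi_pc hd Q1 Z hP1, Psi_pc hd Q2 Z hP2, Finset.sum_mul_sum]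
  simp only [e]
  calc _ ≤ ∑ l ∈ L, ∑ l' ∈ L, W := (Nrm_sum hp1 _ _).trans (Finset.sum_le_sum fun l _ => (Nrm_sum hp1 _ _).trans (Finset.sum_le_sum fun l' _ => piece l l'))
    _ = (L.card : ℝ) * L.card * W := by simp only [Finset.sum_const, nsmul_eq_mul]; ring
    _ ≤ ((L.card : ℝ) * L.card + 1) * W := by nlinarith
    _ = _ := by rw [hW, hNr, mul_pow]; ring

end
end BR

namespace BR

section
variable {d : ℕ}

lemma mem_cube {c x : Fin d → ℝ} {r : ℝ} : x ∈ cube c r ↔ ∀ i, c i - r ≤ x i ∧ x i ≤ c i + r := by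
  unfold cube; simp only [Set.mem_Icc, Pi.le_def]; exact ⟨fun h i => ⟨h.1 i, h.2 i⟩, fun h => ⟨fun i => (h i).1, fun i => (h i).2⟩⟩

lemma sep_cubes (hd : 1 ≤ d) (c1 c2 : Fin d → ℝ) (r1 r2 D : ℝ) (h1 : 0 < r1) (h2 : 0 < r2) (hD0 : 0 < D)
    (hD : D ≤ setDist (cube c1 r1) (cube c2 r2)) :
    ∃ i0, (∀ i, |c2 i - c1 i| ≤ |c2 i0 - c1 i0|) ∧ D ≤ |c2 i0 - c1 i0| - r1 - r2 := by
  have : Nonempty (Fin d) := ⟨⟨0, hd⟩⟩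
  obtain ⟨i0, hi⟩ := Finite.exists_max (fun i => |c2 i - c1 i|)
  refine ⟨i0, hi, ?_⟩
  set L := |c2 i0 - c1 i0| with hL
  have hL0 : 0 ≤ L := abs_nonneg _
  set W := max L (r1 + r2) with hW
  have hW0 : 0 < W := lt_of_lt_of_le (by linarith) (le_max_right _ _)
  have hWL : L ≤ W := le_max_left _ _
  by_contra hlt
  push Not at hlt
  have key : ∀ r : ℝ, 0 < r → ∀ i, |r / W * (c2 i - c1 i)| ≤ r := by
    intro r hr i
    rw [abs_mul, abs_of_pos (by positivity)]
    calc r / W * |c2 i - c1 i| ≤ r / W * W := by gcongr; exact (hi i).trans hWL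
      _ = r := by field_simp
  have m1 : (fun i => c1 i + r1 / W * (c2 i - c1 i)) ∈ cube c1 r1 := by
    rw [mem_cube]; intro i; have := abs_le.1 (key r1 h1 i); constructor <;> linarith
  have m2 : (fun i => c2 i - r2 / W * (c2 i - c1 i)) ∈ cube c2 r2 := by
    rw [mem_cube]; intro i; have := abs_le.1 (key r2 h2 i); constructor <;> linarith
  have hle : setDist (cube c1 r1) (cube c2 r2) ≤ dist (fun i => c1 i + r1 / W * (c2 i - c1 i)) (fun i => c2 i - r2 / W * (c2 i - c1 i)) := by
    unfold setDist
    refine csInf_le ⟨0, ?_⟩ ⟨_, m1, _, m2, rfl⟩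
    rintro _ ⟨a, _, b, _, rfl⟩; exact dist_nonneg
  have : dist (fun i => c1 i + r1 / W * (c2 i - c1 i)) (fun i => c2 i - r2 / W * (c2 i - c1 i)) < D := by
    rw [dist_pi_lt_iff hD0]
    intro i
    have e : c1 i + r1 / W * (c2 i - c1 i) - (c2 i - r2 / W * (c2 i - c1 i)) = -((1 - (r1 + r2) / W) * (c2 i - c1 i)) := by ring
    have hq : (r1 + r2) / W ≤ 1 := by rw [div_le_one hW0]; exact le_max_right _ _
    rw [Real.dist_eq, e, abs_neg, abs_mul, abs_of_nonneg (by linarith)]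
    calc (1 - (r1 + r2) / W) * |c2 i - c1 i| ≤ (1 - (r1 + r2) / W) * L := mul_le_mul_of_nonneg_left (hi i) (by linarith)
      _ < D := by
        rcases le_total L (r1 + r2) with h | h
        · rw [hW, max_eq_right h, div_self (by linarith)]; linarith
        · rw [hW, max_eq_left h]
          have : 0 < L := by linarith
          rw [sub_mul, div_mul_cancel₀ _ this.ne']; linarith
  linarith

lemma cover {ι : Type*} (F : (Fin d → ℝ) × ℝ → ℝ) (hF : Continuous F) (h0 : ∀ w, 0 ≤ F w) (M : Finset ι) (zm : ι → (Fin d → ℝ) × ℝ)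
    (S : Set ((Fin d → ℝ) × ℝ)) (hS : MeasurableSet S) (h ht : ℝ) (hh : 0 ≤ h) (hht : 0 ≤ ht) (B : ℝ) (hB0 : 0 ≤ B)
    (hcov : ∀ w ∈ S, ∃ m ∈ M, w - zm m ∈ Set.Icc (0 : Fin d → ℝ) (fun _ => h) ×ˢ Set.Icc (0 : ℝ) ht)
    (hB : ∀ o, ∑ m ∈ M, F (o + zm m) ≤ B) :
    ∫ w in S, F w ≤ B * (h ^ d * ht) := by
  have inst : (volume : Measure ((Fin d → ℝ) × ℝ)).IsAddLeftInvariant := by rw [Measure.volume_eq_prod]; infer_instance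
  set cell := Set.Icc (0 : Fin d → ℝ) (fun _ => h) ×ˢ Set.Icc (0 : ℝ) ht with hcell
  have hcm : MeasurableSet cell := measurableSet_Icc.prod measurableSet_Icc
  have hfm : Measurable fun w => ENNReal.ofReal (F w) := (ENNReal.measurable_ofReal).comp hF.measurable
  rw [integral_eq_lintegral_of_nonneg_ae (Filter.Eventually.of_forall h0) hF.aestronglyMeasurable]
  apply ENNReal.toReal_le_of_le_ofReal (by positivity)
  have hvol : volume cell = ENNReal.ofReal (h ^ d * ht) := by
    rw [hcell, Measure.volume_eq_prod, Measure.prod_prod, Real.volume_Icc_pi, Real.volume_Icc]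
    simp only [Pi.zero_apply, sub_zero, Finset.prod_const, Finset.card_univ, Fintype.card_fin]
    rw [ENNReal.ofReal_mul (by positivity), ENNReal.ofReal_pow hh]
  calc ∫⁻ w in S, ENNReal.ofReal (F w) = ∫⁻ w, S.indicator (fun w => ENNReal.ofReal (F w)) w := (lintegral_indicator hS _).symm
    _ ≤ ∫⁻ w, ∑ m ∈ M, cell.indicator (fun o => ENNReal.ofReal (F (o + zm m))) (w - zm m) := by
        apply lintegral_mono
        intro w
        by_cases hw : w ∈ S
        · obtain ⟨m, hm, hc⟩ := hcov w hw
          simp only [Set.indicator_of_mem hw]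
          refine le_trans ?_ (Finset.single_le_sum (f := fun m => cell.indicator (fun o => ENNReal.ofReal (F (o + zm m))) (w - zm m)) (fun _ _ => bot_le) hm)
          simp only [Set.indicator_of_mem hc, sub_add_cancel]; exact le_rfl
        · simp only [Set.indicator_of_notMem hw]; exact bot_le
    _ = ∑ m ∈ M, ∫⁻ w, cell.indicator (fun o => ENNReal.ofReal (F (o + zm m))) (w - zm m) := by
        apply lintegral_finsetSum
        intro m _
        exact (Measurable.indicator (hfm.comp (measurable_id.add_const _)) hcm).comp (measurable_id.sub_const _)
    _ = ∑ m ∈ M, ∫⁻ o in cell, ENNReal.ofReal (F (o + zm m)) := by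
        refine Finset.sum_congr rfl fun m _ => ?_
        rw [lintegral_sub_right_eq_self (fun w => cell.indicator (fun o => ENNReal.ofReal (F (o + zm m))) w) (zm m), lintegral_indicator hcm]
    _ = ∫⁻ o in cell, ∑ m ∈ M, ENNReal.ofReal (F (o + zm m)) := by
        rw [lintegral_finsetSum]
        intro m _
        exact hfm.comp (measurable_id.add_const _)
    _ ≤ ∫⁻ o in cell, ENNReal.ofReal B := by
        apply lintegral_mono
        intro o
        simp only
        rw [← ENNReal.ofReal_sum_of_nonneg fun m _ => h0 _]
        exact ENNReal.ofReal_le_ofReal (hB o)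
    _ = ENNReal.ofReal (B * (h ^ d * ht)) := by
        rw [lintegral_const, Measure.restrict_apply MeasurableSet.univ, Set.univ_inter, hvol, ← ENNReal.ofReal_mul hB0]

/-- the exponential sum -/
def ES (Q : Finset (Fin d → ℝ)) (a : (Fin d → ℝ) → ℂ) (w : (Fin d → ℝ) × ℝ) : ℂ :=
  ∑ ξ ∈ Q, a ξ * Complex.exp (Complex.I * ((∑ i, w.1 i * ξ i) + w.2 * ∑ i, ξ i ^ 2))

lemma ES_cont (Q : Finset (Fin d → ℝ)) (a : (Fin d → ℝ) → ℂ) : Continuous (ES Q a) := by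
  unfold ES; fun_prop

/-- lattice points -/
def lat (xc ξ0 : Fin d → ℝ) (tc l : ℝ) (m : (Fin d → ℤ) × ℤ) : (Fin d → ℝ) × ℝ :=
  (fun i => xc i + 2 * π / l * m.1 i - 2 * (2 * π / l ^ 2) * m.2 * ξ0 i, tc + 2 * π / l ^ 2 * m.2)

lemma phase (xc ξ0 : Fin d → ℝ) (tc l : ℝ) (hl : 0 < l) (o : (Fin d → ℝ) × ℝ) (a : (Fin d → ℝ) → ℂ) :
    ∃ α : (Fin d → ℝ) → ℂ, (∀ ξ, ‖α ξ‖ = ‖a ξ‖) ∧ ∀ Q m, ‖ES Q a (o + lat xc ξ0 tc l m)‖ = ‖Psi Q (fun ξ i => (ξ i - ξ0 i) / l) α m‖ := by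
  have hpi := Real.pi_pos
  refine ⟨fun ξ => a ξ * ee ((∑ i, ((xc i + o.1 i) * ξ i + (tc + o.2) * ξ i ^ 2)) / (2 * π)), fun ξ => by rw [norm_mul, norm_ee, mul_one], ?_⟩
  intro Q m
  have : ES Q a (o + lat xc ξ0 tc l m) = ee (∑ i, (m.1 i * ξ0 i / l - m.2 * ξ0 i ^ 2 / l ^ 2)) *
      Psi Q (fun ξ i => (ξ i - ξ0 i) / l) (fun ξ => a ξ * ee ((∑ i, ((xc i + o.1 i) * ξ i + (tc + o.2) * ξ i ^ 2)) / (2 * π))) m := by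
    unfold ES Psi
    rw [Finset.mul_sum]
    refine Finset.sum_congr rfl fun ξ _ => ?_
    have e : ∀ A u v w : ℂ, u * (A * v * w) = A * (u * v * w) := fun A u v w => by ring
    rw [e, ← ee_add, ← ee_add]
    congr 1
    unfold ee
    congr 1
    rw [mul_comm]
    congr 1
    norm_cast
    have q : 2 * π * ((∑ i, (m.1 i * ξ0 i / l - m.2 * ξ0 i ^ 2 / l ^ 2)) + (∑ i, ((xc i + o.1 i) * ξ i + (tc + o.2) * ξ i ^ 2)) / (2 * π)
       + (∑ i, (m.1 i : ℝ) * ((ξ i - ξ0 i) / l) + m.2 * ∑ i, ((ξ i - ξ0 i) / l) ^ 2)) =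
       ∑ i, (2 * π * ((m.1 i * ξ0 i / l - m.2 * ξ0 i ^ 2 / l ^ 2)) + ((xc i + o.1 i) * ξ i + (tc + o.2) * ξ i ^ 2) + 2 * π * ((m.1 i : ℝ) * ((ξ i - ξ0 i) / l)) + 2 * π * (m.2 * ((ξ i - ξ0 i) / l) ^ 2)) := by
      simp only [Finset.sum_add_distrib, ← Finset.mul_sum]
      rw [mul_add, mul_add, mul_add, mul_div_cancel₀ _ (by positivity)]
      ring
    rw [q, Finset.mul_sum, ← Finset.sum_add_distrib]
    refine Finset.sum_congr rfl fun i _ => ?_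
    simp only [lat, Prod.fst_add, Prod.snd_add, Pi.add_apply]
    field_simp
    ring
  rw [this, norm_mul, norm_ee, one_mul]

lemma ball_cover (z : (Fin d → ℝ) × ℝ) (R l : ℝ) (ξ0 : Fin d → ℝ) (N : ℕ) (hd : 1 ≤ d) (hR : 1 ≤ R) (hl : 0 < l) (hl2 : l ≤ 40 * d) (hξ : ∀ i, |ξ0 i| ≤ 6)
    (hN : 14 * d * (l * R) < N) (w : (Fin d → ℝ) × ℝ) (hw : w ∈ ballR z R) :
    ∃ m ∈ box d N ×ˢ Finset.Ico (0 : ℤ) N, w - lat (fun i => z.1 i - 25 * R) ξ0 (z.2 - R) l m ∈ Set.Icc (0 : Fin d → ℝ) (fun _ => 2 * π / l) ×ˢ Set.Icc (0 : ℝ) (2 * π / l ^ 2) := by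
  have hd' : (1 : ℝ) ≤ d := by exact_mod_cast hd
  have hpi := Real.pi_gt_three
  unfold ballR at hw
  simp only [Set.mem_ofPred_eq] at hw
  have hs0 : 0 ≤ ∑ i, (w.1 i - z.1 i) ^ 2 := Finset.sum_nonneg fun i _ => sq_nonneg _
  have ht : |w.2 - z.2| ≤ R := abs_le_of_sq_le_sq (by linarith) (by linarith)
  have hx : ∀ i, |w.1 i - z.1 i| ≤ R := fun i => by
    have := Finset.single_le_sum (f := fun i => (w.1 i - z.1 i) ^ 2) (fun i _ => sq_nonneg _) (Finset.mem_univ i)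
    exact abs_le_of_sq_le_sq (by linarith [sq_nonneg (w.2 - z.2)]) (by linarith)
  set h := 2 * π / l with hh
  set k := 2 * π / l ^ 2 with hk
  have hh0 : 0 < h := by positivity
  have hk0 : 0 < k := by positivity
  have hdl : d * (l * R) ≥ l * R := by nlinarith [mul_pos hl (by linarith : 0 < R)]
  have hNh : 50 * R < N * h := by
    rw [hh, mul_div_assoc', lt_div_iff₀ hl]
    nlinarith
  have hNk : 2 * R < N * k := by
    rw [hk, mul_div_assoc', lt_div_iff₀ (by positivity)]
    have : R * l ^ 2 ≤ 40 * (d * (l * R)) := by nlinarith [mul_pos hl (by linarith : 0 < R)]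
    nlinarith
  set τ := ⌊(w.2 - (z.2 - R)) / k⌋ with hτ
  have t1 : (τ : ℝ) * k ≤ w.2 - (z.2 - R) := by rw [← le_div_iff₀ hk0]; exact Int.floor_le _
  have t2 : w.2 - (z.2 - R) < (τ + 1) * k := by rw [← div_lt_iff₀ hk0]; exact Int.lt_floor_add_one _
  have ht' := abs_le.1 ht
  have t0 : 0 ≤ τ := Int.floor_nonneg.2 (div_nonneg (by linarith) hk0.le)
  have t0' : (0 : ℝ) ≤ τ := by exact_mod_cast t0
  have t3 : τ < N := by rw [hτ, Int.floor_lt, div_lt_iff₀ hk0]; push_cast; linarith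
  have tk0 : 0 ≤ τ * k := by positivity
  have hb : ∀ i, |2 * k * τ * ξ0 i| ≤ 24 * R := fun i => by
    rw [abs_mul, abs_of_nonneg (by positivity)]
    calc 2 * k * τ * |ξ0 i| ≤ 2 * k * τ * 6 := by gcongr; exact hξ i
      _ ≤ _ := by linarith
  set A : Fin d → ℤ := fun i => ⌊(w.1 i - (z.1 i - 25 * R) + 2 * k * τ * ξ0 i) / h⌋ with hA
  have a1 : ∀ i, (A i : ℝ) * h ≤ w.1 i - (z.1 i - 25 * R) + 2 * k * τ * ξ0 i := fun i => by rw [← le_div_iff₀ hh0]; exact Int.floor_le _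
  have a2 : ∀ i, w.1 i - (z.1 i - 25 * R) + 2 * k * τ * ξ0 i < (A i + 1) * h := fun i => by rw [← div_lt_iff₀ hh0]; exact Int.lt_floor_add_one _
  refine ⟨(A, τ), ?_, ?_⟩
  · rw [Finset.mem_product, mem_box, Finset.mem_Ico]
    refine ⟨fun i => ?_, t0, t3⟩
    have h1 := abs_le.1 (hb i)
    have h2 := abs_le.1 (hx i)
    refine ⟨Int.floor_nonneg.2 (div_nonneg (by linarith) hh0.le), ?_⟩
    simp only [hA]
    rw [Int.floor_lt, div_lt_iff₀ hh0]; push_cast; linarith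
  · simp only [Set.mem_prod, Set.mem_Icc, Pi.le_def, lat, Prod.fst_sub, Prod.snd_sub, Pi.sub_apply, Pi.zero_apply, ← hh, ← hk]
    refine ⟨⟨fun i => ?_, fun i => ?_⟩, ?_, ?_⟩
    · linarith [a1 i]
    · linarith [a2 i]
    · linarith
    · linarith

lemma main_int (z : (Fin d → ℝ) × ℝ) (R l : ℝ) (ξ0 : Fin d → ℝ) (N : ℕ) (hd : 1 ≤ d) (hR : 1 ≤ R) (hl : 0 < l) (hl2 : l ≤ 40 * d) (hξ : ∀ i, |ξ0 i| ≤ 6)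
    (hN : 14 * d * (l * R) < N) (Q1 Q2 : Finset (Fin d → ℝ)) (a : (Fin d → ℝ) → ℂ) (p B : ℝ) (hp : 0 < p) (hB : 0 ≤ B)
    (H : ∀ α : (Fin d → ℝ) → ℂ, (∀ ξ, ‖α ξ‖ = ‖a ξ‖) → Nrm p (box d N ×ˢ Finset.Ico (0 : ℤ) N)
      (fun m => Psi Q1 (fun ξ i => (ξ i - ξ0 i) / l) α m * Psi Q2 (fun ξ i => (ξ i - ξ0 i) / l) α m) ≤ B) :
    ∫ w in ballR z R, (‖ES Q1 a w‖ * ‖ES Q2 a w‖) ^ p ≤ B ^ p * ((2 * π / l) ^ d * (2 * π / l ^ 2)) := by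
  have hpi := Real.pi_pos
  refine cover _ ?_ (fun w => by positivity) (box d N ×ˢ Finset.Ico (0 : ℤ) N) (lat (fun i => z.1 i - 25 * R) ξ0 (z.2 - R) l) _ ?_ _ _ (by positivity) (by positivity) _ (by positivity)
    (ball_cover z R l ξ0 N hd hR hl hl2 hξ hN) ?_
  · exact ((ES_cont Q1 a).norm.mul (ES_cont Q2 a).norm).rpow_const fun _ => Or.inr hp.le
  · apply IsOpen.measurableSet
    unfold ballR
    exact isOpen_lt (by fun_prop) (by fun_prop)
  · intro o
    obtain ⟨α, hα, hE⟩ := phase (fun i => z.1 i - 25 * R) ξ0 (z.2 - R) l hl o a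
    have := H α hα
    unfold Nrm at this
    rw [one_div, Real.rpow_inv_le_iff_of_pos (Finset.sum_nonneg fun _ _ => by positivity) hB hp] at this
    simpa only [hE, norm_mul] using this

lemma numerics (d : ℕ) (hd : 1 ≤ d) (p ε e' C K : ℝ) (hp : p = (d + 3) / (d + 1)) (hC : 0 < C) (hK : 0 < K) (he : 0 < e') (hee : e' ≤ ε) (he2 : e' ≤ 1 / (d + 3))
    (D l R A ρ I : ℝ) (hD : 0 < D) (hDl : D ≤ l) (hR : 1 ≤ R) (hRD : 1 ≤ R * D) (hA : 0 ≤ A) (hρ : 0 < ρ) (hρ2 : ρ ^ 2 ≤ K * (l * R)) (hI0 : 0 ≤ I)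
    (hI : I ≤ (C * ρ ^ (4 * e') * (ρ ^ 2) ^ d * A) ^ p * ((2 * π / l) ^ d * (2 * π / l ^ 2))) :
    I ^ (2 * p)⁻¹ ≤ (C ^ (2 : ℝ)⁻¹ * K ^ ((d : ℝ) / 2 + e') * (2 * π) ^ (((d : ℝ) + 1) * (2 * p)⁻¹)) * R ^ ((d : ℝ) / 2 + ε) * D ^ (-(1 / ((d : ℝ) + 3)) + ε) * A ^ (2 : ℝ)⁻¹ := by
  have hpi := Real.pi_pos
  have hd' : (1 : ℝ) ≤ d := by exact_mod_cast hd
  have hp0 : 0 < p := by rw [hp]; positivity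
  have hl : 0 < l := by linarith
  have hR0 : 0 < R := by linarith
  have hV : (2 * π / l) ^ d * (2 * π / l ^ 2) = (2 * π) ^ ((d : ℝ) + 1) * l ^ (-((d : ℝ) + 2)) := by
    rw [Real.rpow_neg hl.le]
    norm_cast
    rw [div_pow]; field_simp; ring
  have h1 : C * ρ ^ (4 * e') * (ρ ^ 2) ^ d * A ≤ C * (K * (l * R)) ^ ((d : ℝ) + 2 * e') * A := by
    have : ρ ^ (4 * e') * (ρ ^ 2) ^ d = (ρ ^ 2) ^ ((d : ℝ) + 2 * e') := by
      rw [Real.rpow_add (by positivity), Real.rpow_natCast, mul_comm, ← Real.rpow_natCast ρ 2, ← Real.rpow_mul hρ.le]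
      congr 2; push_cast; ring
    calc _ = C * (ρ ^ (4 * e') * (ρ ^ 2) ^ d) * A := by ring
      _ ≤ _ := by rw [this]; gcongr
  have h2 : I ^ (2 * p)⁻¹ ≤ ((C * (K * (l * R)) ^ ((d : ℝ) + 2 * e') * A) ^ p * ((2 * π) ^ ((d : ℝ) + 1) * l ^ (-((d : ℝ) + 2)))) ^ (2 * p)⁻¹ := by
    apply Real.rpow_le_rpow hI0 _ (by positivity)
    rw [hV] at hI
    refine hI.trans ?_
    gcongr
  refine h2.trans ?_
  have e1 : ((C * (K * (l * R)) ^ ((d : ℝ) + 2 * e') * A) ^ p * ((2 * π) ^ ((d : ℝ) + 1) * l ^ (-((d : ℝ) + 2)))) ^ (2 * p)⁻¹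
      = (C ^ (2 : ℝ)⁻¹ * K ^ ((d : ℝ) / 2 + e') * (2 * π) ^ (((d : ℝ) + 1) * (2 * p)⁻¹)) * R ^ ((d : ℝ) / 2 + e') * l ^ (-(1 / ((d : ℝ) + 3)) + e') * A ^ (2 : ℝ)⁻¹ := by
    rw [Real.mul_rpow (by positivity) (by positivity), ← Real.rpow_mul (by positivity), Real.mul_rpow (by positivity) (by positivity) (x := (2 * π) ^ ((d : ℝ) + 1)),
      ← Real.rpow_mul (by positivity), ← Real.rpow_mul (by positivity)]
    have q1 : p * (2 * p)⁻¹ = (2 : ℝ)⁻¹ := by field_simp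
    rw [q1, Real.mul_rpow (by positivity) hA, Real.mul_rpow (by positivity) (by positivity), ← Real.rpow_mul (by positivity)]
    have q2 : ((d : ℝ) + 2 * e') * 2⁻¹ = d / 2 + e' := by ring
    rw [q2, Real.mul_rpow (by positivity) (by positivity), Real.mul_rpow (by positivity) (by positivity)]
    have q3 : (-(1 / ((d : ℝ) + 3)) + e') = (d / 2 + e') + -((d : ℝ) + 2) * (2 * p)⁻¹ := by
      rw [hp]; field_simp; ring
    rw [q3, Real.rpow_add hl (d / 2 + e')]
    ring
  rw [e1]
  have h3 : l ^ (-(1 / ((d : ℝ) + 3)) + e') ≤ D ^ (-(1 / ((d : ℝ) + 3)) + e') := Real.rpow_le_rpow_of_nonpos hD hDl (by linarith)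
  have h4 : R ^ ((d : ℝ) / 2 + e') * D ^ (-(1 / ((d : ℝ) + 3)) + e') ≤ R ^ ((d : ℝ) / 2 + ε) * D ^ (-(1 / ((d : ℝ) + 3)) + ε) := by
    have : R ^ ((d : ℝ) / 2 + ε) * D ^ (-(1 / ((d : ℝ) + 3)) + ε) = R ^ ((d : ℝ) / 2 + e') * D ^ (-(1 / ((d : ℝ) + 3)) + e') * (R * D) ^ (ε - e') := by
      rw [Real.mul_rpow hR0.le hD.le]
      have : ∀ a b c f : ℝ, a * b * (c * f) = (a * c) * (b * f) := fun a b c f => by ring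
      rw [this, ← Real.rpow_add hR0, ← Real.rpow_add hD]
      congr 2 <;> ring
    rw [this]
    exact le_mul_of_one_le_right (by positivity) (Real.one_le_rpow hRD (by linarith))
  set G := (C ^ (2 : ℝ)⁻¹ * K ^ ((d : ℝ) / 2 + e') * (2 * π) ^ (((d : ℝ) + 1) * (2 * p)⁻¹)) with hG
  calc G * R ^ ((d : ℝ) / 2 + e') * l ^ (-(1 / ((d : ℝ) + 3)) + e') * A ^ (2 : ℝ)⁻¹
      ≤ G * R ^ ((d : ℝ) / 2 + e') * D ^ (-(1 / ((d : ℝ) + 3)) + e') * A ^ (2 : ℝ)⁻¹ := by gcongr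
    _ = G * (R ^ ((d : ℝ) / 2 + e') * D ^ (-(1 / ((d : ℝ) + 3)) + e')) * A ^ (2 : ℝ)⁻¹ := by ring
    _ ≤ G * (R ^ ((d : ℝ) / 2 + ε) * D ^ (-(1 / ((d : ℝ) + 3)) + ε)) * A ^ (2 : ℝ)⁻¹ := by gcongr
    _ = _ := by ring

end
end BR

namespace BR

section
variable {d : ℕ}

lemma config (hd : 1 ≤ d) (D : ℝ) (hD0 : 0 < D) (c1 c2 : Fin d → ℝ) (r1 r2 : ℝ) (hb1 : cube c1 r1 ⊆ bigCube d) (hb2 : cube c2 r2 ⊆ bigCube d)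
    (h1 : 0 < r1) (h1' : r1 ≤ D) (h2 : 0 < r2) (h2' : r2 ≤ D) (hs : D ≤ setDist (cube c1 r1) (cube c2 r2)) :
    ∃ (i0 : Fin d) (S : ℝ) (ξ0 : Fin d → ℝ), D ≤ S ∧ S ≤ 2 ∧ (∀ i, |ξ0 i| ≤ 6) ∧
      (∀ ξ, ξ ∈ cube c1 r1 ∨ ξ ∈ cube c2 r2 → ∀ i, 5 / 2 * S ≤ ξ i - ξ0 i ∧ ξ i - ξ0 i ≤ 15 / 2 * S) ∧
      (∀ q ∈ cube c1 r1, ∀ q' ∈ cube c1 r1, ∀ r ∈ cube c2 r2, ∀ r' ∈ cube c2 r2, S ^ 2 ≤ (q i0 - r i0) * (q' i0 - r' i0)) := by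
  obtain ⟨i0, hmax, hS⟩ := sep_cubes hd c1 c2 r1 r2 D h1 h2 hD0 hs
  have corner : ∀ (c : Fin d → ℝ) (r : ℝ), 0 < r → cube c r ⊆ bigCube d → ∀ i, -1 ≤ c i - r ∧ c i + r ≤ 1 := by
    intro c r hr hb i
    have m1 : (fun i => c i - r) ∈ cube c r := by rw [mem_cube]; intro i; constructor <;> linarith
    have m2 : (fun i => c i + r) ∈ cube c r := by rw [mem_cube]; intro i; constructor <;> linarith
    exact ⟨(hb m1).1 i, (hb m2).2 i⟩
  have k1 := corner c1 r1 h1 hb1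
  have k2 := corner c2 r2 h2 hb2
  set S := |c2 i0 - c1 i0| - r1 - r2 with hSd
  have hS2 : S ≤ 2 := by
    have : |c2 i0 - c1 i0| ≤ 2 := by
      rw [abs_le]; constructor <;> linarith [k1 i0, k2 i0]
    linarith
  refine ⟨i0, S, fun i => min (c1 i - r1) (c2 i - r2) - 5 / 2 * S, hS, hS2, ?_, ?_, ?_⟩
  · intro i
    have a : -1 ≤ min (c1 i - r1) (c2 i - r2) := le_min (k1 i).1 (k2 i).1
    have b : min (c1 i - r1) (c2 i - r2) ≤ 1 := (min_le_left _ _).trans (by linarith [(k1 i).2])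
    rw [abs_le]; constructor <;> linarith
  · intro ξ hξ i
    have hm := abs_le.1 ((hmax i).trans (by linarith : _ ≤ S + 2 * D))
    have a1 := min_le_left (c1 i - r1) (c2 i - r2)
    have a2 := min_le_right (c1 i - r1) (c2 i - r2)
    have a3 : c1 i + r1 ≤ min (c1 i - r1) (c2 i - r2) + 5 * S ∧ c2 i + r2 ≤ min (c1 i - r1) (c2 i - r2) + 5 * S := by
      rcases min_choice (c1 i - r1) (c2 i - r2) with h | h <;> rw [h] at a1 a2 ⊢ <;> constructor <;> linarith
    rcases hξ with h | h
    · have := mem_cube.1 h i; constructor <;> linarith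
    · have := mem_cube.1 h i; constructor <;> linarith
  · intro q hq q' hq' r hr r' hr'
    have e1 := mem_cube.1 hq i0
    have e2 := mem_cube.1 hq' i0
    have e3 := mem_cube.1 hr i0
    have e4 := mem_cube.1 hr' i0
    have S0 : 0 ≤ S := by linarith
    rcases le_total 0 (c2 i0 - c1 i0) with h | h
    · have hS' : S = c2 i0 - c1 i0 - r1 - r2 := by rw [hSd, abs_of_nonneg h]
      have u : S ≤ r i0 - q i0 := by linarith
      have v : S ≤ r' i0 - q' i0 := by linarith
      nlinarith [mul_le_mul u v S0 (by linarith)]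
    · have hS' : S = -(c2 i0 - c1 i0) - r1 - r2 := by rw [hSd, abs_of_nonpos h]
      have u : S ≤ q i0 - r i0 := by linarith
      have v : S ≤ q' i0 - r' i0 := by linarith
      nlinarith [mul_le_mul u v S0 (by linarith)]

theorem final (hd : 1 ≤ d) (p : ℝ) (hp : p = (d + 3) / (d + 1)) (ε : ℝ) (hε : 0 < ε) :
    ∃ Cε : ℝ, 0 < Cε ∧ ∀ (D : ℝ), 0 < D → D ≤ 1 → ∀ (c₁ c₂ : Fin d → ℝ) (r₁ r₂ : ℝ),
        cube c₁ r₁ ⊆ bigCube d → cube c₂ r₂ ⊆ bigCube d →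
        D / 2 ≤ 2 * r₁ → 2 * r₁ ≤ 2 * D → D / 2 ≤ 2 * r₂ → 2 * r₂ ≤ 2 * D →
        D ≤ setDist (cube c₁ r₁) (cube c₂ r₂) →
      ∀ (R : ℝ), 1 ≤ R → R⁻¹ ≤ D →
      ∀ (z : (Fin d → ℝ) × ℝ) (Ξ₁ Ξ₂ : Finset (Fin d → ℝ)),
        ↑Ξ₁ ⊆ cube c₁ r₁ → ↑Ξ₂ ⊆ cube c₂ r₂ →
        (∀ ξ ∈ Ξ₁, ∀ ξ' ∈ Ξ₁, ξ ≠ ξ' → R⁻¹ ≤ dist ξ ξ') →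
        (∀ ξ ∈ Ξ₂, ∀ ξ' ∈ Ξ₂, ξ ≠ ξ' → R⁻¹ ≤ dist ξ ξ') →
      ∀ (a : (Fin d → ℝ) → ℂ),
        (∫ w in ballR z R, (‖ES Ξ₁ a w‖ * ‖ES Ξ₂ a w‖) ^ p) ^ (2 * p)⁻¹
          ≤ Cε * R ^ ((d : ℝ) / 2 + ε) * D ^ (-(1 / ((d : ℝ) + 3)) + ε)
              * (√(∑ ξ ∈ Ξ₁, ‖a ξ‖ ^ 2) * √(∑ ξ ∈ Ξ₂, ‖a ξ‖ ^ 2)) ^ ((2 : ℝ)⁻¹) := by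
  have hpi := Real.pi_pos
  have hd' : (1 : ℝ) ≤ d := by exact_mod_cast hd
  have hp0 : 0 < p := by rw [hp]; positivity
  set e' := min ε (1 / ((d : ℝ) + 3)) with he'
  have he0 : 0 < e' := lt_min hε (by positivity)
  obtain ⟨k, hk, C, hC, H⟩ := discrete hd hp (4 * e') (by positivity)
  have hk' : (2 : ℝ) ≤ k := by exact_mod_cast hk
  set K : ℝ := k ^ 2 * (14 * d) with hK
  have hK0 : 0 < K := by positivity
  refine ⟨C ^ (2 : ℝ)⁻¹ * K ^ ((d : ℝ) / 2 + e') * (2 * π) ^ (((d : ℝ) + 1) * (2 * p)⁻¹), by positivity, ?_⟩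
  intro D hD0 hD1 c1 c2 r1 r2 hb1 hb2 hr1 hr1' hr2 hr2' hs R hR hRD z Q1 Q2 hQ1 hQ2 s1 s2 a
  obtain ⟨i0, S, ξ0, hDS, hS2, hξ0, hloc, htr⟩ := config hd D hD0 c1 c2 r1 r2 hb1 hb2 (by linarith) (by linarith) (by linarith) (by linarith) hs
  have hS0 : 0 < S := by linarith
  have hR0 : 0 < R := by linarith
  have hRD1 : 1 ≤ R * D := by
    rw [inv_le_iff_one_le_mul₀ hR0] at hRD; linarith
  set l := 20 * d * S with hl
  have hl0 : 0 < l := by positivity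
  have hDl : D ≤ l := by nlinarith
  have hlR : 1 ≤ l * R := by nlinarith
  have hx1 : 1 ≤ 14 * d * (l * R) := by nlinarith
  obtain ⟨j, hj1, hj2⟩ := exists_nat_pow_near hx1 (by nlinarith : (1 : ℝ) < (k : ℝ) ^ 2)
  set ρ := k ^ (j + 1) with hρ
  have hρ0 : 0 < ρ := by positivity
  have hρr : (0 : ℝ) < ρ := by exact_mod_cast hρ0
  have hρe : (ρ : ℝ) ^ 2 = ((k : ℝ) ^ 2) ^ (j + 1) := by rw [hρ]; push_cast; rw [← pow_mul, ← pow_mul, mul_comm]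
  have hρl : 14 * d * (l * R) < (ρ : ℝ) ^ 2 := by rw [hρe]; exact hj2
  have hρu : (ρ : ℝ) ^ 2 ≤ K * (l * R) := by
    rw [hρe, pow_succ, hK]
    nlinarith [sq_nonneg (k : ℝ)]
  have PBof : ∀ Q : Finset (Fin d → ℝ), (∀ q ∈ Q, q ∈ cube c1 r1 ∨ q ∈ cube c2 r2) → PB ((fun (ξ : Fin d → ℝ) (i : Fin d) => (ξ i - ξ0 i) / l) '' Q) := by
    rintro Q hQ _ ⟨q, hq, rfl⟩ i
    obtain ⟨u, v⟩ := hloc q (hQ q hq) i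
    simp only
    rw [le_div_iff₀ hl0, div_le_iff₀ hl0]
    have e1 : 1 / (8 * (d : ℝ)) * l = 5 / 2 * S := by rw [hl]; field_simp; norm_num
    have e3 : 3 / (8 * (d : ℝ)) * l = 15 / 2 * S := by rw [hl]; field_simp; norm_num
    rw [e1, e3]; exact ⟨u, v⟩
  have sepof : ∀ q q' : Fin d → ℝ, R⁻¹ ≤ dist q q' → 1 / (ρ : ℝ) ^ 2 ≤ dist (fun i => (q i - ξ0 i) / l) (fun i => (q' i - ξ0 i) / l) := by
    intro q q' h
    have e : dist q q' ≤ l * dist (fun i => (q i - ξ0 i) / l) (fun i => (q' i - ξ0 i) / l) := by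
      rw [dist_pi_le_iff (by positivity)]
      intro i
      have := dist_le_pi_dist (fun i => (q i - ξ0 i) / l) (fun i => (q' i - ξ0 i) / l) i
      calc dist (q i) (q' i) = l * dist ((q i - ξ0 i) / l) ((q' i - ξ0 i) / l) := by
            rw [Real.dist_eq, Real.dist_eq, ← sub_div, abs_div, abs_of_pos hl0, sub_sub_sub_cancel_right]; field_simp
        _ ≤ _ := by gcongr
    have e2 := h.trans e
    have : 1 / (ρ : ℝ) ^ 2 ≤ 1 / (l * R) := by
      apply one_div_le_one_div_of_le (by positivity)
      nlinarith
    refine this.trans ?_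
    rw [div_le_iff₀ (by positivity)]
    rw [inv_le_iff_one_le_mul₀ hR0] at e2
    linarith
  set A := √(∑ ξ ∈ Q1, ‖a ξ‖ ^ 2) * √(∑ ξ ∈ Q2, ‖a ξ‖ ^ 2) with hA
  refine numerics d hd p ε e' C K hp hC hK0 he0 (min_le_left _ _) (min_le_right _ _) D l R A ρ _ hD0 hDl hR hRD1 (by positivity) hρr hρu
    (integral_nonneg fun w => by positivity) ?_
  refine main_int z R l ξ0 (ρ ^ 2) hd hR hl0 (by rw [hl]; nlinarith) hξ0 (by push_cast; exact hρl) Q1 Q2 a p _ hp0 (by positivity) ?_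
  intro α hα
  have := H (j + 1) ρ hρ Q1 Q2 (fun ξ i => (ξ i - ξ0 i) / l) i0 (PBof Q1 fun q hq => Or.inl (hQ1 hq)) (PBof Q2 fun q hq => Or.inr (hQ2 hq)) ?_
    (fun q hq q' hq' hne => sepof q q' (s1 q hq q' hq' hne)) (fun q hq q' hq' hne => sepof q q' (s2 q hq q' hq' hne)) α α
  · simp only [hα] at this
    exact this
  · intro q hq q' hq' r hr r' hr'
    have := htr q (hQ1 hq) q' (hQ1 hq') r (hQ2 hr) r' (hQ2 hr')
    have e : ∀ x y : Fin d → ℝ, (x i0 - ξ0 i0) / l - (y i0 - ξ0 i0) / l = (x i0 - y i0) / l := fun x y => by ring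
    simp only [e]
    rw [div_mul_div_comm, le_div_iff₀ (by positivity)]
    have : (1 / (20 * d : ℝ)) ^ 2 * (l * l) = S ^ 2 := by rw [hl]; field_simp
    linarith

end
end BR

/-- the improved bilinear exponential sum estimate (estimate (5.16)),
at the bilinear exponent `q = 2(n+2)/n`. -/
theorem improved_bilinear_exponential_sum
    (n : ℕ) (hn : 2 ≤ n) (ε : ℝ) (hε : 0 < ε) :
    ∃ Cε : ℝ, 0 < Cε ∧
      ∀ (D : ℝ), 0 < D → D ≤ 1 →
      ∀ (c₁ c₂ : Fin (n - 1) → ℝ) (r₁ r₂ : ℝ),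
        cube c₁ r₁ ⊆ bigCube (n - 1) → cube c₂ r₂ ⊆ bigCube (n - 1) →
        D / 2 ≤ 2 * r₁ → 2 * r₁ ≤ 2 * D → D / 2 ≤ 2 * r₂ → 2 * r₂ ≤ 2 * D →
        D ≤ setDist (cube c₁ r₁) (cube c₂ r₂) →
      ∀ (R : ℝ), 1 ≤ R → R⁻¹ ≤ D →
      ∀ (z : (Fin (n - 1) → ℝ) × ℝ),
      ∀ (Ξ₁ Ξ₂ : Finset (Fin (n - 1) → ℝ)),
        ↑Ξ₁ ⊆ cube c₁ r₁ → ↑Ξ₂ ⊆ cube c₂ r₂ →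
        (∀ ξ ∈ Ξ₁, ∀ ξ' ∈ Ξ₁, ξ ≠ ξ' → R⁻¹ ≤ dist ξ ξ') →
        (∀ ξ ∈ Ξ₂, ∀ ξ' ∈ Ξ₂, ξ ≠ ξ' → R⁻¹ ≤ dist ξ ξ') →
      ∀ (a : (Fin (n - 1) → ℝ) → ℂ),
        (∫ w in ballR z R,
            (‖∑ ξ ∈ Ξ₁, a ξ *
                Complex.exp (Complex.I * ((∑ i, w.1 i * ξ i) + w.2 * ∑ i, ξ i ^ 2))‖ *
             ‖∑ ξ ∈ Ξ₂, a ξ *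
                Complex.exp (Complex.I * ((∑ i, w.1 i * ξ i) + w.2 * ∑ i, ξ i ^ 2))‖)
              ^ ((2 * ((n : ℝ) + 2) / (n : ℝ)) / 2)) ^ (2 * ((n : ℝ) + 2) / (n : ℝ))⁻¹
          ≤ Cε * R ^ (((n : ℝ) - 1) / 2 + ε)
              * D ^ (((n : ℝ) - 1) / 2 - ((n : ℝ) + 1) / (2 * ((n : ℝ) + 2) / (n : ℝ)) + ε)
              * ((∑ ξ ∈ Ξ₁, ‖a ξ‖ ^ 2) ^ ((2 : ℝ)⁻¹) *
                 (∑ ξ ∈ Ξ₂, ‖a ξ‖ ^ 2) ^ ((2 : ℝ)⁻¹)) ^ ((2 : ℝ)⁻¹) := by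
  obtain ⟨d, hd, hdn⟩ : ∃ d : ℕ, d = n - 1 ∧ n = d + 1 := ⟨n - 1, rfl, by omega⟩
  rw [← hd]
  have hd1 : 1 ≤ d := by omega
  have hnr : (n : ℝ) = d + 1 := by rw [hdn]; push_cast; ring
  obtain ⟨C, hC, H⟩ := BR.final hd1 (((d : ℝ) + 3) / (d + 1)) rfl ε hε
  refine ⟨C, hC, ?_⟩
  intro D a1 a2 c₁ c₂ r₁ r₂ a3 a4 a5 a6 a7 a8 a9 R b1 b2 z Ξ₁ Ξ₂ b3 b4 b5 b6 a
  have := H D a1 a2 c₁ c₂ r₁ r₂ a3 a4 a5 a6 a7 a8 a9 R b1 b2 z Ξ₁ Ξ₂ b3 b4 b5 b6 a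
  have e1 : (2 * ((n : ℝ) + 2) / (n : ℝ)) / 2 = ((d : ℝ) + 3) / (d + 1) := by rw [hnr]; field_simp; ring
  have e2 : 2 * ((n : ℝ) + 2) / (n : ℝ) = 2 * (((d : ℝ) + 3) / (d + 1)) := by rw [hnr]; field_simp; ring
  have e3 : ((n : ℝ) - 1) / 2 - ((n : ℝ) + 1) / (2 * ((n : ℝ) + 2) / (n : ℝ)) = -(1 / ((d : ℝ) + 3)) := by rw [hnr]; field_simp; ring
  have e4 : ((n : ℝ) - 1) / 2 = (d : ℝ) / 2 := by rw [hnr]; ring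
  rw [e1, e3, e2, e4]
  simp only [Real.sqrt_eq_rpow, one_div] at this ⊢
  exact this
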